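/- Let Ω be a properly convex quasi-homogeneous affine domain in ℝ⁴ whose asymptotic cone AC(Ω) is 3-dimensional (its linear span has dimension 3). Then Ω is affinely equivalent to one of the following: (i) {(x₁,x₂,x₃,x₄) ∈ ℝ⁴ | x₂ > x₁² and x₃ > 0 and x₄ > 0}; (ii) {(x₁,x₂,x₃,x₄) ∈ ℝ⁴ | x₃ > 0 and (x₂ − x₁²)·x₃ > x₄²}. -/

import Mathlib

open Matrix Set Filter Topology Pointwise

noncomputable section

/-- The affine action on ℝⁿ of an (n+1)×(n+1) invertible matrix in affine form
(ℝⁿ is identified with the hyperplane x_{n+1} = 1). -/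
def affAct (n : ℕ) (g : GL (Fin (n + 1)) ℝ) (x : Fin n → ℝ) : Fin n → ℝ :=
  fun i => (∑ j : Fin n, g.val i.castSucc j.castSucc * x j) + g.val i.castSucc (Fin.last n)

/-- A matrix in GL(n+1,ℝ) has affine form if its last row is (0, …, 0, 1). -/
def IsAffineForm (n : ℕ) (g : GL (Fin (n + 1)) ℝ) : Prop :=
  (∀ j : Fin n, g.val (Fin.last n) j.castSucc = 0) ∧ g.val (Fin.last n) (Fin.last n) = 1

/-- Aut(Ω): the group (here: set) of affine transformations of ℝⁿ preserving Ω,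
realized as affine-form matrices in GL(n+1,ℝ). -/
def AutSet (n : ℕ) (Ω : Set (Fin n → ℝ)) : Set (GL (Fin (n + 1)) ℝ) :=
  {g | IsAffineForm n g ∧ affAct n g '' Ω = Ω}

/-- Aut⁰(Ω): the identity component of Aut(Ω). -/
def AutIdComp (n : ℕ) (Ω : Set (Fin n → ℝ)) : Set (GL (Fin (n + 1)) ℝ) :=
  connectedComponentIn (AutSet n Ω) 1

/-- The limit set Λ_G of a subset G of Aut(Ω). -/
def limitSet (n : ℕ) (Ω : Set (Fin n → ℝ)) (G : Set (GL (Fin (n + 1)) ℝ)) :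
    Set (Fin n → ℝ) :=
  {ξ | ξ ∈ frontier Ω ∧ ∃ x ∈ Ω, ∃ u : ℕ → GL (Fin (n + 1)) ℝ,
    (∀ k, u k ∈ G) ∧ Filter.Tendsto (fun k => affAct n (u k) x) Filter.atTop (nhds ξ)}

/-- Ω is a convex affine domain: a nonempty open convex subset of ℝⁿ. -/
def IsConvexDomain (n : ℕ) (Ω : Set (Fin n → ℝ)) : Prop :=
  Ω.Nonempty ∧ IsOpen Ω ∧ Convex ℝ Ω

/-- Ω contains no complete affine line. -/
def HasNoLine (n : ℕ) (Ω : Set (Fin n → ℝ)) : Prop :=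
  ¬ ∃ x ∈ Ω, ∃ v : Fin n → ℝ, v ≠ 0 ∧ ∀ t : ℝ, x + t • v ∈ Ω

/-- Ω is a properly convex affine domain. -/
def IsProperlyConvexDomain (n : ℕ) (Ω : Set (Fin n → ℝ)) : Prop :=
  IsConvexDomain n Ω ∧ HasNoLine n Ω

/-- Ω is quasi-homogeneous: some compact K ⊆ Ω has ⋃_{g ∈ Aut(Ω)} g(K) = Ω. -/
def IsQuasiHomogeneous (n : ℕ) (Ω : Set (Fin n → ℝ)) : Prop :=
  ∃ K : Set (Fin n → ℝ), IsCompact K ∧ K ⊆ Ω ∧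
    (⋃ g ∈ AutSet n Ω, affAct n g '' K) = Ω

/-- Aut(Ω) is irreducible: it preserves no nonempty proper affine subspace of ℝⁿ. -/
def IsIrreducibleAut (n : ℕ) (Ω : Set (Fin n → ℝ)) : Prop :=
  ¬ ∃ S : AffineSubspace ℝ (Fin n → ℝ), (S : Set (Fin n → ℝ)).Nonempty ∧
      (S : Set (Fin n → ℝ)) ≠ Set.univ ∧
      ∀ g ∈ AutSet n Ω, affAct n g '' (S : Set (Fin n → ℝ)) = (S : Set (Fin n → ℝ))

/-- The asymptotic cone AC(Ω). -/
def asympCone (n : ℕ) (Ω : Set (Fin n → ℝ)) : Set (Fin n → ℝ) :=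
  {u | ∀ x ∈ Ω, ∀ t : ℝ, 0 ≤ t → x + t • u ∈ Ω}

/-- Ω is a cone with some vertex v. -/
def IsCone (n : ℕ) (Ω : Set (Fin n → ℝ)) : Prop :=
  ∃ v : Fin n → ℝ, ∀ x ∈ Ω, ∀ t : ℝ, 0 < t → v + t • (x - v) ∈ Ω

/-- Two subsets of ℝⁿ are affinely equivalent. -/
def AffinelyEquivalent (n : ℕ) (Ω Ω' : Set (Fin n → ℝ)) : Prop :=
  ∃ e : (Fin n → ℝ) ≃ᵃ[ℝ] (Fin n → ℝ), e '' Ω = Ω'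

/-- Γ acts freely on Ω. -/
def ActsFreely (n : ℕ) (Ω : Set (Fin n → ℝ)) (Γ : Set (GL (Fin (n + 1)) ℝ)) : Prop :=
  ∀ γ ∈ Γ, γ ≠ 1 → ∀ x ∈ Ω, affAct n γ x ≠ x

/-- Γ acts properly discontinuously on Ω. -/
def ActsProperlyDiscontinuously (n : ℕ) (Ω : Set (Fin n → ℝ))
    (Γ : Set (GL (Fin (n + 1)) ℝ)) : Prop :=
  ∀ K L : Set (Fin n → ℝ), K ⊆ Ω → L ⊆ Ω → IsCompact K → IsCompact L →
    {γ ∈ Γ | (affAct n γ '' K ∩ L).Nonempty}.Finite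

/-- Γ acts cocompactly on Ω. -/
def ActsCocompactly (n : ℕ) (Ω : Set (Fin n → ℝ)) (Γ : Set (GL (Fin (n + 1)) ℝ)) : Prop :=
  ∃ K : Set (Fin n → ℝ), IsCompact K ∧ K ⊆ Ω ∧ (⋃ γ ∈ Γ, affAct n γ '' K) = Ω

/-- The linear part of an affine-form matrix has determinant one. -/
def LinearPartDetOne (n : ℕ) (g : GL (Fin (n + 1)) ℝ) : Prop :=
  (Matrix.of fun i j : Fin n => g.val i.castSucc j.castSucc).det = 1

/-- A closed convex cone which contains no line and has nonempty interior. -/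
structure IsSolidCone {V : Type*} [NormedAddCommGroup V] [NormedSpace ℝ V] (C : Set V) : Prop where
  closed : IsClosed C
  add_mem : ∀ x ∈ C, ∀ y ∈ C, x + y ∈ C
  smul_mem : ∀ t : ℝ, 0 ≤ t → ∀ x ∈ C, t • x ∈ C
  pointed : ∀ x ∈ C, -x ∈ C → x = 0
  interior_nonempty : (interior C).Nonempty

namespace IsSolidCone

variable {V : Type*} [NormedAddCommGroup V] [NormedSpace ℝ V] {C : Set V}

lemma zero_mem (hC : IsSolidCone C) : (0 : V) ∈ C := by
  obtain ⟨u, hu⟩ := hC.interior_nonempty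
  simpa using hC.smul_mem 0 le_rfl u (interior_subset hu)

lemma convex (hC : IsSolidCone C) : Convex ℝ C := by
  intro x hx y hy a b ha hb _
  exact hC.add_mem _ (hC.smul_mem a ha x hx) _ (hC.smul_mem b hb y hy)

lemma add_mem_interior (hC : IsSolidCone C) {u c : V} (hu : u ∈ interior C) (hc : c ∈ C) :
    u + c ∈ interior C := by
  have h1 : IsOpen ((fun x => x - c) ⁻¹' interior C) :=
    isOpen_interior.preimage (by fun_prop)
  refine interior_maximal ?_ h1 (show u + c - c ∈ interior C by simpa using hu)
  intro x hx
  have := hC.add_mem _ (interior_subset hx) c hc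
  simpa using this

lemma smul_mem_interior (hC : IsSolidCone C) {u : V} {t : ℝ} (ht : 0 < t)
    (hu : u ∈ interior C) : t • u ∈ interior C := by
  have h1 : IsOpen ((fun x => t⁻¹ • x) ⁻¹' interior C) :=
    isOpen_interior.preimage (by fun_prop)
  refine interior_maximal ?_ h1 (show t⁻¹ • t • u ∈ interior C by
    rwa [smul_smul, inv_mul_cancel₀ ht.ne', one_smul])
  intro x hx
  have := hC.smul_mem t ht.le _ (interior_subset hx)
  simpa [smul_smul, mul_inv_cancel₀ ht.ne'] using this

lemma mem_interior_iff {u : V} :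
    u ∈ interior C ↔ ∃ δ > 0, ∀ v : V, ‖v‖ ≤ δ → u + v ∈ C := by
  constructor
  · intro hu
    obtain ⟨ε, hε, h⟩ := Metric.isOpen_iff.1 isOpen_interior u hu
    refine ⟨ε / 2, by positivity, fun v hv => interior_subset (h ?_)⟩
    simp only [Metric.mem_ball, dist_self_add_left]
    linarith
  · rintro ⟨δ, hδ, h⟩
    refine mem_interior.2 ⟨Metric.ball u δ, ?_, Metric.isOpen_ball, Metric.mem_ball_self hδ⟩
    intro x hx
    have := h (x - u) (by simpa [dist_eq_norm] using (Metric.mem_ball.1 hx).le)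
    simpa using this

/-- Uniform inner radius along a compact subset of an open set. -/
lemma exists_uniform_radius {K U : Set V} (hK : IsCompact K) (hU : IsOpen U) (hKU : K ⊆ U) :
    ∃ δ > 0, ∀ k ∈ K, ∀ v : V, ‖v‖ ≤ δ → k + v ∈ U := by
  obtain ⟨δ, hδ, h⟩ := hK.exists_cthickening_subset_open hU hKU
  refine ⟨δ, hδ, fun k hk v hv => h ?_⟩
  exact Metric.mem_cthickening_of_dist_le _ k δ K hk (by simpa using hv)

lemma zero_notMem_interior (hC : IsSolidCone C) [Nontrivial V] : (0 : V) ∉ interior C := by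
  intro h
  obtain ⟨δ, hδ, h⟩ := mem_interior_iff.1 h
  obtain ⟨x, hx⟩ := exists_ne (0 : V)
  have hn : 0 < ‖x‖ := norm_pos_iff.2 hx
  have h1 := h ((δ / ‖x‖) • x) (by
    rw [norm_smul, Real.norm_of_nonneg (by positivity), div_mul_cancel₀ _ hn.ne'])
  have h2 := h (-((δ / ‖x‖) • x)) (by
    rw [norm_neg, norm_smul, Real.norm_of_nonneg (by positivity), div_mul_cancel₀ _ hn.ne'])
  rw [zero_add] at h1 h2
  have := hC.pointed _ h1 h2
  rw [smul_eq_zero] at this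
  rcases this with h | h
  · exact (div_pos hδ hn).ne' h
  · exact hx h

/-- Every vector is bounded by a multiple of an interior vector. -/
lemma exists_sub_mem (hC : IsSolidCone C) {u : V} (hu : u ∈ interior C) (v : V) :
    ∃ t : ℝ, 0 < t ∧ t • u - v ∈ interior C := by
  have h1 : Tendsto (fun t : ℝ => u - t • v) (𝓝[>] 0) (𝓝 (u - (0 : ℝ) • v)) :=
    (Continuous.tendsto (by fun_prop) 0).mono_left nhdsWithin_le_nhds
  rw [zero_smul, sub_zero] at h1
  have h2 := h1.eventually (isOpen_interior.mem_nhds hu)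
  obtain ⟨t, ht, ht0⟩ := (h2.and self_mem_nhdsWithin).exists
  have ht0 : 0 < t := ht0
  refine ⟨t⁻¹, inv_pos.2 ht0, ?_⟩
  have := hC.smul_mem_interior (inv_pos.2 ht0) ht
  simpa [smul_sub, smul_smul, inv_mul_cancel₀ ht0.ne'] using this

variable [FiniteDimensional ℝ V]

/-- A linear functional dominating the norm on the cone. -/
lemma exists_strict_functional (hC : IsSolidCone C) :
    ∃ ℓ : V →L[ℝ] ℝ, ∀ c ∈ C, ‖c‖ ≤ ℓ c := by
  have hloc : ∀ c : V, ∃ ℓ : V →L[ℝ] ℝ, (∀ x ∈ C, 0 ≤ ℓ x) ∧ (c ∈ C → c ≠ 0 → 0 < ℓ c) := by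
    intro c
    by_cases hc : c ∈ C ∧ c ≠ 0
    swap
    · exact ⟨0, fun _ _ => le_rfl, fun h h' => (hc ⟨h, h'⟩).elim⟩
    have hnc : -c ∉ C := fun h => hc.2 (hC.pointed c hc.1 h)
    obtain ⟨f, u, hf1, hf2⟩ := geometric_hahn_banach_point_closed hC.convex hC.closed hnc
    have hu0 : u < 0 := by simpa using hf2 0 hC.zero_mem
    refine ⟨f, fun x hx => ?_, fun _ _ => ?_⟩
    · by_contra hneg
      have hneg : f x < 0 := not_le.1 hneg
      have h1 := hf2 _ (hC.smul_mem (u / f x) (div_nonneg_of_nonpos hu0.le hneg.le) x hx)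
      rw [map_smul, smul_eq_mul, div_mul_cancel₀ _ hneg.ne] at h1
      exact lt_irrefl _ h1
    · rw [map_neg] at hf1
      linarith
  choose L hL1 hL2 using hloc
  have hcomp : IsCompact (C ∩ Metric.sphere (0 : V) 1) := (isCompact_sphere 0 1).inter_left hC.closed
  obtain ⟨t, -, ht⟩ := hcomp.elim_nhds_subcover (fun c => {x | 0 < L c x})
    (by
      intro c hc
      have hc0 : c ≠ 0 := by
        rintro rfl
        simpa using hc.2
      exact (isOpen_lt continuous_const (L c).continuous).mem_nhds (hL2 c hc.1 hc0))
  set f : V →L[ℝ] ℝ := ∑ c ∈ t, L c with hf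
  have hfpos : ∀ x ∈ C ∩ Metric.sphere (0 : V) 1, 0 < f x := by
    intro x hx
    obtain ⟨c, hct, hcx⟩ := mem_iUnion₂.1 (ht hx)
    rw [hf, _root_.sum_apply]
    exact Finset.sum_pos' (fun i _ => hL1 i x hx.1) ⟨c, hct, hcx⟩
  rcases (C ∩ Metric.sphere (0 : V) 1).eq_empty_or_nonempty with he | hne
  · refine ⟨0, fun c hc => ?_⟩
    by_contra h
    have hn : 0 < ‖c‖ := by simpa using h
    have : ‖c‖⁻¹ • c ∈ C ∩ Metric.sphere (0 : V) 1 :=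
      ⟨hC.smul_mem _ (by positivity) c hc, by simp [norm_smul, hn.ne']⟩
    rw [he] at this
    exact this
  obtain ⟨x₀, hx₀, hmin⟩ := hcomp.exists_isMinOn hne f.continuous.continuousOn
  have hm := hfpos x₀ hx₀
  refine ⟨(f x₀)⁻¹ • f, fun c hc => ?_⟩
  rcases eq_or_ne c 0 with rfl | hc0
  · simp
  have hn : 0 < ‖c‖ := norm_pos_iff.2 hc0
  have h1 : f x₀ ≤ f (‖c‖⁻¹ • c) :=
    hmin ⟨hC.smul_mem _ (by positivity) c hc, by simp [norm_smul, hn.ne']⟩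
  rw [map_smul, smul_eq_mul, inv_mul_eq_div, le_div_iff₀ hn] at h1
  show ‖c‖ ≤ (f x₀)⁻¹ * f c
  rw [inv_mul_eq_div, le_div_iff₀ hm]
  linarith

lemma exists_normal (hC : IsSolidCone C) :
    ∃ N > 0, ∀ p ∈ C, ∀ q ∈ C, ‖p‖ ≤ N * ‖p + q‖ := by
  obtain ⟨ℓ, hℓ⟩ := hC.exists_strict_functional
  refine ⟨‖ℓ‖ + 1, by positivity, fun p hp q hq => ?_⟩
  have h1 := hℓ p hp
  have h2 := (norm_nonneg q).trans (hℓ q hq)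
  have h3 : ℓ (p + q) ≤ ‖ℓ‖ * ‖p + q‖ := (le_abs_self _).trans (ℓ.le_opNorm _)
  rw [map_add] at h3
  nlinarith [norm_nonneg (p + q)]

/-- A cone-preserving linear map is bounded by its value at an interior vector. -/
lemma exists_bound (hC : IsSolidCone C) :
    ∃ N > 0, ∀ (A : V →ₗ[ℝ] V), (∀ c ∈ C, A c ∈ C) → ∀ (u : V) (δ : ℝ), 0 < δ →
      (∀ v, ‖v‖ ≤ δ → u + v ∈ C) → ∀ v, ‖A v‖ ≤ N / δ * ‖A u‖ * ‖v‖ := by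
  obtain ⟨N, hN, h⟩ := hC.exists_normal
  refine ⟨2 * N + 1, by positivity, fun A hA u δ hδ hu v => ?_⟩
  rcases eq_or_ne v 0 with rfl | hv
  · simp
  have hn : 0 < ‖v‖ := norm_pos_iff.2 hv
  set v' := (δ / ‖v‖) • v with hv'
  have hv'n : ‖v'‖ = δ := by
    rw [hv', norm_smul, Real.norm_of_nonneg (by positivity), div_mul_cancel₀ _ hn.ne']
  have h1 := hA _ (hu v' hv'n.le)
  have h2 := hA _ (hu (-v') (by rw [norm_neg]; exact hv'n.le))
  have h3 := h _ h1 _ h2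
  have e : A (u + v') + A (u + -v') = (2 : ℝ) • A u := by
    simp only [map_add, map_neg, two_smul]; abel
  rw [e, norm_smul, Real.norm_of_nonneg (by norm_num : (0 : ℝ) ≤ 2)] at h3
  have h4 : ‖A v'‖ ≤ (2 * N + 1) * ‖A u‖ := by
    have : A v' = A (u + v') - A u := by simp
    rw [this]
    refine (norm_sub_le _ _).trans ?_
    linarith
  have h5 : v = (‖v‖ / δ) • v' := by
    have h6 : ‖v‖ / δ * (δ / ‖v‖) = 1 := by field_simp
    rw [hv', smul_smul, h6, one_smul]
  calc ‖A v‖ = ‖v‖ / δ * ‖A v'‖ := by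
        conv_lhs => rw [h5]
        rw [map_smul, norm_smul, Real.norm_of_nonneg (by positivity)]
    _ ≤ ‖v‖ / δ * ((2 * N + 1) * ‖A u‖) := by gcongr
    _ = _ := by ring

/-- Vectors decompose as bounded differences of cone elements. -/
lemma exists_bound_of_cone (hC : IsSolidCone C) :
    ∃ N > 0, ∀ (A : V →ₗ[ℝ] V) (r : ℝ), (∀ c ∈ C, ‖A c‖ ≤ r * ‖c‖) →
      ∀ v, ‖A v‖ ≤ N * r * ‖v‖ := by
  obtain ⟨u, hu⟩ := hC.interior_nonempty
  obtain ⟨δ, hδ, h⟩ := mem_interior_iff.1 hu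
  refine ⟨(2 * ‖u‖ + δ) / δ, by positivity, fun A r hA v => ?_⟩
  rcases eq_or_ne v 0 with rfl | hv
  · simp
  have hn : 0 < ‖v‖ := norm_pos_iff.2 hv
  set v' := (δ / ‖v‖) • v with hv'
  have hv'n : ‖v'‖ = δ := by
    rw [hv', norm_smul, Real.norm_of_nonneg (by positivity), div_mul_cancel₀ _ hn.ne']
  have h1 := hA _ (h v' hv'n.le)
  have h2 := hA u (interior_subset hu)
  have hv0 : 0 ≤ r := by
    by_contra hr
    have hu0 : u + v' = 0 := by
      by_contra hne
      have := norm_pos_iff.2 hne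
      nlinarith [norm_nonneg (A (u + v'))]
    have hu1 : u = 0 := by
      by_contra hne
      have := norm_pos_iff.2 hne
      nlinarith [norm_nonneg (A u)]
    rw [hu1, zero_add] at hu0
    rw [hu0, norm_zero] at hv'n
    linarith
  have h4 : ‖A v'‖ ≤ r * (2 * ‖u‖ + δ) := by
    have : A v' = A (u + v') - A u := by simp
    rw [this]
    refine (norm_sub_le _ _).trans ?_
    have := mul_le_mul_of_nonneg_left (norm_add_le u v') hv0
    rw [hv'n] at this
    linarith
  have h5 : v = (‖v‖ / δ) • v' := by
    have h6 : ‖v‖ / δ * (δ / ‖v‖) = 1 := by field_simp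
    rw [hv', smul_smul, h6, one_smul]
  calc ‖A v‖ = ‖v‖ / δ * ‖A v'‖ := by
        conv_lhs => rw [h5]
        rw [map_smul, norm_smul, Real.norm_of_nonneg (by positivity)]
    _ ≤ ‖v‖ / δ * (r * (2 * ‖u‖ + δ)) := by gcongr
    _ = _ := by ring

end IsSolidCone

/-- A group acting on the line by the affine maps `s ↦ a g * s + b g` and linearly on `V`. -/
structure BaseAction (G V : Type*) [Group G] [AddCommGroup V] [Module ℝ V] where
  a : G → ℝ
  b : G → ℝ
  A : G →* (V ≃ₗ[ℝ] V)
  a_ne : ∀ g, a g ≠ 0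
  a_mul : ∀ g h, a (g * h) = a g * a h
  b_mul : ∀ g h, b (g * h) = a g * b h + b g

namespace BaseAction

variable {G V : Type*} [Group G] [AddCommGroup V] [Module ℝ V] (X : BaseAction G V)

/-- The action on the line. -/
def act (g : G) (s : ℝ) : ℝ := X.a g * s + X.b g

lemma a_one : X.a 1 = 1 := by
  have := X.a_mul 1 1
  rw [mul_one] at this
  exact (mul_eq_left₀ (X.a_ne 1)).1 this.symm

lemma b_one : X.b 1 = 0 := by
  have := X.b_mul 1 1
  rw [mul_one, X.a_one] at this
  linarith

lemma act_one (s : ℝ) : X.act 1 s = s := by simp [act, X.a_one, X.b_one]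

lemma act_mul (g h : G) (s : ℝ) : X.act (g * h) s = X.act g (X.act h s) := by
  simp only [act, X.a_mul, X.b_mul]; ring

lemma act_inv_act (g : G) (s : ℝ) : X.act g⁻¹ (X.act g s) = s := by
  rw [← act_mul, inv_mul_cancel, act_one]

lemma act_act_inv (g : G) (s : ℝ) : X.act g (X.act g⁻¹ s) = s := by
  rw [← act_mul, mul_inv_cancel, act_one]

lemma act_sub (g : G) (s t : ℝ) : X.act g s - X.act g t = X.a g * (s - t) := by
  simp only [act]; ring

lemma act_add (g : G) (s t : ℝ) : X.act g (s + t) = X.act g s + X.a g * t := by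
  simp only [act]; ring

lemma a_inv (g : G) : X.a g⁻¹ = (X.a g)⁻¹ := by
  have := X.a_mul g⁻¹ g
  rw [inv_mul_cancel, X.a_one] at this
  exact eq_inv_of_mul_eq_one_left this.symm

lemma b_inv (g : G) : X.b g⁻¹ = -(X.b g / X.a g) := by
  have := X.act_inv_act g 0
  simp only [act, a_inv] at this
  have h := X.a_ne g
  field_simp at this ⊢
  linarith

lemma a_pow (g : G) (n : ℕ) : X.a (g ^ n) = X.a g ^ n := by
  induction n with
  | zero => simp [X.a_one]
  | succ n ih => rw [pow_succ, X.a_mul, ih, pow_succ]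

lemma A_inv_apply (g : G) (v : V) : X.A g⁻¹ v = (X.A g).symm v := by
  rw [map_inv]; rfl

lemma A_inv_A (g : G) (v : V) : X.A g⁻¹ (X.A g v) = v := by
  rw [A_inv_apply, LinearEquiv.symm_apply_apply]

lemma A_A_inv (g : G) (v : V) : X.A g (X.A g⁻¹ v) = v := by
  rw [A_inv_apply, LinearEquiv.apply_symm_apply]

lemma A_mul_apply (g h : G) (v : V) : X.A (g * h) v = X.A g (X.A h v) := by
  rw [map_mul]; rfl

/-- The translation parts of the elements with trivial multiplier. -/
def translations : AddSubgroup ℝ where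
  carrier := {β | ∃ g, X.a g = 1 ∧ X.b g = β}
  zero_mem' := ⟨1, X.a_one, X.b_one⟩
  add_mem' := by
    rintro _ _ ⟨g, hg, rfl⟩ ⟨h, hh, rfl⟩
    exact ⟨h * g, by rw [X.a_mul, hg, hh, one_mul], by rw [X.b_mul, hh, one_mul]⟩
  neg_mem' := by
    rintro _ ⟨g, hg, rfl⟩
    exact ⟨g⁻¹, by rw [X.a_inv, hg, inv_one], by rw [X.b_inv, hg, div_one]⟩

/-- Every point can be moved to a fixed bounded set by elements with arbitrarily large
multiplier. -/
def IsExpanding : Prop := ∃ J, ∀ s M, ∃ g, |X.act g s| ≤ J ∧ M < |X.a g|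

variable {X}

lemma a_conj_pow (g h : G) (n : ℕ) (hh : X.a h = 1) : X.a (g ^ n * h * (g ^ n)⁻¹) = 1 := by
  rw [X.a_mul, X.a_mul, hh, X.a_inv, mul_one, mul_inv_cancel₀ (X.a_ne _)]

lemma b_conj_pow (g h : G) (n : ℕ) (hh : X.a h = 1) :
    X.b (g ^ n * h * (g ^ n)⁻¹) = X.a g ^ n * X.b h := by
  have h1 := X.a_ne (g ^ n)
  rw [X.b_mul, X.b_mul, X.a_mul, hh, X.b_inv, ← X.a_pow]
  field_simp
  ring

lemma IsExpanding.exists_contracting (hX : X.IsExpanding) : ∃ g, |X.a g| < 1 := by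
  obtain ⟨J, hJ⟩ := hX
  obtain ⟨g, -, hg⟩ := hJ 0 1
  refine ⟨g⁻¹, ?_⟩
  rw [X.a_inv, abs_inv]
  exact inv_lt_one_of_one_lt₀ hg

lemma IsExpanding.exists_translation (hX : X.IsExpanding) : ∃ g, X.a g = 1 ∧ X.b g ≠ 0 := by
  obtain ⟨J, hJ⟩ := hX
  obtain ⟨g, -, hg⟩ := hJ 0 1
  have hne : 1 - X.a g ≠ 0 := by
    intro h
    rw [show X.a g = 1 by linarith, abs_one] at hg
    exact lt_irrefl _ hg
  set p := X.b g / (1 - X.a g) with hp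
  have hb : X.b g = p * (1 - X.a g) := by rw [hp, div_mul_cancel₀ _ hne]
  obtain ⟨h, hh1, hh2⟩ := hJ (p + 1) (J + |p|)
  set q := X.act h p with hq
  have hqp : p - q ≠ 0 := by
    intro h0
    have e := X.act_sub h (p + 1) p
    rw [← hq, show q = p by linarith, add_sub_cancel_left, mul_one] at e
    rw [← e] at hh2
    have := abs_sub (X.act h (p + 1)) p
    linarith
  refine ⟨g * (h * g * h⁻¹)⁻¹, ?_, ?_⟩
  · have h1 := X.a_ne g
    have h2 := X.a_ne h
    simp only [X.a_mul, X.a_inv]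
    field_simp
  · have hbq : X.b h = q - X.a h * p := by rw [hq, act]; ring
    have h1 := X.a_ne g
    have h2 := X.a_ne h
    have : X.b (g * (h * g * h⁻¹)⁻¹) = (1 - X.a g) * (p - q) := by
      simp only [X.b_mul, X.a_mul, X.a_inv, X.b_inv, hbq, hb]
      field_simp
      ring
    rw [this]
    exact mul_ne_zero hne hqp

lemma IsExpanding.dense_translations (hX : X.IsExpanding) :
    Dense (X.translations : Set ℝ) := by
  obtain ⟨g, hg⟩ := hX.exists_contracting
  obtain ⟨h, hh, hb⟩ := hX.exists_translation
  refine AddSubgroup.dense_of_not_isolated_zero _ fun ε hε => ?_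
  have h1 : Tendsto (fun n => |X.a g| ^ n * |X.b h|) atTop (𝓝 (0 * |X.b h|)) :=
    (tendsto_pow_atTop_nhds_zero_of_lt_one (abs_nonneg _) hg).mul_const _
  rw [zero_mul] at h1
  obtain ⟨n, hn⟩ := (h1.eventually (gt_mem_nhds hε)).exists
  have hmem : X.a g ^ n * X.b h ∈ X.translations :=
    ⟨_, a_conj_pow g h n hh, b_conj_pow g h n hh⟩
  have hne : X.a g ^ n * X.b h ≠ 0 := mul_ne_zero (pow_ne_zero _ (X.a_ne g)) hb
  refine ⟨|X.a g ^ n * X.b h|, ?_, abs_pos.2 hne, by rwa [abs_mul, abs_pow]⟩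
  rcases abs_choice (X.a g ^ n * X.b h) with e | e <;> rw [e]
  · exact hmem
  · exact neg_mem hmem

end BaseAction

/-- The symmetric second difference of a function on the line. -/
def secondDiff {V : Type*} [AddCommGroup V] [Module ℝ V] (f : ℝ → V) (r s : ℝ) : V :=
  f (s + r) + f (s - r) - (2 : ℝ) • f s

/-- A continuous function on the line with vanishing second differences is affine. -/
lemma affine_of_secondDiff_eq_zero {V : Type*} [NormedAddCommGroup V] [NormedSpace ℝ V]
    {f : ℝ → V} (hf : Continuous f) (h0 : ∀ r s, secondDiff f r s = 0) (t : ℝ) :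
    f t = f 0 + t • (f 1 - f 0) := by
  have hadd : ∀ x y, f (x + y) - f 0 = (f x - f 0) + (f y - f 0) := by
    intro x y
    have h1 := h0 ((x - y) / 2) ((x + y) / 2)
    have h2 := h0 ((x + y) / 2) ((x + y) / 2)
    unfold secondDiff at h1 h2
    rw [show (x + y) / 2 + (x - y) / 2 = x by ring,
      show (x + y) / 2 - (x - y) / 2 = y by ring] at h1
    rw [add_halves, sub_self] at h2
    linear_combination (norm := module) h2 - h1
  set L : ℝ →+ V := ⟨⟨fun x => f x - f 0, sub_self _⟩, hadd⟩
  have hLc : Continuous L := hf.sub continuous_const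
  have h1 : f t - f 0 = t • (f 1 - f 0) := by
    have := (L.toRealLinearMap hLc).map_smul t 1
    rwa [smul_eq_mul, mul_one] at this
  rw [← h1, add_sub_cancel]

/-- A continuous function on the line whose second differences lie in a solid cone and are
permuted by a group acting cocompactly on the product of the line and the cone. -/
structure IsEquivariantProfile {G V : Type*} [Group G] [NormedAddCommGroup V] [NormedSpace ℝ V]
    (X : BaseAction G V) (C : Set V) (f : ℝ → V) : Prop where
  cone : IsSolidCone C
  map_mem : ∀ g, ∀ c ∈ C, X.A g c ∈ C
  continuous : Continuous f
  diff_mem : ∀ r s, secondDiff f r s ∈ C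
  diff_map : ∀ g r s, secondDiff f (X.a g * r) (X.act g s) = X.A g (secondDiff f r s)
  cocompact : ∃ J : ℝ, ∃ K : Set V, IsCompact K ∧ K ⊆ interior C ∧
    ∀ s, ∀ u ∈ interior C, ∃ g, |X.act g s| ≤ J ∧ X.A g u ∈ K
  exists_ne : ∃ r s, secondDiff f r s ≠ 0

lemma IsSolidCone.exists_boundary {V : Type*} [NormedAddCommGroup V] [NormedSpace ℝ V]
    {C : Set V} (hC : IsSolidCone C) (hV : 2 ≤ Module.finrank ℝ V) :
    ∃ z ∈ C, z ∉ interior C ∧ z ≠ 0 := by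
  by_contra! hcon
  have hcon : ∀ z ∈ C, z ≠ 0 → z ∈ interior C := fun z hz h0 => by
    by_contra h
    exact h0 (hcon z hz h)
  have hfd : Module.Finite ℝ V := Module.finite_of_finrank_pos (by omega)
  have hnt : Nontrivial V := Module.nontrivial_of_finrank_pos (R := ℝ) (by omega)
  have hrk : 1 < Module.rank ℝ V := by
    rw [← Module.finrank_eq_rank ℝ V]
    exact_mod_cast hV
  have hconn := (isConnected_compl_singleton_of_one_lt_rank hrk (0 : V)).isPreconnected
  obtain ⟨u, hu⟩ := hC.interior_nonempty
  have hu0 : u ≠ 0 := fun h => hC.zero_notMem_interior (h ▸ hu)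
  obtain ⟨x, -, hx1, hx2⟩ := hconn (interior C) Cᶜ isOpen_interior hC.closed.isOpen_compl
    (fun x hx => by
      by_cases h : x ∈ C
      · exact Or.inl (hcon x h hx)
      · exact Or.inr h)
    ⟨u, hu0, hu⟩
    ⟨-u, by simpa using hu0, fun h => hu0 (hC.pointed u (interior_subset hu) h)⟩
  exact hx2 (interior_subset hx1)

lemma IsSolidCone.mem_of_add_nat_smul_mem {V : Type*} [NormedAddCommGroup V] [NormedSpace ℝ V]
    {C : Set V} (hC : IsSolidCone C) {y z : V} (h : ∀ n : ℕ, y + (n : ℝ) • z ∈ C) : z ∈ C := by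
  have h1 : Tendsto (fun n : ℕ => ((n : ℝ) + 1)⁻¹ • y + z) atTop (𝓝 ((0 : ℝ) • y + z)) :=
    ((tendsto_natCast_atTop_atTop.atTop_add tendsto_const_nhds).inv_tendsto_atTop.smul_const
      y).add_const z
  rw [zero_smul, zero_add] at h1
  refine hC.closed.mem_of_tendsto h1 (Eventually.of_forall fun n => ?_)
  have := hC.smul_mem ((n : ℝ) + 1)⁻¹ (by positivity) _ (h (n + 1))
  rw [smul_add, smul_smul] at this
  push_cast at this
  rwa [inv_mul_cancel₀ (by positivity), one_smul] at this

namespace IsEquivariantProfile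

variable {G V : Type*} [Group G] [NormedAddCommGroup V] [NormedSpace ℝ V]
  {X : BaseAction G V} {C : Set V} {f : ℝ → V}

lemma continuous_diff (h : IsEquivariantProfile X C f) :
    Continuous (fun p : ℝ × ℝ => secondDiff f p.1 p.2) := by
  have := h.continuous
  unfold secondDiff
  fun_prop

lemma exists_diff_ne (h : IsEquivariantProfile X C f) (s : ℝ) : ∃ r, secondDiff f r s ≠ 0 := by
  by_contra! hs
  obtain ⟨r, s', hne⟩ := h.exists_ne
  refine hne (h.cone.pointed _ (h.diff_mem r s') ?_)
  have e : -secondDiff f r s' = secondDiff f r (2 * s - s') := by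
    have h1 := hs (s' + r - s)
    have h2 := hs (s' - r - s)
    have h3 := hs (s' - s)
    unfold secondDiff at h1 h2 h3 ⊢
    rw [show s + (s' + r - s) = s' + r by ring,
      show s - (s' + r - s) = 2 * s - s' - r by ring] at h1
    rw [show s + (s' - r - s) = s' - r by ring,
      show s - (s' - r - s) = 2 * s - s' + r by ring] at h2
    rw [show s + (s' - s) = s' by ring, show s - (s' - s) = 2 * s - s' by ring] at h3
    linear_combination (norm := module) (-1 : ℝ) • h1 - h2 + (2 : ℝ) • h3
  rw [e]
  exact h.diff_mem _ _

lemma exists_lower_bound (h : IsEquivariantProfile X C f) (J : ℝ) :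
    ∃ c > 0, ∃ r₀ > 0, ∀ t, |t| ≤ J → ∃ ρ, |ρ| ≤ r₀ ∧ c ≤ ‖secondDiff f ρ t‖ := by
  by_contra! hcon
  have h1 : ∀ n : ℕ, ∃ t, |t| ≤ J ∧ ∀ ρ, |ρ| ≤ (n : ℝ) + 1 →
      ‖secondDiff f ρ t‖ < ((n : ℝ) + 1)⁻¹ :=
    fun n => hcon _ (by positivity) _ (by positivity)
  choose t ht1 ht2 using h1
  obtain ⟨s, -, φ, hφ, hs⟩ := (isCompact_Icc (a := -J) (b := J)).tendsto_subseq
    (fun n => abs_le.1 (ht1 n))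
  obtain ⟨r, hr⟩ := h.exists_diff_ne s
  have h2 : Tendsto (fun n => ‖secondDiff f r (t (φ n))‖) atTop (𝓝 ‖secondDiff f r s‖) :=
    ((h.continuous_diff.comp (Continuous.prodMk_right r)).norm.tendsto s).comp hs
  have h3 : Tendsto (fun n => (((φ n : ℕ) : ℝ) + 1)⁻¹) atTop (𝓝 0) :=
    (tendsto_natCast_atTop_atTop.atTop_add tendsto_const_nhds).inv_tendsto_atTop.comp
      hφ.tendsto_atTop
  have h4 : ∀ᶠ n in atTop, ‖secondDiff f r (t (φ n))‖ ≤ (((φ n : ℕ) : ℝ) + 1)⁻¹ := by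
    filter_upwards [(tendsto_natCast_atTop_atTop.comp hφ.tendsto_atTop).eventually_ge_atTop |r|]
      with n hn
    have hn : |r| ≤ (φ n : ℝ) := hn
    exact (ht2 (φ n) r (by linarith)).le
  have h5 := le_of_tendsto_of_tendsto h2 h3 h4
  exact hr (norm_le_zero_iff.1 h5)

lemma exists_preimage (h : IsEquivariantProfile X C f) (J : ℝ) :
    ∃ c > 0, ∃ r₀ > 0, ∀ g s, |X.act g s| ≤ J →
      ∃ r, |X.a g| * |r| ≤ r₀ ∧ c ≤ ‖X.A g (secondDiff f r s)‖ := by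
  obtain ⟨c, hc, r₀, hr₀, hcr⟩ := h.exists_lower_bound J
  refine ⟨c, hc, r₀, hr₀, fun g s hs => ?_⟩
  obtain ⟨ρ, hρ1, hρ2⟩ := hcr _ hs
  have e : X.a g * (ρ / X.a g) = ρ := mul_div_cancel₀ _ (X.a_ne g)
  refine ⟨ρ / X.a g, ?_, ?_⟩
  · rwa [← abs_mul, e]
  · rwa [← h.diff_map, e]

/-- Bounded linear part forces bounded multiplier. -/
lemma exists_a_le (h : IsEquivariantProfile X C f) (J R : ℝ) :
    ∃ M > 0, ∀ g s, |s| ≤ J → |X.act g s| ≤ J → (∀ v, ‖X.A g v‖ ≤ R * ‖v‖) → |X.a g| ≤ M := by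
  obtain ⟨c, hc, r₀, hr₀, hcr⟩ := h.exists_preimage J
  have huc : UniformContinuousOn (fun p : ℝ × ℝ => secondDiff f p.1 p.2)
      (Icc (-1) 1 ×ˢ Icc (-J) J) :=
    (isCompact_Icc.prod isCompact_Icc).uniformContinuousOn_of_continuous
      h.continuous_diff.continuousOn
  obtain ⟨δ, hδ, hd⟩ := Metric.uniformContinuousOn_iff.1 huc (c / (|R| + 1)) (by positivity)
  have hz : ∀ s, secondDiff f 0 s = 0 := fun s => by
    simp [secondDiff, two_smul]
  refine ⟨r₀ / min δ 1 + 1, by positivity, fun g s hs hgs hA => ?_⟩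
  by_contra! hM
  obtain ⟨r, hr1, hr2⟩ := hcr g s hgs
  have hδ1 : 0 < min δ 1 := by positivity
  have hr : |r| < min δ 1 := by
    by_contra! hr
    have h1 : r₀ / min δ 1 * min δ 1 < |X.a g| * |r| := by
      have : 0 < r₀ / min δ 1 := by positivity
      nlinarith
    rw [div_mul_cancel₀ _ hδ1.ne'] at h1
    linarith
  have hr' := lt_min_iff.1 hr
  have h2 := hd (r, s) ⟨abs_le.1 hr'.2.le, abs_le.1 hs⟩ (0, s)
    ⟨by constructor <;> norm_num, abs_le.1 hs⟩ (by
      simpa [Prod.dist_eq, Real.dist_eq, hδ] using hr'.1)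
  simp only [hz, dist_zero_right] at h2
  have h3 := hA (secondDiff f r s)
  have h4 : R * ‖secondDiff f r s‖ ≤ |R| * ‖secondDiff f r s‖ := by
    gcongr
    exact le_abs_self R
  rw [lt_div_iff₀ (by positivity)] at h2
  nlinarith [norm_nonneg (secondDiff f r s), abs_nonneg R]

/-- Small linear part forces small multiplier. -/
lemma exists_a_mul_le (h : IsEquivariantProfile X C f) (J M : ℝ) :
    ∃ η > 0, ∀ g s, |s| ≤ J → |X.act g s| ≤ J → (∀ v, ‖X.A g v‖ ≤ η * ‖v‖) →
      |X.a g| * M ≤ 1 := by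
  obtain ⟨c, hc, r₀, hr₀, hcr⟩ := h.exists_preimage J
  have hK : IsCompact (Icc (-(r₀ * |M|)) (r₀ * |M|) ×ˢ Icc (-J) J) := isCompact_Icc.prod isCompact_Icc
  obtain ⟨B, hB⟩ := hK.exists_bound_of_continuousOn h.continuous_diff.continuousOn
  refine ⟨c / (|B| + 1), by positivity, fun g s hs hgs hA => ?_⟩
  by_contra! hM
  obtain ⟨r, hr1, hr2⟩ := hcr g s hgs
  have hr : |r| ≤ r₀ * |M| := by
    have h1 : 1 ≤ |X.a g| * |M| := hM.le.trans (by gcongr; exact le_abs_self M)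
    calc |r| ≤ |r| * (|X.a g| * |M|) := le_mul_of_one_le_right (abs_nonneg _) h1
      _ = |X.a g| * |r| * |M| := by ring
      _ ≤ _ := by gcongr
  have h2 := hB (r, s) ⟨abs_le.1 hr, abs_le.1 hs⟩
  have h3 := hA (secondDiff f r s)
  have h4 : ‖secondDiff f r s‖ ≤ |B| := h2.trans (le_abs_self B)
  have h5 : c / (|B| + 1) * ‖secondDiff f r s‖ ≤ c / (|B| + 1) * |B| := by gcongr
  have h6 : c / (|B| + 1) * |B| < c := by
    rw [div_mul_eq_mul_div, div_lt_iff₀ (by positivity)]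
    nlinarith
  linarith

variable [FiniteDimensional ℝ V]

/-- Bounds for the inverse of an element bringing a vector back to a compact set. -/
lemma exists_inv_bound (h : IsEquivariantProfile X C f) {K : Set V} (hK : IsCompact K)
    (hKC : K ⊆ interior C) :
    ∃ N > 0, ∀ g, ∀ u, X.A g u ∈ K → ∀ v, ‖X.A g⁻¹ v‖ ≤ N * ‖u‖ * ‖v‖ := by
  obtain ⟨N, hN, hb⟩ := h.cone.exists_bound
  obtain ⟨δ, hδ, hr⟩ := IsSolidCone.exists_uniform_radius hK isOpen_interior hKC
  refine ⟨N / δ, by positivity, fun g u hu v => ?_⟩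
  have := hb (X.A g⁻¹ : V →ₗ[ℝ] V) (h.map_mem g⁻¹) (X.A g u) δ hδ
    (fun v hv => interior_subset (hr _ hu v hv)) v
  simpa [X.A_inv_A] using this

lemma isExpanding (h : IsEquivariantProfile X C f) : X.IsExpanding := by
  obtain ⟨J, K, hK, hKC, hJ⟩ := h.cocompact
  obtain ⟨u, hu⟩ := h.cone.interior_nonempty
  obtain ⟨N, hN, hb⟩ := h.exists_inv_bound hK hKC
  refine ⟨J, fun s M => ?_⟩
  obtain ⟨η, hη, hη'⟩ := h.exists_a_mul_le (max J |s|) (|M| + 1)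
  set ε := η / (N * (‖u‖ + 1)) with hε
  have hε0 : 0 < ε := by positivity
  obtain ⟨g, hg1, hg2⟩ := hJ s (ε • u) (h.cone.smul_mem_interior hε0 hu)
  refine ⟨g, hg1, ?_⟩
  have h1 := hη' g⁻¹ (X.act g s) (hg1.trans (le_max_left _ _))
    (by rw [X.act_inv_act]; exact le_max_right _ _) (fun v => by
      refine (hb g _ hg2 v).trans ?_
      gcongr
      rw [norm_smul, Real.norm_of_nonneg hε0.le, hε]
      have e : N * (η / (N * (‖u‖ + 1)) * ‖u‖) = η * (‖u‖ / (‖u‖ + 1)) := by field_simp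
      rw [e]
      exact mul_le_of_le_one_right hη.le ((div_le_one (by positivity)).2 (by linarith)))
  rw [X.a_inv, abs_inv, inv_mul_le_iff₀ (abs_pos.2 (X.a_ne g)), mul_one] at h1
  linarith [le_abs_self M]

end IsEquivariantProfile

namespace IsEquivariantProfile

variable {G V : Type*} [Group G] [NormedAddCommGroup V] [NormedSpace ℝ V]
  {X : BaseAction G V} {C : Set V} {f : ℝ → V}

/-- The span of all second differences. -/
def diffSpan (f : ℝ → V) : Submodule ℝ V :=
  Submodule.span ℝ (range fun p : ℝ × ℝ => secondDiff f p.1 p.2)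

lemma diff_mem_diffSpan (f : ℝ → V) (r s : ℝ) : secondDiff f r s ∈ diffSpan f :=
  Submodule.subset_span ⟨(r, s), rfl⟩

lemma diffSpan_induction {p : V → Prop} (h0 : p 0) (hadd : ∀ x y, p x → p y → p (x + y))
    (hsmul : ∀ (t : ℝ) x, p x → p (t • x)) (hf : ∀ r s, p (secondDiff f r s)) :
    ∀ v ∈ diffSpan f, p v := by
  intro v hv
  induction hv using Submodule.span_induction with
  | mem x hx => obtain ⟨⟨r, s⟩, rfl⟩ := hx; exact hf r s
  | zero => exact h0
  | add x y _ _ hx hy => exact hadd x y hx hy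
  | smul t x _ hx => exact hsmul t x hx

lemma map_diffSpan (h : IsEquivariantProfile X C f) (g : G) :
    ∀ v ∈ diffSpan f, X.A g v ∈ diffSpan f := by
  refine diffSpan_induction (by simp) (fun x y hx hy => ?_) (fun t x hx => ?_) (fun r s => ?_)
  · rw [map_add]; exact add_mem hx hy
  · rw [map_smul]; exact Submodule.smul_mem _ t hx
  · rw [← h.diff_map]; exact diff_mem_diffSpan f _ _

lemma exists_bound_of_diffSpan_eq_top (h : IsEquivariantProfile X C f) (hW : diffSpan f = ⊤)
    [FiniteDimensional ℝ V] (J M : ℝ) :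
    ∃ R > 0, ∀ g, |X.act g 0| ≤ J → |X.a g| ≤ M → ∀ v, ‖X.A g v‖ ≤ R * ‖v‖ := by
  have hpt : ∀ v ∈ diffSpan f, ∃ R, ∀ g, |X.act g 0| ≤ J → |X.a g| ≤ M → ‖X.A g v‖ ≤ R := by
    refine diffSpan_induction ⟨0, by simp⟩ ?_ ?_ ?_
    · rintro x y ⟨R, hR⟩ ⟨R', hR'⟩
      refine ⟨R + R', fun g h1 h2 => ?_⟩
      rw [map_add]
      exact (norm_add_le _ _).trans (add_le_add (hR g h1 h2) (hR' g h1 h2))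
    · rintro t x ⟨R, hR⟩
      refine ⟨|t| * R, fun g h1 h2 => ?_⟩
      rw [map_smul, norm_smul, Real.norm_eq_abs]
      exact mul_le_mul_of_nonneg_left (hR g h1 h2) (abs_nonneg t)
    · intro r s
      have hK : IsCompact (Icc (-(M * |r|)) (M * |r|) ×ˢ Icc (-(J + M * |s|)) (J + M * |s|)) :=
        isCompact_Icc.prod isCompact_Icc
      obtain ⟨B, hB⟩ := hK.exists_bound_of_continuousOn h.continuous_diff.continuousOn
      refine ⟨B, fun g h1 h2 => ?_⟩
      rw [← h.diff_map]
      refine hB (X.a g * r, X.act g s) ⟨abs_le.1 ?_, abs_le.1 ?_⟩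
      · rw [abs_mul]; gcongr
      · have : X.act g s = X.act g 0 + X.a g * s := by rw [← X.act_add, zero_add]
        rw [this]
        refine (abs_add_le _ _).trans ?_
        rw [abs_mul]
        gcongr
  obtain ⟨u, hu⟩ := h.cone.interior_nonempty
  obtain ⟨δ, hδ, hr⟩ := IsSolidCone.mem_interior_iff.1 hu
  obtain ⟨N, hN, hb⟩ := h.cone.exists_bound
  obtain ⟨R, hR⟩ := hpt u (hW ▸ Submodule.mem_top)
  refine ⟨N / δ * (|R| + 1), by positivity, fun g h1 h2 v => ?_⟩
  have h3 := hb (X.A g : V →ₗ[ℝ] V) (h.map_mem g) u δ hδ hr v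
  refine h3.trans ?_
  gcongr
  exact (hR g h1 h2).trans ((le_abs_self R).trans (by linarith))

lemma exists_intermediate (h : IsEquivariantProfile X C f) [FiniteDimensional ℝ V] {J : ℝ}
    {K : Set V} (hK : IsCompact K) (hKC : K ⊆ interior C)
    (hJ : ∀ s, ∀ u ∈ interior C, ∃ g, |X.act g s| ≤ J ∧ X.A g u ∈ K) :
    ∃ M > 0, ∀ u ∈ interior C, ∃ g, ∃ t : ℝ, 0 < t ∧ |X.act g 0| ≤ J ∧ X.A g (t • u) ∈ K ∧
      |X.a g| ≤ 1 ∧ 1 ≤ M * |X.a g| := by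
  obtain ⟨N, hN, hb⟩ := h.exists_inv_bound hK hKC
  obtain ⟨B, hB⟩ := hK.exists_bound_of_continuousOn (f := id) continuous_id.continuousOn
  obtain ⟨N', hN', hb'⟩ := h.cone.exists_bound
  obtain ⟨δ, hδ, hr⟩ := IsSolidCone.exists_uniform_radius hK isOpen_interior hKC
  obtain ⟨M, hM, hMa⟩ := h.exists_a_le J (N' / δ * (2 * B))
  refine ⟨M, hM, fun u hu => ?_⟩
  choose! T hT1 hT2 using fun t : ℝ => fun ht : 0 < t =>
    hJ 0 (t • u) (h.cone.smul_mem_interior ht hu)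
  have hratio : ∀ t : ℝ, 0 < t → |X.a (T t)| ≤ M * |X.a (T (2 * t))| := by
    intro t ht
    have ht2 : 0 < 2 * t := by positivity
    have h1 := hMa (T t * (T (2 * t))⁻¹) (X.act (T (2 * t)) 0) (hT1 _ ht2)
      (by rw [X.act_mul, X.act_inv_act]; exact hT1 t ht) (fun v => by
        have h2 := hb' (X.A (T t * (T (2 * t))⁻¹) : V →ₗ[ℝ] V) (h.map_mem _)
          (X.A (T (2 * t)) ((2 * t) • u)) δ hδ
          (fun v hv => interior_subset (hr _ (hT2 _ ht2) v hv)) v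
        refine h2.trans ?_
        gcongr
        rw [LinearEquiv.coe_coe, X.A_mul_apply, X.A_inv_A, mul_smul, map_smul, norm_smul,
          Real.norm_of_nonneg (by norm_num)]
        have := hB _ (hT2 t ht)
        simp only [id] at this
        linarith)
    rw [X.a_mul, X.a_inv, abs_mul, abs_inv, ← div_eq_mul_inv,
      div_le_iff₀ (abs_pos.2 (X.a_ne _))] at h1
    exact h1
  have hsmall : ∃ t > 0, 1 < |X.a (T t)| := by
    obtain ⟨η, hη, hη'⟩ := h.exists_a_mul_le J 2
    set ε := η / (N * (‖u‖ + 1)) with hε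
    have hε0 : 0 < ε := by positivity
    refine ⟨ε, hε0, ?_⟩
    have h0 : |(0 : ℝ)| ≤ J := by
      rw [abs_zero]; exact (abs_nonneg _).trans (hT1 1 one_pos)
    have h1 := hη' (T ε)⁻¹ (X.act (T ε) 0) (hT1 ε hε0) (by rwa [X.act_inv_act]) (fun v => by
        refine (hb _ _ (hT2 ε hε0) v).trans ?_
        gcongr
        rw [norm_smul, Real.norm_of_nonneg hε0.le, hε]
        have e : N * (η / (N * (‖u‖ + 1)) * ‖u‖) = η * (‖u‖ / (‖u‖ + 1)) := by field_simp
        rw [e]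
        exact mul_le_of_le_one_right hη.le ((div_le_one (by positivity)).2 (by linarith)))
    rw [X.a_inv, abs_inv, inv_mul_le_iff₀ (abs_pos.2 (X.a_ne _)), mul_one] at h1
    linarith
  obtain ⟨t₀, ht₀, hat₀⟩ := hsmall
  have hlarge : ∃ n : ℕ, |X.a (T (2 ^ n * t₀))| ≤ 1 := by
    obtain ⟨η, hη, hη'⟩ := h.exists_a_mul_le J 1
    obtain ⟨ρ, hρ, hρu⟩ := IsSolidCone.mem_interior_iff.1 hu
    have hBp : 0 ≤ B := (norm_nonneg _).trans (hB _ (hT2 1 one_pos))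
    obtain ⟨n, hn⟩ := pow_unbounded_of_one_lt (N' / ρ * B / (η * t₀)) (by norm_num : (1 : ℝ) < 2)
    have hp : (0 : ℝ) < 2 ^ n * t₀ := by positivity
    refine ⟨n, ?_⟩
    have h0 : |(0 : ℝ)| ≤ J := by
      rw [abs_zero]; exact (abs_nonneg _).trans (hT1 1 one_pos)
    have h1 := hη' (T (2 ^ n * t₀)) 0 h0 (hT1 _ hp) (fun v => by
      refine (hb' (X.A (T (2 ^ n * t₀)) : V →ₗ[ℝ] V) (h.map_mem _) u ρ hρ hρu v).trans ?_
      gcongr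
      have h2 := hB _ (hT2 _ hp)
      simp only [id, map_smul, norm_smul, Real.norm_of_nonneg hp.le] at h2
      rw [div_lt_iff₀ (by positivity)] at hn
      have h3 : 2 ^ n * t₀ * ‖X.A (T (2 ^ n * t₀)) u‖ * (N' / ρ) ≤ B * (N' / ρ) := by gcongr
      have h4 : 2 ^ n * t₀ * (N' / ρ * ‖X.A (T (2 ^ n * t₀)) u‖) ≤ 2 ^ n * t₀ * η := by linarith
      exact le_of_mul_le_mul_left h4 hp)
    linarith
  classical
  obtain ⟨n, hn, hmin⟩ : ∃ n : ℕ, |X.a (T (2 ^ n * t₀))| ≤ 1 ∧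
      ∀ m < n, ¬ |X.a (T (2 ^ m * t₀))| ≤ 1 :=
    ⟨Nat.find hlarge, Nat.find_spec hlarge, fun m hm => Nat.find_min hlarge hm⟩
  have hp : (0 : ℝ) < 2 ^ n * t₀ := by positivity
  refine ⟨T (2 ^ n * t₀), 2 ^ n * t₀, hp, hT1 _ hp, hT2 _ hp, hn, ?_⟩
  cases n with
  | zero => rw [pow_zero, one_mul] at hn; linarith
  | succ n =>
    have h1 := not_le.1 (hmin n (Nat.lt_succ_self n))
    have h2 := hratio (2 ^ n * t₀) (by positivity)
    rw [show 2 * (2 ^ n * t₀) = 2 ^ (n + 1) * t₀ by ring] at h2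
    linarith

lemma diffSpan_ne_top (h : IsEquivariantProfile X C f) (hV : 2 ≤ Module.finrank ℝ V) :
    diffSpan f ≠ ⊤ := by
  intro hW
  have hfd : Module.Finite ℝ V := Module.finite_of_finrank_pos (by omega)
  obtain ⟨J, K, hK, hKC, hJ⟩ := h.cocompact
  obtain ⟨M, hM, hMg⟩ := h.exists_intermediate hK hKC hJ
  obtain ⟨R₁, hR₁, h1⟩ := h.exists_bound_of_diffSpan_eq_top hW J 1
  obtain ⟨R₂, hR₂, h2⟩ := h.exists_bound_of_diffSpan_eq_top hW (M * J) M
  obtain ⟨B, hB⟩ := hK.exists_bound_of_continuousOn (f := id) continuous_id.continuousOn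
  obtain ⟨δ, hδ, hr⟩ := IsSolidCone.exists_uniform_radius hK isOpen_interior hKC
  obtain ⟨z, hz, hzi, hz0⟩ := h.cone.exists_boundary hV
  obtain ⟨u, hu⟩ := h.cone.interior_nonempty
  have hBp : 0 ≤ B := by
    obtain ⟨g, -, hg⟩ := hJ 0 u hu
    exact (norm_nonneg _).trans (hB _ hg)
  set κ := δ / (R₁ * (R₂ * (B + 1))) with hκ
  have hκ0 : 0 < κ := by positivity
  have key : ∀ w ∈ interior C, ∀ v, ‖v‖ ≤ κ * ‖w‖ → w + v ∈ C := by
    intro w hw v hv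
    obtain ⟨g, t, ht, hg0, hgK, ha1, ha2⟩ := hMg w hw
    have ha : 0 < |X.a g| := abs_pos.2 (X.a_ne g)
    have hainv : |X.a g⁻¹| ≤ M := by
      rw [X.a_inv, abs_inv]
      rw [← div_le_iff₀ ha, one_div] at ha2
      exact ha2
    have hg0' : |X.act g⁻¹ 0| ≤ M * J := by
      have e : X.act g⁻¹ 0 = X.a g⁻¹ * -X.act g 0 := by
        simp only [BaseAction.act, X.b_inv, X.a_inv, mul_zero, zero_add]
        have := X.a_ne g
        field_simp
      rw [e, abs_mul, abs_neg]
      gcongr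
    have hw1 : t * ‖w‖ ≤ R₂ * (B + 1) := by
      have h3 := h2 g⁻¹ hg0' hainv (X.A g (t • w))
      rw [X.A_inv_A, norm_smul, Real.norm_of_nonneg ht.le] at h3
      have := hB _ hgK
      simp only [id] at this
      exact h3.trans (by gcongr; linarith)
    have h3 : ‖X.A g (t • v)‖ ≤ δ := by
      refine (h1 g hg0 ha1 _).trans ?_
      rw [norm_smul, Real.norm_of_nonneg ht.le]
      calc R₁ * (t * ‖v‖) ≤ R₁ * (t * (κ * ‖w‖)) := by gcongr
        _ = R₁ * κ * (t * ‖w‖) := by ring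
        _ ≤ R₁ * κ * (R₂ * (B + 1)) := by gcongr
        _ = δ := by rw [hκ]; field_simp
    have h4 := h.map_mem g⁻¹ _ (interior_subset (hr _ hgK _ h3))
    rw [← map_add, X.A_inv_A, ← smul_add] at h4
    have h5 := h.cone.smul_mem t⁻¹ (by positivity) _ h4
    rwa [smul_smul, inv_mul_cancel₀ ht.ne', one_smul] at h5
  have hzn : 0 < ‖z‖ := norm_pos_iff.2 hz0
  refine hzi (IsSolidCone.mem_interior_iff.2 ⟨κ * ‖z‖ / 4, by positivity, fun v hv => ?_⟩)
  set η := min (‖z‖ / 2) (κ * ‖z‖ / 4) / (‖u‖ + 1) with hη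
  have hη0 : 0 < η := by positivity
  have hηu : ‖η • u‖ ≤ min (‖z‖ / 2) (κ * ‖z‖ / 4) := by
    rw [norm_smul, Real.norm_of_nonneg hη0.le, hη, div_mul_eq_mul_div]
    refine div_le_of_le_mul₀ (by positivity) (by positivity) ?_
    gcongr
    linarith
  have hηu' := le_min_iff.1 hηu
  have hw : η • u + z ∈ interior C := h.cone.add_mem_interior (h.cone.smul_mem_interior hη0 hu) hz
  have h5 : ‖z‖ / 2 ≤ ‖η • u + z‖ := by
    have := norm_sub_le (η • u + z) (η • u)
    rw [add_sub_cancel_left] at this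
    linarith
  have := key _ hw (v - η • u) (by
    refine (norm_sub_le _ _).trans ?_
    have : κ * (‖z‖ / 2) ≤ κ * ‖η • u + z‖ := by gcongr
    linarith)
  convert this using 1
  abel

end IsEquivariantProfile

/-- A map of a plane (or a line) some of whose conjugates converge to the identity is
unipotent. -/
lemma unipotent_of_tendsto_conj {W : Type*} [NormedAddCommGroup W] [NormedSpace ℝ W]
    [FiniteDimensional ℝ W] (hW : Module.finrank ℝ W ≤ 2) (L : W →ₗ[ℝ] W)
    (P : ℕ → (W ≃ₗ[ℝ] W))
    (hlim : ∀ w, Tendsto (fun n => P n (L ((P n).symm w))) atTop (𝓝 w)) (w : W) :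
    L (L w) - (2 : ℝ) • L w + w = 0 := by
  classical
  set d := Module.finrank ℝ W with hd
  let B := Module.finBasis ℝ W
  have hdet : ∀ x : ℝ, L.charpoly.eval x = (x - 1) ^ d := by
    intro x
    have h1 : ∀ n, ((P n).conj L).charpoly.eval x = L.charpoly.eval x := fun n => by
      rw [LinearEquiv.charpoly_conj]
    have h2 : ∀ T : W →ₗ[ℝ] W, T.charpoly.eval x =
        (Matrix.scalar (Fin d) x - LinearMap.toMatrix B B T).det := fun T => by
      rw [← LinearMap.charpoly_toMatrix T B, Matrix.eval_charpoly]
    have h3 : Tendsto (fun n => LinearMap.toMatrix B B ((P n).conj L)) atTop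
        (𝓝 (1 : Matrix (Fin d) (Fin d) ℝ)) := by
      refine tendsto_pi_nhds.2 fun i => tendsto_pi_nhds.2 fun j => ?_
      have h4 : Continuous (fun w : W => B.repr w i) :=
        ((Finsupp.lapply i).comp B.repr.toLinearMap : W →ₗ[ℝ] ℝ).continuous_of_finiteDimensional
      have h5 := (h4.tendsto (B j)).comp (hlim (B j))
      simp only [LinearMap.toMatrix_apply, LinearEquiv.conj_apply_apply]
      convert h5 using 2 with n
      · rfl
      · rw [Matrix.one_apply, B.repr_self, Finsupp.single_apply]
        exact if_congr eq_comm rfl rfl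
    have h6 : Continuous (fun M : Matrix (Fin d) (Fin d) ℝ => (Matrix.scalar (Fin d) x - M).det) := by
      fun_prop
    have h7 := (h6.tendsto 1).comp h3
    have h8 : (fun M : Matrix (Fin d) (Fin d) ℝ => (Matrix.scalar (Fin d) x - M).det) ∘
        (fun n => LinearMap.toMatrix B B ((P n).conj L)) = fun _ => L.charpoly.eval x := by
      funext n
      rw [← h1 n, h2 ((P n).conj L)]
      rfl
    rw [h8] at h7
    have h9 := tendsto_nhds_unique tendsto_const_nhds h7
    rw [h9]
    have : Matrix.scalar (Fin d) x - 1 = Matrix.scalar (Fin d) (x - 1) := by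
      rw [map_sub, map_one]
    rw [this, Matrix.scalar_apply, Matrix.det_diagonal]
    simp
  have hcp : L.charpoly = (Polynomial.X - Polynomial.C 1) ^ d := by
    refine Polynomial.funext fun x => ?_
    rw [hdet]; simp
  have h0 := LinearMap.aeval_self_charpoly L
  rw [hcp] at h0
  simp only [map_pow, map_sub, Polynomial.aeval_X, map_one] at h0
  have h2 : (L - 1) ^ 2 = 0 := pow_eq_zero_of_le hW h0
  have h3 := LinearMap.congr_fun h2 w
  simp only [pow_two, Module.End.mul_apply, LinearMap.sub_apply, Module.End.one_apply,
    LinearMap.zero_apply, map_sub] at h3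
  rw [← h3]
  module

namespace IsEquivariantProfile

variable {G V : Type*} [Group G] [NormedAddCommGroup V] [NormedSpace ℝ V]
  {X : BaseAction G V} {C : Set V} {f : ℝ → V}

/-- The restriction of the linear part to the span of the second differences. -/
def restrict (h : IsEquivariantProfile X C f) (g : G) : diffSpan f ≃ₗ[ℝ] diffSpan f :=
  LinearEquiv.ofLinearMap ((X.A g : V →ₗ[ℝ] V).restrict (h.map_diffSpan g))
    ((X.A g⁻¹ : V →ₗ[ℝ] V).restrict (h.map_diffSpan g⁻¹))
    (by ext v; simp) (by ext v; simp)

lemma coe_restrict (h : IsEquivariantProfile X C f) (g : G) (v : diffSpan f) :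
    (h.restrict g v : V) = X.A g v := rfl

lemma coe_restrict_symm (h : IsEquivariantProfile X C f) (g : G) (v : diffSpan f) :
    ((h.restrict g).symm v : V) = X.A g⁻¹ v := rfl

lemma unipotent [FiniteDimensional ℝ V] (h : IsEquivariantProfile X C f)
    (hW : Module.finrank ℝ (diffSpan f) ≤ 2) (τ : G) (hτ : X.a τ = 1) (v : V)
    (hv : v ∈ diffSpan f) : X.A τ (X.A τ v) - (2 : ℝ) • X.A τ v + v = 0 := by
  obtain ⟨g, hg⟩ := h.isExpanding.exists_contracting
  have hlim : ∀ w ∈ diffSpan f,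
      Tendsto (fun n => X.A (g ^ n * τ * (g ^ n)⁻¹) w) atTop (𝓝 w) := by
    refine diffSpan_induction (by simp) (fun x y hx hy => ?_) (fun t x hx => ?_) (fun r s => ?_)
    · simpa only [map_add] using hx.add hy
    · simpa only [map_smul] using hx.const_smul t
    · have h1 : Tendsto (fun n => X.a g ^ n * X.b τ) atTop (𝓝 (0 * X.b τ)) :=
        (tendsto_pow_atTop_nhds_zero_of_abs_lt_one hg).mul_const _
      rw [zero_mul] at h1
      have h2 : Tendsto (fun n => secondDiff f r (s + X.a g ^ n * X.b τ)) atTop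
          (𝓝 (secondDiff f r (s + 0))) :=
        ((h.continuous_diff.comp (Continuous.prodMk_right r)).tendsto _).comp (h1.const_add s)
      rw [add_zero] at h2
      refine h2.congr fun n => ?_
      rw [← h.diff_map, BaseAction.act, BaseAction.a_conj_pow g τ n hτ,
        BaseAction.b_conj_pow g τ n hτ, one_mul, one_mul]
  have := unipotent_of_tendsto_conj hW (h.restrict τ : diffSpan f →ₗ[ℝ] diffSpan f)
    (fun n => h.restrict (g ^ n)) (fun w => by
      rw [tendsto_subtype_rng]
      refine (hlim w w.2).congr fun n => ?_
      simp only [LinearEquiv.coe_coe, coe_restrict, coe_restrict_symm, X.A_mul_apply]) ⟨v, hv⟩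
  exact congrArg Subtype.val this

lemma diff_fixed [FiniteDimensional ℝ V] (h : IsEquivariantProfile X C f)
    (hW : Module.finrank ℝ (diffSpan f) ≤ 2) (τ : G) (hτ : X.a τ = 1) (r s : ℝ) :
    X.A τ (secondDiff f r s) = secondDiff f r s := by
  set y := secondDiff f r s with hy
  set z := X.A τ y - y with hz
  have hu := h.unipotent hW τ hτ y (diff_mem_diffSpan f r s)
  have hAy : X.A τ y = y + z := by rw [hz]; abel
  have hAz : X.A τ z = z := by
    rw [hz, map_sub]
    linear_combination (norm := module) hu
  have h1 : ∀ n : ℕ, y + (n : ℝ) • z ∈ C := by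
    intro n
    induction n with
    | zero => simpa using h.diff_mem r s
    | succ n ih =>
      have := h.map_mem τ _ ih
      rw [map_add, map_smul, hAz, hAy] at this
      convert this using 1
      push_cast
      module
  have h2 : ∀ n : ℕ, y + (n : ℝ) • (-z) ∈ C := by
    intro n
    induction n with
    | zero => simpa using h.diff_mem r s
    | succ n ih =>
      have := h.map_mem τ⁻¹ _ ih
      have e : y + (n : ℝ) • -z = X.A τ (y + ((n + 1 : ℕ) : ℝ) • -z) := by
        rw [map_add, map_smul, map_neg, hAz, hAy]
        push_cast
        module
      rwa [e, X.A_inv_A] at this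
  have hz0 := h.cone.pointed z (h.cone.mem_of_add_nat_smul_mem h1)
    (h.cone.mem_of_add_nat_smul_mem h2)
  rw [hAy, hz0, add_zero]

lemma diff_const [FiniteDimensional ℝ V] (h : IsEquivariantProfile X C f)
    (hW : Module.finrank ℝ (diffSpan f) ≤ 2) (r s : ℝ) :
    secondDiff f r s = secondDiff f r 0 := by
  have hcont : Continuous (fun s => secondDiff f r s) :=
    h.continuous_diff.comp (Continuous.prodMk_right r)
  refine congrFun (Continuous.ext_on h.isExpanding.dense_translations hcont
    (continuous_const (y := secondDiff f r 0)) ?_) s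
  rintro _ ⟨τ, hτ, rfl⟩
  have := h.diff_map τ r 0
  rw [h.diff_fixed hW τ hτ, BaseAction.act, hτ, one_mul, mul_zero, zero_add] at this
  exact this

/-- A profile whose second differences span at most a plane is a quadratic polynomial. -/
lemma exists_quadratic [FiniteDimensional ℝ V] (h : IsEquivariantProfile X C f)
    (hW : Module.finrank ℝ (diffSpan f) ≤ 2) :
    ∃ c ∈ C, c ≠ 0 ∧ ∃ d e : V, ∀ s, f s = s ^ 2 • c + s • d + e := by
  have hfc := h.continuous
  let B : ℝ → ℝ → V := fun p q => f (p + q) - f p - f q + f 0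
  have hmix : ∀ p q s, f (s + p + q) - f (s + p) - f (s + q) + f s = B p q := by
    intro p q s
    have e1 : ∀ s, f (s + p + q) - f (s + p) - f (s + q) + f s =
        secondDiff f ((p + q) / 2) 0 - secondDiff f ((p - q) / 2) 0 := by
      intro s
      rw [← h.diff_const hW _ (s + (p + q) / 2), ← h.diff_const hW ((p - q) / 2) (s + (p + q) / 2)]
      unfold secondDiff
      ring_nf
      module
    rw [e1, ← e1 0]
    simp [B]
  have hadd : ∀ q p p', B (p + p') q = B p q + B p' q := by
    intro q p p'
    rw [← hmix p q p', show B (p + p') q = f (p' + p + q) - f (p' + p) - f q + f 0 by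
      simp only [B]; rw [add_comm p p']]
    simp only [B]
    module
  have hsymm : ∀ p q, B p q = B q p := fun p q => by
    simp only [B]; rw [add_comm p q]; abel
  have hlin : ∀ p q, B p q = p • B 1 q := by
    intro p q
    have hc : Continuous fun p => B p q := by simp only [B]; fun_prop
    let L : ℝ →L[ℝ] V := (AddMonoidHom.mk' (fun p => B p q) (hadd q)).toRealLinearMap hc
    have : L (p • 1) = p • L 1 := map_smul L p 1
    rw [smul_eq_mul, mul_one] at this
    exact this
  have hbil : ∀ p q, B p q = (p * q) • B 1 1 := by
    intro p q
    rw [hlin, hsymm, hlin, smul_smul]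
  set c := (2⁻¹ : ℝ) • B 1 1 with hc
  let e : ℝ → V := fun s => f s - s ^ 2 • c - f 0
  have hec : Continuous e := by simp only [e]; fun_prop
  have headd : ∀ p q, e (p + q) = e p + e q := by
    intro p q
    have h1 := hbil p q
    have h2 : B p q = f (p + q) - f p - f q + f 0 := rfl
    rw [h2] at h1
    simp only [e, hc]
    linear_combination (norm := module) h1
  have helin : ∀ p, e p = p • e 1 := by
    intro p
    let L : ℝ →L[ℝ] V := (AddMonoidHom.mk' e headd).toRealLinearMap hec
    have : L (p • 1) = p • L 1 := map_smul L p 1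
    rw [smul_eq_mul, mul_one] at this
    exact this
  have hquad : ∀ s, f s = s ^ 2 • c + s • e 1 + f 0 := by
    intro s
    rw [← helin]
    simp only [e]
    abel
  have hD : ∀ r s, secondDiff f r s = (2 * r ^ 2) • c := by
    intro r s
    unfold secondDiff
    rw [hquad (s + r), hquad (s - r), hquad s]
    module
  refine ⟨c, ?_, ?_, e 1, f 0, hquad⟩
  · have h1 := h.cone.smul_mem (1 / 2) (by norm_num) _ (h.diff_mem 1 0)
    rw [hD, smul_smul] at h1
    norm_num at h1
    exact h1
  · rintro h0
    obtain ⟨r, s, hne⟩ := h.exists_ne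
    rw [hD, h0, smul_zero] at hne
    exact hne rfl

end IsEquivariantProfile

/-- Limits of rescaled points of a convex set are recession directions. -/
lemma recession_of_tendsto {E : Type*} [NormedAddCommGroup E] [NormedSpace ℝ E] {Ω : Set E}
    (ho : IsOpen Ω) (hc : Convex ℝ Ω) {x : ℕ → E} {t : ℕ → ℝ} {d : E}
    (hx : ∀ n, x n ∈ closure Ω) (ht : Tendsto t atTop atTop)
    (hd : Tendsto (fun n => (t n)⁻¹ • x n) atTop (𝓝 d)) :
    ∀ y ∈ Ω, ∀ τ : ℝ, 0 ≤ τ → y + τ • d ∈ Ω := by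
  have hcl : ∀ y ∈ Ω, ∀ τ : ℝ, 0 ≤ τ → y + τ • d ∈ closure Ω := by
    intro y hy τ hτ
    have h1 : Tendsto (fun n => (1 - τ * (t n)⁻¹) • y + τ • ((t n)⁻¹ • x n)) atTop
        (𝓝 ((1 - τ * 0) • y + τ • d)) :=
      (((ht.inv_tendsto_atTop.const_mul τ).const_sub 1).smul_const y).add (hd.const_smul τ)
    rw [mul_zero, sub_zero, one_smul] at h1
    refine isClosed_closure.mem_of_tendsto h1 ?_
    filter_upwards [ht.eventually_ge_atTop τ, ht.eventually_gt_atTop 0] with n hn hn0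
    rw [smul_smul]
    have h2 : τ * (t n)⁻¹ ≤ 1 := by
      rw [← div_eq_mul_inv]
      exact (div_le_one hn0).2 hn
    exact hc.closure (subset_closure hy) (hx n) (by linarith) (by positivity) (by ring)
  intro y hy τ hτ
  have h1 := hc.combo_interior_closure_mem_interior (by rwa [ho.interior_eq])
    (hcl y hy (2 * τ) (by positivity)) (a := 1 / 2) (b := 1 / 2) (by norm_num) (by norm_num)
    (by norm_num)
  have h2 := interior_subset h1
  convert h2 using 1
  module

/-- A convex domain in `ℝ × V` whose recession cone is `0 × C`, together with a group of affine
automorphisms acting cocompactly and preserving the fibration over `ℝ`. -/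
structure IsFiberedDomain {G V : Type*} [Group G] [NormedAddCommGroup V] [NormedSpace ℝ V]
    (X : BaseAction G V) (w c : G → V) (C : Set V) (Ω K : Set (ℝ × V)) : Prop where
  isOpen : IsOpen Ω
  convex : Convex ℝ Ω
  nonempty : Ω.Nonempty
  cone : IsSolidCone C
  recession : ∀ d : ℝ × V, (∀ x ∈ Ω, ∀ t : ℝ, 0 ≤ t → x + t • d ∈ Ω) ↔ d.1 = 0 ∧ d.2 ∈ C
  mem_iff : ∀ g s v, (X.act g s, X.A g v + s • w g + c g) ∈ Ω ↔ (s, v) ∈ Ω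
  compact : IsCompact K
  subset : K ⊆ Ω
  cocompact : ∀ s v, (s, v) ∈ Ω → ∃ g, (X.act g s, X.A g v + s • w g + c g) ∈ K

namespace IsFiberedDomain

variable {G V : Type*} [Group G] [NormedAddCommGroup V] [NormedSpace ℝ V]
  {X : BaseAction G V} {w c : G → V} {C : Set V} {Ω K : Set (ℝ × V)}

lemma recession_mem (h : IsFiberedDomain X w c C Ω K) {x : ℕ → ℝ × V} {t : ℕ → ℝ} {d : ℝ × V}
    (hx : ∀ n, x n ∈ closure Ω) (ht : Tendsto t atTop atTop)
    (hd : Tendsto (fun n => (t n)⁻¹ • x n) atTop (𝓝 d)) : d.1 = 0 ∧ d.2 ∈ C :=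
  (h.recession d).1 (recession_of_tendsto h.isOpen h.convex hx ht hd)

lemma add_cone_mem (h : IsFiberedDomain X w c C Ω K) {s : ℝ} {v u : V} (hv : (s, v) ∈ Ω)
    (hu : u ∈ C) : (s, v + u) ∈ Ω := by
  have := (h.recession (0, u)).2 ⟨rfl, hu⟩ _ hv 1 zero_le_one
  simpa using this

lemma add_cone_mem_closure (h : IsFiberedDomain X w c C Ω K) {s : ℝ} {v u : V}
    (hv : (s, v) ∈ closure Ω) (hu : u ∈ C) : (s, v + u) ∈ closure Ω := by
  have h1 : MapsTo (fun x : ℝ × V => (x.1, x.2 + u)) Ω Ω := fun x hx => h.add_cone_mem hx hu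
  exact h1.closure (by fun_prop) hv

/-- The base interval. -/
def base (Ω : Set (ℝ × V)) : Set ℝ := Prod.fst '' Ω

lemma mem_base {s : ℝ} : s ∈ base Ω ↔ ∃ v, (s, v) ∈ Ω := by
  constructor
  · rintro ⟨⟨s, v⟩, hx, rfl⟩; exact ⟨v, hx⟩
  · rintro ⟨v, hv⟩; exact ⟨_, hv, rfl⟩

lemma add_interior_mem (h : IsFiberedDomain X w c C Ω K) {s : ℝ} {v u : V}
    (hs : s ∈ base Ω) (hv : (s, v) ∈ closure Ω) (hu : u ∈ interior C) : (s, v + u) ∈ Ω := by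
  obtain ⟨y, hy⟩ := mem_base.1 hs
  obtain ⟨t, ht, htu⟩ := h.cone.exists_sub_mem hu (y - v)
  have h1 := h.add_cone_mem_closure hv (interior_subset htu)
  have h2 := h.convex.combo_interior_closure_mem_interior (by rwa [h.isOpen.interior_eq])
    h1 (a := 1 / 2) (b := 1 / 2) (by norm_num) (by norm_num) (by norm_num)
  have h3 : (s, v + (t / 2) • u) ∈ Ω := by
    convert interior_subset h2 using 1
    ext
    · simp; ring
    · simp only [Prod.snd_add, Prod.smul_snd]; module
  rcases le_or_gt (t / 2) 1 with ht1 | ht1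
  · have := h.add_cone_mem h3 (h.cone.smul_mem (1 - t / 2) (by linarith) u (interior_subset hu))
    convert this using 2
    module
  · have h4 := h.convex.combo_interior_closure_mem_interior (by rwa [h.isOpen.interior_eq])
      hv (a := 1 / (t / 2)) (b := 1 - 1 / (t / 2)) (by positivity)
      (by rw [sub_nonneg, div_le_one (by positivity)]; exact ht1.le) (by ring)
    convert interior_subset h4 using 1
    ext
    · simp; ring
    · simp only [Prod.snd_add, Prod.smul_snd, smul_add, smul_smul]
      rw [show 1 / (t / 2) * (t / 2) = 1 by field_simp]
      module

/-- The automorphism attached to a group element, as a homeomorphism. -/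
def homeo [FiniteDimensional ℝ V] (X : BaseAction G V) (w c : G → V) (g : G) :
    (ℝ × V) ≃ₜ (ℝ × V) where
  toFun x := (X.act g x.1, X.A g x.2 + x.1 • w g + c g)
  invFun y := (X.act g⁻¹ y.1, X.A g⁻¹ (y.2 - X.act g⁻¹ y.1 • w g - c g))
  left_inv x := by
    ext
    · exact X.act_inv_act g _
    · simp only [X.act_inv_act]
      rw [show X.A g x.2 + x.1 • w g + c g - x.1 • w g - c g = X.A g x.2 by abel, X.A_inv_A]
  right_inv y := by
    ext
    · exact X.act_act_inv g _
    · simp only [X.A_A_inv]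
      abel
  continuous_toFun := by
    have := (X.A g : V →ₗ[ℝ] V).continuous_of_finiteDimensional
    have h2 : Continuous (X.act g) := by unfold BaseAction.act; fun_prop
    refine (h2.comp continuous_fst).prodMk ?_
    exact ((this.comp continuous_snd).add (by fun_prop)).add continuous_const
  continuous_invFun := by
    have := (X.A g⁻¹ : V →ₗ[ℝ] V).continuous_of_finiteDimensional
    have h2 : Continuous (X.act g⁻¹) := by unfold BaseAction.act; fun_prop
    refine (h2.comp continuous_fst).prodMk ?_
    exact this.comp (by fun_prop)

variable [FiniteDimensional ℝ V]

lemma mem_closure_iff (h : IsFiberedDomain X w c C Ω K) (g : G) (s : ℝ) (v : V) :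
    (X.act g s, X.A g v + s • w g + c g) ∈ closure Ω ↔ (s, v) ∈ closure Ω := by
  have h1 : homeo X w c g ⁻¹' Ω = Ω := by
    ext ⟨s, v⟩
    exact h.mem_iff g s v
  have h2 := (homeo X w c g).preimage_closure Ω
  rw [h1] at h2
  conv_rhs => rw [← h2]
  rfl

lemma map_mem (h : IsFiberedDomain X w c C Ω K) (g : G) (u : V) (hu : u ∈ C) : X.A g u ∈ C := by
  refine ((h.recession (0, X.A g u)).1 ?_).2
  intro x hx t ht
  obtain ⟨⟨s, v⟩, rfl⟩ := (homeo X w c g).surjective x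
  have h1 : (s, v) ∈ Ω := (h.mem_iff g s v).1 hx
  have h2 := h.add_cone_mem h1 (h.cone.smul_mem t ht u hu)
  have h3 := (h.mem_iff g _ _).2 h2
  convert h3 using 1
  ext
  · simp [homeo]
  · simp [homeo]; abel

lemma act_mem_base (h : IsFiberedDomain X w c C Ω K) (g : G) {s : ℝ} :
    X.act g s ∈ base Ω ↔ s ∈ base Ω := by
  rw [mem_base, mem_base]
  constructor
  · rintro ⟨y, hy⟩
    obtain ⟨⟨s', v⟩, hv⟩ := (homeo X w c g).surjective (X.act g s, y)
    have h1 : s' = s := by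
      have := congrArg (fun z : ℝ × V => X.act g⁻¹ z.1) hv
      simpa [homeo, X.act_inv_act] using this
    subst h1
    refine ⟨v, (h.mem_iff g s' v).1 ?_⟩
    rw [← hv] at hy
    exact hy
  · rintro ⟨v, hv⟩
    exact ⟨_, (h.mem_iff g s v).2 hv⟩

lemma exists_norm_le (h : IsFiberedDomain X w c C Ω K) :
    ∃ R > 0, ∀ x ∈ closure Ω, ∀ x' ∈ closure Ω, ‖x‖ ≤ R * (1 + ‖x + x'‖) := by
  by_contra! hcon
  have h1 : ∀ n : ℕ, ∃ x ∈ closure Ω, ∃ x' ∈ closure Ω,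
      ((n : ℝ) + 1) * (1 + ‖x + x'‖) < ‖x‖ := fun n => hcon _ (by positivity)
  choose x hx x' hx' hn using h1
  have hpos : ∀ n, 0 < ‖x n‖ := fun n => lt_of_le_of_lt (by positivity) (hn n)
  have hlarge : ∀ n : ℕ, (n : ℝ) ≤ ‖x n‖ := fun n => by
    have := hn n
    nlinarith [norm_nonneg (x n + x' n), (Nat.cast_nonneg n : (0 : ℝ) ≤ n)]
  have ht : Tendsto (fun n => ‖x n‖) atTop atTop :=
    tendsto_atTop_mono hlarge tendsto_natCast_atTop_atTop
  obtain ⟨d, hd, φ, hφ, hlim⟩ := (isCompact_sphere (0 : ℝ × V) 1).tendsto_subseq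
    (x := fun n => ‖x n‖⁻¹ • x n) (fun n => by simp [norm_smul, (hpos n).ne'])
  have h2 := h.recession_mem (fun n => hx (φ n)) (ht.comp hφ.tendsto_atTop) hlim
  have h3 : Tendsto (fun n => ‖x n‖⁻¹ • (x n + x' n)) atTop (𝓝 0) := by
    refine squeeze_zero_norm (a := fun n : ℕ => ((n : ℝ) + 1)⁻¹) (fun n => ?_)
      (tendsto_natCast_atTop_atTop.atTop_add tendsto_const_nhds).inv_tendsto_atTop
    rw [norm_smul, norm_inv, norm_norm, inv_mul_le_iff₀ (hpos n), ← div_eq_mul_inv,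
      le_div_iff₀ (by positivity)]
    have := hn n
    nlinarith [norm_nonneg (x n + x' n), (Nat.cast_nonneg n : (0 : ℝ) ≤ n)]
  have h4 : Tendsto (fun n => ‖x (φ n)‖⁻¹ • x' (φ n)) atTop (𝓝 (0 - d)) := by
    refine ((h3.comp hφ.tendsto_atTop).sub hlim).congr fun n => ?_
    simp only [Function.comp]
    module
  rw [zero_sub] at h4
  have h5 := h.recession_mem (fun n => hx' (φ n)) (ht.comp hφ.tendsto_atTop) h4
  have h6 : d = 0 := Prod.ext h2.1 (h.cone.pointed _ h2.2 h5.2)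
  rw [h6] at hd
  simp at hd

lemma exists_cone_norm_le (h : IsFiberedDomain X w c C Ω K) :
    ∃ R > 0, ∀ s v, ∀ u ∈ C, (s, v - u) ∈ closure Ω → ‖u‖ ≤ R * (1 + ‖(s, v)‖) := by
  obtain ⟨R, hR, hb⟩ := h.exists_norm_le
  obtain ⟨⟨s₀, v₀⟩, h0⟩ := h.nonempty
  refine ⟨R * (1 + ‖(s₀, v₀)‖) + ‖(s₀, v₀)‖, by positivity, fun s v u hu hv => ?_⟩
  have h1 := hb _ (subset_closure (h.add_cone_mem h0 hu)) _ hv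
  have e1 : (s₀, v₀ + u) + (s, v - u) = (s₀, v₀) + (s, v) := by ext <;> simp
  rw [e1] at h1
  have h2 := norm_add_le (s₀, v₀) (s, v)
  have h3 : ‖u‖ ≤ ‖(s₀, v₀ + u)‖ + ‖(s₀, v₀)‖ := by
    have h4 : ‖v₀ + u‖ ≤ ‖(s₀, v₀ + u)‖ := norm_snd_le (s₀, v₀ + u)
    have h5 : ‖v₀‖ ≤ ‖(s₀, v₀)‖ := norm_snd_le (s₀, v₀)
    have h6 := norm_sub_le (v₀ + u) v₀
    rw [add_sub_cancel_left] at h6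
    linarith
  have h7 : R * (1 + ‖(s₀, v₀) + (s, v)‖) ≤ R * (1 + (‖(s₀, v₀)‖ + ‖(s, v)‖)) := by gcongr
  nlinarith [norm_nonneg (s₀, v₀), norm_nonneg (s, v),
    mul_nonneg (norm_nonneg (s₀, v₀)) (norm_nonneg (s, v)),
    mul_nonneg hR.le (mul_nonneg (norm_nonneg (s₀, v₀)) (norm_nonneg (s, v)))]

lemma exists_inv_bound (h : IsFiberedDomain X w c C Ω K) :
    ∃ N > 0, ∀ g s v ς, (X.act g s, X.A g v + s • w g + c g) ∈ K →
      (∀ u ∈ C, (s, v - u) ∈ closure Ω → ‖u‖ ≤ ς) → ∀ x, ‖X.A g⁻¹ x‖ ≤ N * ς * ‖x‖ := by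
  obtain ⟨δ, hδ, hr⟩ := IsSolidCone.exists_uniform_radius h.compact h.isOpen h.subset
  obtain ⟨N, hN, hb⟩ := h.cone.exists_bound_of_cone
  refine ⟨N / δ, by positivity, fun g s v ς hK hς x => ?_⟩
  have key := hb (X.A g⁻¹ : V →ₗ[ℝ] V) (ς / δ) (fun u hu => ?_) x
  · calc _ ≤ N * (ς / δ) * ‖x‖ := key
      _ = _ := by ring
  · rcases eq_or_ne u 0 with rfl | hu0
    · simp
    have hn : 0 < ‖u‖ := norm_pos_iff.2 hu0
    set t := δ / ‖u‖ with ht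
    have ht0 : 0 < t := by positivity
    have h1 := hr _ hK (0, -(t • u)) (by
      rw [Prod.norm_mk, norm_zero, norm_neg, norm_smul, Real.norm_of_nonneg ht0.le, ht,
        div_mul_cancel₀ _ hn.ne', max_eq_right hδ.le])
    have h2 : (X.act g s, X.A g (v - X.A g⁻¹ (t • u)) + s • w g + c g) ∈ Ω := by
      convert h1 using 1
      ext
      · simp
      · rw [map_sub, X.A_A_inv]
        simp only [Prod.snd_add]
        abel
    have h3 := hς _ (h.map_mem _ _ (h.cone.smul_mem t ht0.le u hu))
      (subset_closure ((h.mem_iff g _ _).1 h2))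
    rw [map_smul, norm_smul, Real.norm_of_nonneg ht0.le] at h3
    rw [LinearEquiv.coe_coe, div_mul_eq_mul_div, le_div_iff₀ hδ]
    rw [ht, div_mul_eq_mul_div, div_le_iff₀ hn] at h3
    linarith

end IsFiberedDomain

namespace IsFiberedDomain

variable {G V : Type*} [Group G] [NormedAddCommGroup V] [NormedSpace ℝ V]
  {X : BaseAction G V} {w c : G → V} {C : Set V} {Ω K : Set (ℝ × V)} [FiniteDimensional ℝ V]

/-- The closure of a fiber has a minimal point for a strictly positive functional. -/
lemma exists_minimal (h : IsFiberedDomain X w c C Ω K) {s : ℝ} (hs : s ∈ base Ω) :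
    ∃ p, (s, p) ∈ closure Ω ∧ ∃ ℓ : V →L[ℝ] ℝ, (∀ u ∈ C, ‖u‖ ≤ ℓ u) ∧
      ∀ q, (s, q) ∈ closure Ω → ℓ p ≤ ℓ q := by
  obtain ⟨ℓ, hℓ⟩ := h.cone.exists_strict_functional
  obtain ⟨v₀, hv₀⟩ := mem_base.1 hs
  set F : Set V := {v | (s, v) ∈ closure Ω ∧ ℓ v ≤ ℓ v₀} with hF
  have hFc : IsClosed F :=
    (isClosed_closure.preimage (Continuous.prodMk_right s)).inter
      (isClosed_le ℓ.continuous continuous_const)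
  have hFb : Bornology.IsBounded F := by
    by_contra hb
    rw [isBounded_iff_forall_norm_le] at hb
    push Not at hb
    choose x hx1 hx2 using fun n : ℕ => hb ((n : ℝ) + 1)
    have hpos : ∀ n, 0 < ‖x n‖ := fun n => lt_trans (by positivity) (hx2 n)
    have ht : Tendsto (fun n => ‖x n‖) atTop atTop :=
      tendsto_atTop_mono (fun n => (by linarith [hx2 n] : (n : ℝ) ≤ ‖x n‖))
        tendsto_natCast_atTop_atTop
    obtain ⟨d, hd, φ, hφ, hlim⟩ := (isCompact_sphere (0 : V) 1).tendsto_subseq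
      (x := fun n => ‖x n‖⁻¹ • x n) (fun n => by simp [norm_smul, (hpos n).ne'])
    have ht' := ht.comp hφ.tendsto_atTop
    have h1 : Tendsto (fun n => ‖x (φ n)‖⁻¹ • ((s, x (φ n)) : ℝ × V)) atTop (𝓝 (0, d)) := by
      have h2 : Tendsto (fun n => ‖x (φ n)‖⁻¹ * s) atTop (𝓝 (0 * s)) :=
        ht'.inv_tendsto_atTop.mul_const s
      rw [zero_mul] at h2
      exact h2.prodMk_nhds hlim
    have h2 := h.recession_mem (fun n => (hx1 (φ n)).1) ht' h1
    have h3 : Tendsto (fun n => ‖x (φ n)‖⁻¹ * ℓ v₀) atTop (𝓝 (0 * ℓ v₀)) :=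
      ht'.inv_tendsto_atTop.mul_const _
    rw [zero_mul] at h3
    have h4 := le_of_tendsto_of_tendsto ((ℓ.continuous.tendsto d).comp hlim) h3
      (Eventually.of_forall fun n => by
        simp only [Function.comp, map_smul, smul_eq_mul]
        exact mul_le_mul_of_nonneg_left (hx1 (φ n)).2 (by positivity))
    have h5 := hℓ d h2.2
    rw [mem_sphere_zero_iff_norm.1 hd] at h5
    linarith
  have hcomp : IsCompact F := Metric.isCompact_of_isClosed_isBounded hFc hFb
  obtain ⟨p, hp, hmin⟩ := hcomp.exists_isMinOn ⟨v₀, subset_closure hv₀, le_rfl⟩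
    ℓ.continuous.continuousOn
  refine ⟨p, hp.1, ℓ, hℓ, fun q hq => ?_⟩
  rcases le_total (ℓ q) (ℓ v₀) with h1 | h1
  · exact hmin ⟨hq, h1⟩
  · exact hp.2.trans h1

/-- Near a minimal point of a fiber the linear parts returning to the compact set expand. -/
lemma exists_expanding (h : IsFiberedDomain X w c C Ω K) {s : ℝ} (hs : s ∈ base Ω) :
    ∃ p, (s, p) ∈ closure Ω ∧ ∀ ε > 0, ∃ g q, (X.act g s, X.A g q + s • w g + c g) ∈ K ∧
      (s, q) ∈ Ω ∧ ‖q - p‖ ≤ ε ∧ ∀ x, ‖X.A g⁻¹ x‖ ≤ ε * ‖x‖ := by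
  obtain ⟨p, hp, ℓ, hℓ, hmin⟩ := h.exists_minimal hs
  obtain ⟨N, hN, hb⟩ := h.exists_inv_bound
  obtain ⟨u, hu⟩ := h.cone.interior_nonempty
  have hℓu : 0 ≤ ℓ u := (norm_nonneg u).trans (hℓ u (interior_subset hu))
  refine ⟨p, hp, fun ε hε => ?_⟩
  set η := ε / (ℓ u * N + ‖u‖ + 1) with hη
  have hη0 : 0 < η := by positivity
  have hηe : η * (ℓ u * N + ‖u‖ + 1) = ε := div_mul_cancel₀ _ (by positivity)
  have hx := h.add_interior_mem hs hp (h.cone.smul_mem_interior hη0 hu)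
  obtain ⟨g, hg⟩ := h.cocompact _ _ hx
  refine ⟨g, p + η • u, hg, hx, ?_, fun x => ?_⟩
  · rw [add_sub_cancel_left, norm_smul, Real.norm_of_nonneg hη0.le]
    nlinarith [mul_nonneg hℓu hN.le]
  · refine (hb g s _ (η * ℓ u) hg (fun z hz hzc => ?_) x).trans ?_
    · have h1 := hmin _ hzc
      rw [map_sub, map_add, map_smul, smul_eq_mul] at h1
      linarith [hℓ z hz]
    · gcongr
      nlinarith [norm_nonneg u]

lemma isOpen_base (h : IsFiberedDomain X w c C Ω K) : IsOpen (base Ω) :=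
  isOpenMap_fst _ h.isOpen

lemma exists_bounded_section (h : IsFiberedDomain X w c C Ω K) {J : Set ℝ} (hJ : IsCompact J)
    (hJΩ : J ⊆ base Ω) : ∃ B > 0, ∀ t ∈ J, ∃ y, ‖y‖ ≤ B ∧ (t, y) ∈ Ω := by
  choose! y hy using fun t (ht : t ∈ base Ω) => mem_base.1 ht
  obtain ⟨T, hT⟩ := hJ.elim_nhds_subcover' (fun t _ => {t' | (t', y t) ∈ Ω}) (fun t ht =>
    (h.isOpen.preimage (Continuous.prodMk_left (y t))).mem_nhds (hy t (hJΩ ht)))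
  refine ⟨∑ t ∈ T, ‖y t‖ + 1, by positivity, fun t ht => ?_⟩
  obtain ⟨t', ht', htt⟩ := mem_iUnion₂.1 (hT ht)
  refine ⟨y t', ?_, htt⟩
  have := Finset.single_le_sum (f := fun t : J => ‖y t‖) (fun i _ => norm_nonneg _) ht'
  linarith

/-- If returning elements keep the other fibers in a compact part of the base, the closure of
the domain contains the graph of an affine map. -/
lemma exists_affine_section (h : IsFiberedDomain X w c C Ω K) {s : ℝ} (hs : s ∈ base Ω)
    (hJ : ∀ σ ∈ base Ω, ∃ J, IsCompact J ∧ J ⊆ base Ω ∧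
      ∀ g, (X.act g s ∈ Prod.fst '' K) → X.act g σ ∈ J) :
    ∃ p ω : V, ∀ σ ∈ base Ω, (σ, p + (σ - s) • ω) ∈ closure Ω := by
  obtain ⟨p, hp, hexp⟩ := h.exists_expanding hs
  choose g q hg hq hqp hA using fun n : ℕ => hexp ((n : ℝ) + 1)⁻¹ (by positivity)
  have hε : Tendsto (fun n : ℕ => ((n : ℝ) + 1)⁻¹) atTop (𝓝 0) :=
    (tendsto_natCast_atTop_atTop.atTop_add tendsto_const_nhds).inv_tendsto_atTop
  have hqlim : Tendsto q atTop (𝓝 p) :=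
    tendsto_iff_norm_sub_tendsto_zero.2 (squeeze_zero (fun n => norm_nonneg _) hqp hε)
  obtain ⟨B, hB⟩ := h.compact.exists_bound_of_continuousOn (f := id) continuous_id.continuousOn
  set ω : ℕ → V := fun n => -X.A (g n)⁻¹ (w (g n)) with hω
  have hsec : ∀ σ ∈ base Ω, ∃ e : ℕ → V, Tendsto e atTop (𝓝 p) ∧
      ∀ n, (σ, e n + (σ - s) • ω n) ∈ Ω := by
    intro σ hσ
    obtain ⟨J, hJc, hJΩ, hJg⟩ := hJ σ hσ
    obtain ⟨B', hB', hsec⟩ := h.exists_bounded_section hJc hJΩ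
    choose y hy1 hy2 using fun n => hsec _ (hJg (g n) ⟨_, hg n, rfl⟩)
    set k : ℕ → V := fun n => X.A (g n) (q n) + s • w (g n) + c (g n) with hk
    refine ⟨fun n => X.A (g n)⁻¹ (y n - k n) + q n, ?_, fun n => ?_⟩
    · have h1 : Tendsto (fun n => X.A (g n)⁻¹ (y n - k n)) atTop (𝓝 0) := by
        have h2 := hε.mul_const (B' + B)
        rw [zero_mul] at h2
        refine squeeze_zero_norm (fun n => ?_) h2
        refine (hA n _).trans ?_
        gcongr
        refine (norm_sub_le _ _).trans (add_le_add (hy1 n) ?_)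
        exact (norm_snd_le (X.act (g n) s, k n)).trans (hB _ (hg n))
      simpa using h1.add hqlim
    · rw [← h.mem_iff (g n)]
      convert hy2 n using 2
      simp only [hk, hω, map_add, map_sub, map_smul, map_neg, X.A_A_inv]
      module
  obtain ⟨r, hr, hrs⟩ : ∃ r > 0, s + r ∈ base Ω ∧ s - r ∈ base Ω := by
    obtain ⟨ε, hε, hb⟩ := Metric.isOpen_iff.1 h.isOpen_base s hs
    refine ⟨ε / 2, by positivity, hb ?_, hb ?_⟩ <;>
      simp [abs_of_pos hε] <;> linarith
  obtain ⟨e₁, he₁, hm₁⟩ := hsec _ hrs.1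
  obtain ⟨e₂, he₂, hm₂⟩ := hsec _ hrs.2
  have hωb : ∃ M, ∀ n, ‖ω n‖ ≤ M := by
    obtain ⟨R, hR, hS⟩ := h.exists_norm_le
    obtain ⟨M₁, hM₁⟩ := (he₁.norm).bddAbove_range
    obtain ⟨M₂, hM₂⟩ := (he₂.norm).bddAbove_range
    have hM₁ : ∀ n, ‖e₁ n‖ ≤ M₁ := fun n => hM₁ ⟨n, rfl⟩
    have hM₂ : ∀ n, ‖e₂ n‖ ≤ M₂ := fun n => hM₂ ⟨n, rfl⟩
    refine ⟨(R * (1 + (|s + r| + |s - r| + (M₁ + M₂))) + M₁) / r, fun n => ?_⟩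
    have h1 := hS _ (subset_closure (hm₁ n)) _ (subset_closure (hm₂ n))
    have e : ((s + r, e₁ n + (s + r - s) • ω n) + (s - r, e₂ n + (s - r - s) • ω n) : ℝ × V) =
        (s + r + (s - r), e₁ n + e₂ n) := by
      ext
      · rfl
      · simp only [Prod.snd_add]; module
    rw [e] at h1
    have h2 : ‖((s + r + (s - r), e₁ n + e₂ n) : ℝ × V)‖ ≤
        |s + r| + |s - r| + (M₁ + M₂) := by
      rw [Prod.norm_mk, Real.norm_eq_abs]
      refine max_le ?_ ?_
      · have := abs_add_le (s + r) (s - r)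
        linarith [norm_nonneg (e₁ n), norm_nonneg (e₂ n), hM₁ n, hM₂ n]
      · refine (norm_add_le _ _).trans ?_
        linarith [hM₁ n, hM₂ n, abs_nonneg (s + r), abs_nonneg (s - r)]
    have h3 := (norm_snd_le (s + r, e₁ n + (s + r - s) • ω n)).trans h1
    rw [add_sub_cancel_left] at h3
    have h4 : ‖r • ω n‖ ≤ ‖e₁ n + r • ω n‖ + ‖e₁ n‖ := by
      have := norm_sub_le (e₁ n + r • ω n) (e₁ n)
      rwa [add_sub_cancel_left] at this
    rw [norm_smul, Real.norm_of_nonneg hr.le] at h4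
    rw [le_div_iff₀ hr]
    have h5 : R * (1 + ‖((s + r + (s - r), e₁ n + e₂ n) : ℝ × V)‖) ≤
      R * (1 + (|s + r| + |s - r| + (M₁ + M₂))) := by gcongr
    simp only at h3
    linarith [hM₁ n]
  obtain ⟨M, hM⟩ := hωb
  obtain ⟨ω', -, φ, hφ, hlim⟩ := (isCompact_closedBall (0 : V) M).tendsto_subseq
    (x := ω) (fun n => by simpa using hM n)
  refine ⟨p, ω', fun σ hσ => ?_⟩
  obtain ⟨e, he, hm⟩ := hsec σ hσ
  have h1 := (he.comp hφ.tendsto_atTop).add (hlim.const_smul (σ - s))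
  exact isClosed_closure.mem_of_tendsto (tendsto_const_nhds.prodMk_nhds h1)
    (Eventually.of_forall fun n => subset_closure (hm (φ n)))

lemma isBounded_base_of_affine_section (h : IsFiberedDomain X w c C Ω K) {s : ℝ} {p ω : V}
    (hpω : ∀ σ ∈ base Ω, (σ, p + (σ - s) • ω) ∈ closure Ω) : Bornology.IsBounded (base Ω) := by
  by_contra hb
  rw [isBounded_iff_forall_norm_le] at hb
  push Not at hb
  choose σ hσ1 hσ2 using fun n : ℕ => hb ((n : ℝ) + 1)
  have hpos : ∀ n, 0 < ‖σ n‖ := fun n => lt_trans (by positivity) (hσ2 n)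
  have ht : Tendsto (fun n => ‖σ n‖) atTop atTop :=
    tendsto_atTop_mono (fun n => (by linarith [hσ2 n] : (n : ℝ) ≤ ‖σ n‖))
      tendsto_natCast_atTop_atTop
  obtain ⟨d, hd, φ, hφ, hlim⟩ := (isCompact_sphere (0 : ℝ) 1).tendsto_subseq
    (x := fun n => ‖σ n‖⁻¹ • σ n) (fun n => by
      rw [mem_sphere_zero_iff_norm, norm_smul, norm_inv, norm_norm, inv_mul_cancel₀ (hpos n).ne'])
  have ht' := ht.comp hφ.tendsto_atTop
  have h1 : Tendsto (fun n => ‖σ (φ n)‖⁻¹ • ((σ (φ n), p + (σ (φ n) - s) • ω) : ℝ × V)) atTop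
      (𝓝 (d, (0 : ℝ) • (p - s • ω) + d • ω)) := by
    have h2 := (ht'.inv_tendsto_atTop.smul_const (p - s • ω)).add (hlim.smul_const ω)
    refine (hlim.prodMk_nhds h2).congr fun n => ?_
    ext
    · rfl
    · simp only [Function.comp, Prod.smul_snd, Pi.inv_apply, smul_eq_mul]
      module
  have h3 := h.recession_mem (fun n => hpω _ (hσ1 (φ n))) ht' h1
  have h4 : d = 0 := h3.1
  rw [h4] at hd
  simp at hd

lemma infDist_act (h : IsFiberedDomain X w c C Ω K) (hne : (base Ω)ᶜ.Nonempty) (g : G) (σ : ℝ) :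
    Metric.infDist (X.act g σ) (base Ω)ᶜ = |X.a g| * Metric.infDist σ (base Ω)ᶜ := by
  have hle : ∀ g σ, Metric.infDist (X.act g σ) (base Ω)ᶜ ≤
      |X.a g| * Metric.infDist σ (base Ω)ᶜ := by
    intro g σ
    have ha := abs_pos.2 (X.a_ne g)
    rw [← div_le_iff₀' ha]
    refine (Metric.le_infDist hne).2 fun y hy => ?_
    rw [div_le_iff₀' ha, Real.dist_eq, ← abs_mul, ← X.act_sub, ← Real.dist_eq]
    exact Metric.infDist_le_dist_of_mem (fun hm => hy ((h.act_mem_base g).1 hm))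
  refine le_antisymm (hle g σ) ?_
  have h1 := hle g⁻¹ (X.act g σ)
  rw [X.act_inv_act, X.a_inv, abs_inv, inv_mul_eq_div, le_div_iff₀ (abs_pos.2 (X.a_ne g))] at h1
  linarith

lemma base_eq_univ (h : IsFiberedDomain X w c C Ω K) : base Ω = univ := by
  by_contra hne
  have hne : (base Ω)ᶜ.Nonempty := nonempty_compl.2 hne
  have hcl : IsClosed (base Ω)ᶜ := h.isOpen_base.isClosed_compl
  have hpos : ∀ σ, 0 < Metric.infDist σ (base Ω)ᶜ ↔ σ ∈ base Ω := by
    intro σ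
    rw [← hcl.notMem_iff_infDist_pos hne, notMem_compl_iff]
  have hKc : IsCompact (Prod.fst '' K) := h.compact.image continuous_fst
  obtain ⟨⟨s, v⟩, hsv⟩ := h.nonempty
  have hs : s ∈ base Ω := mem_base.2 ⟨v, hsv⟩
  have hKne : (Prod.fst '' K).Nonempty := by
    obtain ⟨g, hg⟩ := h.cocompact s v hsv
    exact ⟨_, _, hg, rfl⟩
  obtain ⟨t₀, ht₀, hmin⟩ := hKc.exists_isMinOn hKne
    (Metric.continuous_infDist_pt (base Ω)ᶜ).continuousOn
  obtain ⟨t₁, ht₁, hmax⟩ := hKc.exists_isMaxOn hKne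
    (Metric.continuous_infDist_pt (base Ω)ᶜ).continuousOn
  have hδ : 0 < Metric.infDist t₀ (base Ω)ᶜ := (hpos t₀).2 (image_mono h.subset ht₀)
  set δ := Metric.infDist t₀ (base Ω)ᶜ
  set R := Metric.infDist t₁ (base Ω)ᶜ
  obtain ⟨B, hB⟩ := hKc.exists_bound_of_continuousOn (f := id) continuous_id.continuousOn
  have hbdd : Bornology.IsBounded (base Ω) := by
    obtain ⟨p, ω, hpω⟩ := h.exists_affine_section hs (fun σ hσ => by
      have hds := (hpos s).2 hs
      have hdσ := (hpos σ).2 hσ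
      set ds := Metric.infDist s (base Ω)ᶜ with hds_def
      set dσ := Metric.infDist σ (base Ω)ᶜ with hdσ_def
      refine ⟨Icc (-(B + R / ds * |σ - s|)) (B + R / ds * |σ - s|) ∩
        {t | δ / ds * dσ ≤ Metric.infDist t (base Ω)ᶜ}, ?_, ?_, ?_⟩
      · exact isCompact_Icc.inter_right
          (isClosed_le continuous_const (Metric.continuous_infDist_pt _))
      · rintro t ⟨-, ht⟩
        exact (hpos t).1 (lt_of_lt_of_le (by positivity) ht)
      · intro g hg
        have h1 : δ ≤ Metric.infDist (X.act g s) (base Ω)ᶜ := hmin hg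
        have h2 : Metric.infDist (X.act g s) (base Ω)ᶜ ≤ R := hmax hg
        rw [h.infDist_act hne, ← hds_def] at h1 h2
        refine ⟨abs_le.1 ?_, ?_⟩
        · have e : X.act g σ = X.act g s + X.a g * (σ - s) := by
            rw [← X.act_add]; ring_nf
          rw [e]
          refine (abs_add_le _ _).trans (add_le_add (hB _ hg) ?_)
          rw [abs_mul]
          gcongr
          rwa [le_div_iff₀ hds]
        · rw [mem_ofPred_eq, h.infDist_act hne]
          gcongr
          rwa [div_le_iff₀ hds])
    exact h.isBounded_base_of_affine_section hpω
  obtain ⟨D, hD⟩ := isBounded_iff_forall_norm_le.1 hbdd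
  have ha : ∀ g, |X.a g| ≤ 1 := by
    intro g
    by_contra! hg
    obtain ⟨ε, hε, hb⟩ := Metric.isOpen_iff.1 h.isOpen_base s hs
    have hs' : s + ε / 2 ∈ base Ω := hb (by
      simp only [Metric.mem_ball, Real.dist_eq, add_sub_cancel_left, abs_of_pos (half_pos hε)]
      linarith)
    obtain ⟨n, hn⟩ := pow_unbounded_of_one_lt (2 * D / (ε / 2)) hg
    have h1 := X.act_sub (g ^ n) (s + ε / 2) s
    have h2 := hD _ ((h.act_mem_base (g ^ n)).2 hs')
    have h3 := hD _ ((h.act_mem_base (g ^ n)).2 hs)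
    have h4 := norm_sub_le (X.act (g ^ n) (s + ε / 2)) (X.act (g ^ n) s)
    rw [h1, X.a_pow, add_sub_cancel_left, norm_mul, norm_pow, Real.norm_eq_abs,
      Real.norm_of_nonneg (half_pos hε).le] at h4
    rw [div_lt_iff₀ (by positivity)] at hn
    linarith
  have hge : ∀ σ ∈ base Ω, δ ≤ Metric.infDist σ (base Ω)ᶜ := by
    intro σ hσ
    obtain ⟨v, hv⟩ := mem_base.1 hσ
    obtain ⟨g, hg⟩ := h.cocompact σ v hv
    have h1 : δ ≤ Metric.infDist (X.act g σ) (base Ω)ᶜ := hmin ⟨_, hg, rfl⟩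
    rw [h.infDist_act hne] at h1
    exact h1.trans (mul_le_of_le_one_left Metric.infDist_nonneg (ha g))
  have hclopen : IsClopen (base Ω) := by
    refine ⟨?_, h.isOpen_base⟩
    have : base Ω = {σ | δ ≤ Metric.infDist σ (base Ω)ᶜ} := by
      ext σ
      exact ⟨hge σ, fun hσ => (hpos σ).1 (lt_of_lt_of_le hδ hσ)⟩
    rw [this]
    exact isClosed_le continuous_const (Metric.continuous_infDist_pt _)
  rcases isClopen_iff.1 hclopen with h0 | h0
  · rw [h0] at hs; exact hs
  · rw [h0] at hne; simp at hne

lemma mem_base_all (h : IsFiberedDomain X w c C Ω K) (s : ℝ) : s ∈ base Ω := by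
  rw [h.base_eq_univ]; trivial

lemma exists_act_bound (h : IsFiberedDomain X w c C Ω K) :
    ∃ J, ∀ g s v, (X.act g s, X.A g v + s • w g + c g) ∈ K → |X.act g s| ≤ J := by
  obtain ⟨B, hB⟩ := h.compact.exists_bound_of_continuousOn (f := Prod.fst)
    continuous_fst.continuousOn
  exact ⟨B, fun g s v hg => hB _ hg⟩

lemma isExpanding (h : IsFiberedDomain X w c C Ω K) : X.IsExpanding := by
  obtain ⟨B, hB⟩ := h.compact.exists_bound_of_continuousOn (f := Prod.fst)
    continuous_fst.continuousOn
  refine ⟨B, fun s M => ?_⟩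
  by_contra! hcon
  obtain ⟨p, ω, hpω⟩ := h.exists_affine_section (h.mem_base_all s) (fun σ _ => by
    refine ⟨Icc (-(B + M * |σ - s|)) (B + M * |σ - s|), isCompact_Icc,
      fun t _ => h.mem_base_all t, ?_⟩
    rintro g ⟨k, hk, hkg⟩
    have h1 : |X.act g s| ≤ B := by rw [← hkg]; exact hB k hk
    have e : X.act g σ = X.act g s + X.a g * (σ - s) := by
      rw [← X.act_add]; ring_nf
    refine abs_le.1 ?_
    rw [e]
    refine (abs_add_le _ _).trans (add_le_add h1 ?_)
    rw [abs_mul]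
    gcongr
    exact hcon g h1)
  have hb := h.isBounded_base_of_affine_section hpω
  rw [h.base_eq_univ] at hb
  exact NormedSpace.unbounded_univ ℝ ℝ hb

end IsFiberedDomain

namespace IsFiberedDomain

/-- A point of the closed fiber over `s` whose translated cone contains the fiber. -/
def IsVertex {V : Type*} [NormedAddCommGroup V] (C : Set V) (Ω : Set (ℝ × V)) (s : ℝ) (p : V) :
    Prop :=
  (s, p) ∈ closure Ω ∧ ∀ z, (s, z) ∈ Ω → z - p ∈ C

variable {G V : Type*} [Group G] [NormedAddCommGroup V] [NormedSpace ℝ V]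
  {X : BaseAction G V} {w c : G → V} {C : Set V} {Ω K : Set (ℝ × V)} [FiniteDimensional ℝ V]

lemma exists_preimage (h : IsFiberedDomain X w c C Ω K) (g : G) {s : ℝ} {z : V}
    (hz : (X.act g s, z) ∈ Ω) : ∃ y, (s, y) ∈ Ω ∧ z = X.A g y + s • w g + c g := by
  have e : z = X.A g (X.A g⁻¹ (z - s • w g - c g)) + s • w g + c g := by
    rw [X.A_A_inv]; abel
  refine ⟨_, ?_, e⟩
  rw [e] at hz
  exact (h.mem_iff g _ _).1 hz

lemma isVertex_map (h : IsFiberedDomain X w c C Ω K) (g : G) {s : ℝ} {p : V}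
    (hp : IsVertex C Ω s p) : IsVertex C Ω (X.act g s) (X.A g p + s • w g + c g) := by
  refine ⟨(h.mem_closure_iff g s p).2 hp.1, fun z hz => ?_⟩
  obtain ⟨y, hy, rfl⟩ := h.exists_preimage g hz
  have := h.map_mem g _ (hp.2 y hy)
  rw [map_sub] at this
  convert this using 1
  abel

lemma sub_mem_of_isVertex (h : IsFiberedDomain X w c C Ω K) {s : ℝ} {p q : V}
    (hp : IsVertex C Ω s p) (hq : (s, q) ∈ closure Ω) : q - p ∈ C := by
  obtain ⟨u, hu⟩ := h.cone.interior_nonempty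
  have h1 : Tendsto (fun t : ℝ => q + t • u - p) (𝓝[>] 0) (𝓝 (q + (0 : ℝ) • u - p)) :=
    (Continuous.tendsto (by fun_prop) 0).mono_left nhdsWithin_le_nhds
  rw [zero_smul, add_zero] at h1
  refine h.cone.closed.mem_of_tendsto h1 ?_
  filter_upwards [self_mem_nhdsWithin] with t ht
  exact hp.2 _ (h.add_interior_mem (h.mem_base_all s) hq (h.cone.smul_mem_interior ht hu))

lemma isVertex_unique (h : IsFiberedDomain X w c C Ω K) {s : ℝ} {p q : V}
    (hp : IsVertex C Ω s p) (hq : IsVertex C Ω s q) : p = q := by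
  have h1 := h.sub_mem_of_isVertex hp hq.1
  have h2 := h.sub_mem_of_isVertex hq hp.1
  rw [← neg_sub] at h2
  exact (sub_eq_zero.1 (h.cone.pointed _ h1 h2)).symm

lemma eventually_mem (h : IsFiberedDomain X w c C Ω K) {s : ℕ → ℝ} {s₀ : ℝ}
    (hs : Tendsto s atTop (𝓝 s₀)) {z : V} (hz : (s₀, z) ∈ Ω) : ∀ᶠ n in atTop, (s n, z) ∈ Ω :=
  (hs.prodMk_nhds tendsto_const_nhds).eventually (h.isOpen.mem_nhds hz)

lemma exists_isVertex_limit (h : IsFiberedDomain X w c C Ω K) {s : ℕ → ℝ} {p : ℕ → V} {s₀ : ℝ}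
    (hs : Tendsto s atTop (𝓝 s₀)) (hp : ∀ n, IsVertex C Ω (s n) (p n)) :
    ∃ p₀, IsVertex C Ω s₀ p₀ ∧ ∃ φ : ℕ → ℕ, StrictMono φ ∧ Tendsto (p ∘ φ) atTop (𝓝 p₀) := by
  obtain ⟨R, hR, hb⟩ := h.exists_cone_norm_le
  obtain ⟨y, hy⟩ := mem_base.1 (h.mem_base_all s₀)
  obtain ⟨B, hB⟩ := (hs.norm).bddAbove_range
  have hB : ∀ n, ‖s n‖ ≤ B := fun n => hB ⟨n, rfl⟩
  obtain ⟨p₀, -, φ, hφ, hlim⟩ := tendsto_subseq_of_frequently_bounded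
    (s := Metric.closedBall (0 : V) (‖y‖ + R * (1 + (B + ‖y‖)))) Metric.isBounded_closedBall
    (x := p) (by
      refine Eventually.frequently ?_
      filter_upwards [h.eventually_mem hs hy] with n hn
      rw [mem_closedBall_zero_iff]
      have h1 := hb (s n) y (y - p n) ((hp n).2 _ hn) (by
        rw [sub_sub_cancel]; exact (hp n).1)
      have h2 : ‖(s n, y)‖ ≤ B + ‖y‖ := by
        rw [Prod.norm_mk]
        refine max_le ?_ ?_ <;> linarith [hB n, norm_nonneg y, norm_nonneg (s n)]
      have h3 := norm_sub_le y (y - p n)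
      rw [sub_sub_cancel] at h3
      have h4 : R * (1 + ‖(s n, y)‖) ≤ R * (1 + (B + ‖y‖)) := by gcongr
      linarith)
  refine ⟨p₀, ⟨?_, fun z hz => ?_⟩, φ, hφ, hlim⟩
  · exact isClosed_closure.mem_of_tendsto ((hs.comp hφ.tendsto_atTop).prodMk_nhds hlim)
      (Eventually.of_forall fun n => (hp (φ n)).1)
  · refine h.cone.closed.mem_of_tendsto (hlim.const_sub z) ?_
    filter_upwards [hφ.tendsto_atTop.eventually (h.eventually_mem hs hz)] with n hn
    exact (hp (φ n)).2 z hn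

lemma exists_isVertex (h : IsFiberedDomain X w c C Ω K) : ∃ s p, IsVertex C Ω s p := by
  obtain ⟨R, hR, hcb⟩ := h.exists_cone_norm_le
  obtain ⟨N, hN, hib⟩ := h.exists_inv_bound
  obtain ⟨N', hN', hAb⟩ := h.cone.exists_bound
  obtain ⟨⟨s, y⟩, hy⟩ := h.nonempty
  obtain ⟨u, hu⟩ := h.cone.interior_nonempty
  have huC := interior_subset hu
  obtain ⟨δ, hδ, hur⟩ := IsSolidCone.mem_interior_iff.1 hu
  obtain ⟨B, hB⟩ := h.compact.exists_bound_of_continuousOn (f := id) continuous_id.continuousOn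
  set t : ℕ → ℝ := fun n => (n : ℝ) + 1 with ht
  have ht0 : ∀ n, 0 < t n := fun n => by positivity
  have ht1 : ∀ n, 1 ≤ t n := fun n => by simp [ht]
  have htt : Tendsto t atTop atTop :=
    tendsto_natCast_atTop_atTop.atTop_add tendsto_const_nhds
  have hx : ∀ n, (s, y + t n • u) ∈ Ω := fun n =>
    h.add_cone_mem hy (h.cone.smul_mem _ (ht0 n).le _ huC)
  choose g hg using fun n => h.cocompact _ _ (hx n)
  set b : ℕ → ℝ := fun n => X.act (g n) s with hbdef
  set p : ℕ → V := fun n => X.A (g n) y + s • w (g n) + c (g n) with hpdef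
  have hp : ∀ n, (b n, p n) ∈ Ω := fun n => (h.mem_iff _ _ _).2 hy
  have hAu : ∀ n, t n * ‖X.A (g n) u‖ ≤ R * (1 + B) := by
    intro n
    have h1 := hcb _ _ (X.A (g n) (t n • u)) (h.map_mem _ _ (h.cone.smul_mem _ (ht0 n).le _ huC))
      (by
        convert subset_closure (hp n) using 1
        rw [hpdef, hbdef]
        simp only [map_add]
        congr 1
        · abel : (b n, X.A (g n) (y + t n • u) + s • w (g n) + c (g n) - X.A (g n) (t n • u)) ∈
            closure Ω)
    have h2 := hB _ (hg n)
    rw [map_smul, norm_smul, Real.norm_of_nonneg (ht0 n).le] at h1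
    refine h1.trans ?_
    gcongr
    exact h2
  have hA : ∀ n v, ‖X.A (g n) (t n • v)‖ ≤ N' / δ * (R * (1 + B)) * ‖v‖ := by
    intro n v
    have h1 := hAb (X.A (g n) : V →ₗ[ℝ] V) (h.map_mem _) u δ hδ hur (t n • v)
    simp only [LinearEquiv.coe_coe] at h1
    refine h1.trans ?_
    rw [norm_smul, Real.norm_of_nonneg (ht0 n).le]
    calc N' / δ * ‖X.A (g n) u‖ * (t n * ‖v‖) = N' / δ * (t n * ‖X.A (g n) u‖) * ‖v‖ := by ring
      _ ≤ _ := mul_le_mul_of_nonneg_right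
        (mul_le_mul_of_nonneg_left (hAu n) (by positivity)) (norm_nonneg _)
  have hAi : ∀ n x, ‖(t n)⁻¹ • X.A (g n)⁻¹ x‖ ≤ N * (R * (1 + ‖(s, y)‖ + ‖u‖)) * ‖x‖ := by
    intro n x
    rw [norm_smul, norm_inv, Real.norm_of_nonneg (ht0 n).le, inv_mul_le_iff₀ (ht0 n)]
    refine (hib (g n) s _ (t n * (R * (1 + ‖(s, y)‖ + ‖u‖))) (hg n)
      (fun z hz hzc => ?_) x).trans (le_of_eq (by ring))
    refine (hcb _ _ z hz hzc).trans ?_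
    have h1 : ‖(s, y + t n • u)‖ ≤ ‖(s, y)‖ + t n * ‖u‖ := by
      have h2 := norm_add_le (s, y) ((0 : ℝ), t n • u)
      rw [Prod.mk_add_mk, add_zero] at h2
      refine h2.trans (add_le_add le_rfl ?_)
      rw [Prod.norm_mk, norm_zero, norm_smul, Real.norm_of_nonneg (ht0 n).le]
      exact max_le (by have := ht0 n; positivity) le_rfl
    have h3 : 1 + ‖(s, y)‖ ≤ t n * (1 + ‖(s, y)‖) := le_mul_of_one_le_left (by positivity) (ht1 n)
    calc R * (1 + ‖(s, y + t n • u)‖) ≤ R * (t n * (1 + ‖(s, y)‖) + t n * ‖u‖) := by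
          refine mul_le_mul_of_nonneg_left ?_ hR.le
          linarith
      _ = _ := by ring
  have hpb : ∀ n, (b n, p n) ∈ Metric.closedBall (0 : ℝ × V) (B + R * (1 + B)) := by
    intro n
    rw [mem_closedBall_zero_iff, Prod.norm_mk]
    have h2 := hB _ (hg n)
    have hRB : 0 ≤ R * (1 + B) :=
      (mul_nonneg (ht0 n).le (norm_nonneg _)).trans (hAu n)
    refine max_le ?_ ?_
    · have := (norm_fst_le (X.act (g n) s, X.A (g n) (y + t n • u) + s • w (g n) + c (g n))).trans h2
      simp only [hbdef] at this ⊢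
      linarith
    · have h3 := (norm_snd_le (X.act (g n) s,
        X.A (g n) (y + t n • u) + s • w (g n) + c (g n))).trans h2
      have e : p n = X.A (g n) (y + t n • u) + s • w (g n) + c (g n) - t n • X.A (g n) u := by
        simp only [hpdef, map_add, map_smul]; abel
      rw [e]
      refine (norm_sub_le _ _).trans (add_le_add h3 ?_)
      rw [norm_smul, Real.norm_of_nonneg (ht0 n).le]
      exact hAu n
  obtain ⟨⟨b₀, p₀⟩, -, φ, hφ, hlim⟩ :=
    (isCompact_closedBall (0 : ℝ × V) (B + R * (1 + B))).tendsto_subseq hpb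
  have hblim : Tendsto (fun n => b (φ n)) atTop (𝓝 b₀) :=
    (continuous_fst.tendsto _).comp hlim
  have hplim : Tendsto (fun n => p (φ n)) atTop (𝓝 p₀) :=
    (continuous_snd.tendsto _).comp hlim
  refine ⟨b₀, p₀, isClosed_closure.mem_of_tendsto hlim
    (Eventually.of_forall fun n => subset_closure (hp (φ n))), fun z hz => ?_⟩
  obtain ⟨n₀, hn₀⟩ := eventually_atTop.1 (h.eventually_mem hblim hz)
  set ψ : ℕ → ℕ := fun n => φ (n + n₀) with hψ
  have hψt : Tendsto ψ atTop atTop := hφ.tendsto_atTop.comp (tendsto_add_atTop_nat n₀)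
  have hpψ : Tendsto (fun n => p (ψ n)) atTop (𝓝 p₀) := hplim.comp (tendsto_add_atTop_nat n₀)
  choose q hq hqe using fun n => h.exists_preimage (g (ψ n)) (hn₀ (n + n₀) (by omega))
  set d : ℕ → V := fun n => (t (ψ n))⁻¹ • (q n - y) with hd
  have hde : ∀ n, X.A (g (ψ n)) (t (ψ n) • d n) = z - p (ψ n) := by
    intro n
    rw [hd]
    simp only [smul_inv_smul₀ (ht0 _).ne']
    nth_rw 1 [hqe n]
    simp only [hpdef, map_sub]
    abel
  have hdb : ∃ M, ∀ n, ‖d n‖ ≤ M := by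
    obtain ⟨M, hM⟩ := ((hpψ.const_sub z).norm).bddAbove_range
    have hM : ∀ n, ‖z - p (ψ n)‖ ≤ M := fun n => hM ⟨n, rfl⟩
    refine ⟨N * (R * (1 + ‖(s, y)‖ + ‖u‖)) * M, fun n => ?_⟩
    have h1 := hAi (ψ n) (z - p (ψ n))
    rw [← hde, X.A_inv_A, inv_smul_smul₀ (ht0 _).ne', hde] at h1
    refine h1.trans ?_
    gcongr
    exact hM n
  obtain ⟨M, hM⟩ := hdb
  obtain ⟨d₀, -, χ, hχ, hdlim⟩ := (isCompact_closedBall (0 : V) M).tendsto_subseq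
    (x := d) (fun n => by simpa using hM n)
  have htχ := htt.comp (hψt.comp hχ.tendsto_atTop)
  have hd₀ : d₀ ∈ C := by
    refine (h.recession_mem (x := fun n => (s, q (χ n))) (d := (0, d₀))
      (fun n => subset_closure (hq (χ n))) htχ ?_).2
    have h1 := (htχ.inv_tendsto_atTop.mul_const s).prodMk_nhds
      (hdlim.add (htχ.inv_tendsto_atTop.smul_const y))
    rw [zero_mul, zero_smul, add_zero] at h1
    refine h1.congr fun n => ?_
    ext
    · rfl
    · simp only [Function.comp, hd, Pi.inv_apply, Prod.smul_snd]
      module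
  have hfin : Tendsto (fun n => z - p (ψ (χ n)) -
      X.A (g (ψ (χ n))) (t (ψ (χ n)) • (d (χ n) - d₀))) atTop (𝓝 (z - p₀ - 0)) := by
    refine ((hpψ.comp hχ.tendsto_atTop).const_sub z).sub ?_
    have h1 := (tendsto_iff_norm_sub_tendsto_zero.1 hdlim).const_mul (N' / δ * (R * (1 + B)))
    rw [mul_zero] at h1
    exact squeeze_zero_norm (fun n => hA _ _) h1
  rw [sub_zero] at hfin
  refine h.cone.closed.mem_of_tendsto hfin (Eventually.of_forall fun n => ?_)
  rw [smul_sub, map_sub, hde, sub_sub_cancel]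
  exact h.map_mem _ _ (h.cone.smul_mem _ (ht0 _).le _ hd₀)

lemma exists_isVertex_all (h : IsFiberedDomain X w c C Ω K) (s : ℝ) : ∃ p, IsVertex C Ω s p := by
  obtain ⟨s₀, p₀, h0⟩ := h.exists_isVertex
  have hd := h.isExpanding.dense_translations
  obtain ⟨x, hx, hlim⟩ := mem_closure_iff_seq_limit.1 (hd (s - s₀))
  choose g hg1 hg2 using hx
  have h1 : Tendsto (fun n => X.act (g n) s₀) atTop (𝓝 s) := by
    have := hlim.const_add s₀
    rw [add_sub_cancel] at this
    refine this.congr fun n => ?_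
    rw [BaseAction.act, hg1, hg2, one_mul]
  obtain ⟨p, hp, -⟩ := h.exists_isVertex_limit h1 (fun n => h.isVertex_map (g n) h0)
  exact ⟨p, hp⟩

/-- A fibered domain is the union of translates of the open cone along an equivariant curve. -/
theorem exists_profile (h : IsFiberedDomain X w c C Ω K) :
    ∃ f : ℝ → V, IsEquivariantProfile X C f ∧ ∀ s v, (s, v) ∈ Ω ↔ v - f s ∈ interior C := by
  choose f hf using h.exists_isVertex_all
  obtain ⟨u, hu⟩ := h.cone.interior_nonempty
  have hmem : ∀ s v, (s, v) ∈ Ω ↔ v - f s ∈ interior C := by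
    intro s v
    constructor
    · intro hv
      obtain ⟨ε, hε, hb⟩ := Metric.isOpen_iff.1
        (h.isOpen.preimage (Continuous.prodMk_right s)) v hv
      refine IsSolidCone.mem_interior_iff.2 ⟨ε / 2, by positivity, fun x hx => ?_⟩
      have h1 : (s, v + x) ∈ Ω := hb (by
        rw [Metric.mem_ball, dist_self_add_left]; linarith)
      convert (hf s).2 _ h1 using 1
      abel
    · intro hv
      have := h.add_interior_mem (h.mem_base_all s) (hf s).1 hv
      rwa [add_sub_cancel] at this
  have hcont : Continuous f := by
    refine continuous_iff_seqContinuous.2 fun s s₀ hs => ?_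
    refine tendsto_of_subseq_tendsto fun ns hns => ?_
    obtain ⟨p, hp, φ, -, hlim⟩ := h.exists_isVertex_limit (hs.comp hns)
      (fun n => hf (s (ns n)))
    exact ⟨φ, h.isVertex_unique hp (hf s₀) ▸ hlim⟩
  have hmap : ∀ g s, f (X.act g s) = X.A g (f s) + s • w g + c g := fun g s =>
    h.isVertex_unique (hf _) (h.isVertex_map g (hf s))
  refine ⟨f, ⟨h.cone, h.map_mem, hcont, fun r s => ?_, fun g r s => ?_, ?_, ?_⟩, hmem⟩
  · have h1 : Tendsto (fun t : ℝ => secondDiff f r s + t • u) (𝓝[>] 0)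
        (𝓝 (secondDiff f r s + (0 : ℝ) • u)) :=
      (Continuous.tendsto (by fun_prop) 0).mono_left nhdsWithin_le_nhds
    rw [zero_smul, add_zero] at h1
    refine h.cone.closed.mem_of_tendsto h1 ?_
    filter_upwards [self_mem_nhdsWithin] with t ht
    have htu : (t / 2) • u ∈ interior C := h.cone.smul_mem_interior (half_pos ht) hu
    have ha : (s + r, f (s + r) + (t / 2) • u) ∈ Ω := (hmem _ _).2 (by
      rwa [add_sub_cancel_left])
    have hb : (s - r, f (s - r) + (t / 2) • u) ∈ Ω := (hmem _ _).2 (by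
      rwa [add_sub_cancel_left])
    have hab := h.convex ha hb (a := 1 / 2) (b := 1 / 2) (by norm_num) (by norm_num) (by norm_num)
    have e : (1 / 2 : ℝ) • (s + r, f (s + r) + (t / 2) • u) +
        (1 / 2 : ℝ) • (s - r, f (s - r) + (t / 2) • u) =
        (s, (1 / 2 : ℝ) • (f (s + r) + f (s - r) + t • u)) := by
      ext
      · simp; ring
      · simp only [Prod.snd_add, Prod.smul_snd]; module
    rw [e, hmem] at hab
    have := h.cone.smul_mem 2 (by norm_num) _ (interior_subset hab)
    convert this using 1
    unfold secondDiff
    module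
  · unfold secondDiff
    rw [← X.act_add, show X.act g s - X.a g * r = X.act g (s - r) by
      rw [sub_eq_add_neg s r, X.act_add]; ring, hmap, hmap, hmap]
    simp only [map_sub, map_add, map_smul]
    module
  · obtain ⟨J, hJ⟩ := h.exists_act_bound
    refine ⟨J, (fun x : ℝ × V => x.2 - f x.1) '' K, h.compact.image (by fun_prop), ?_, ?_⟩
    · rintro _ ⟨⟨s, v⟩, hx, rfl⟩
      exact (hmem s v).1 (h.subset hx)
    · intro s v hv
      obtain ⟨g, hg⟩ := h.cocompact s (f s + v) ((hmem _ _).2 (by rwa [add_sub_cancel_left]))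
      refine ⟨g, hJ _ _ _ hg, ⟨_, hg, ?_⟩⟩
      simp only [hmap, map_add]
      abel
  · by_contra! hcon
    have hlin := affine_of_secondDiff_eq_zero hcont hcon
    have := ((h.recession ((1 : ℝ), f 1 - f 0)).1 (fun x hx t _ => by
      obtain ⟨s, v⟩ := x
      have h1 := (hmem s v).1 hx
      refine (hmem (s + t • (1 : ℝ)) (v + t • (f 1 - f 0))).2 ?_
      rw [smul_eq_mul, mul_one]
      rw [hlin s] at h1
      rw [hlin (s + t)]
      convert h1 using 1
      module)).1
    exact one_ne_zero this

end IsFiberedDomain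

/-- The open cone swept out by the lines in direction `c₀` through interior points of `C`. -/
def shadow {V : Type*} [NormedAddCommGroup V] [NormedSpace ℝ V] (C : Set V) (c₀ : V) : Set V :=
  {v | ∃ z : ℝ, v + z • c₀ ∈ interior C}

/-- The boundary of `C` as a graph in direction `c₀` over its shadow. -/
def height {V : Type*} [NormedAddCommGroup V] [NormedSpace ℝ V] (C : Set V) (c₀ : V) (v : V) :
    ℝ :=
  sInf {z : ℝ | v + z • c₀ ∈ C}

namespace IsSolidCone

variable {V : Type*} [NormedAddCommGroup V] [NormedSpace ℝ V] {C : Set V} {c₀ : V}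

lemma subset_closure_interior (hC : IsSolidCone C) : C ⊆ closure (interior C) := by
  intro x hx
  obtain ⟨u, hu⟩ := hC.interior_nonempty
  have h1 : Tendsto (fun t : ℝ => t • u + x) (𝓝[>] 0) (𝓝 ((0 : ℝ) • u + x)) :=
    (Continuous.tendsto (by fun_prop) 0).mono_left nhdsWithin_le_nhds
  rw [zero_smul, zero_add] at h1
  refine mem_closure_of_tendsto h1 ?_
  filter_upwards [self_mem_nhdsWithin] with t ht
  exact hC.add_mem_interior (hC.smul_mem_interior ht hu) hx

/-- An open convex cone is supported at every point outside of it. -/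
lemma exists_support_of_notMem {S : Set V} (ho : IsOpen S) (hc : Convex ℝ S) (hne : S.Nonempty)
    (hs : ∀ t : ℝ, 0 < t → ∀ x ∈ S, t • x ∈ S) {p : V} (hp : p ∉ S) :
    ∃ ℓ : V →L[ℝ] ℝ, (∀ x ∈ S, 0 < ℓ x) ∧ ℓ p ≤ 0 := by
  obtain ⟨f, hf⟩ := geometric_hahn_banach_open_point hc ho hp
  have h0 : 0 ≤ f p := by
    obtain ⟨x, hx⟩ := hne
    have h1 : Tendsto (fun t : ℝ => t * f x) (𝓝[>] 0) (𝓝 (0 * f x)) :=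
      (Continuous.tendsto (by fun_prop) 0).mono_left nhdsWithin_le_nhds
    rw [zero_mul] at h1
    refine le_of_tendsto h1 ?_
    filter_upwards [self_mem_nhdsWithin] with t ht
    have := hf _ (hs t ht x hx)
    rw [map_smul, smul_eq_mul] at this
    exact this.le
  have hle : ∀ x ∈ S, f x ≤ 0 := by
    intro x hx
    by_contra! hpos
    have := hf _ (hs ((f p + 1) / f x) (by positivity) x hx)
    rw [map_smul, smul_eq_mul, div_mul_cancel₀ _ hpos.ne'] at this
    linarith
  refine ⟨-f, fun x hx => ?_, by simpa using h0⟩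
  rw [_root_.neg_apply, neg_pos]
  refine lt_of_le_of_ne (hle x hx) fun h => ?_
  obtain ⟨ε, hε, hb⟩ := Metric.isOpen_iff.1 ho x hx
  have hf0 : f = 0 := by
    ext y
    rcases eq_or_ne y 0 with rfl | hy
    · simp
    have hn := norm_pos_iff.2 hy
    have key : ∀ t : ℝ, |t| * ‖y‖ < ε → t * f y ≤ 0 := by
      intro t ht
      have := hle (x + t • y) (hb (by
        rw [Metric.mem_ball, dist_self_add_left, norm_smul, Real.norm_eq_abs]
        exact ht))
      rwa [map_add, h, zero_add, map_smul, smul_eq_mul] at this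
    have hq : 0 < ε / 2 / ‖y‖ := by positivity
    have hlt : |ε / 2 / ‖y‖| * ‖y‖ < ε := by
      rw [abs_of_pos hq, div_mul_cancel₀ _ hn.ne']; linarith
    have h1 := key (ε / 2 / ‖y‖) hlt
    have h2 := key (-(ε / 2 / ‖y‖)) (by rwa [abs_neg])
    have h3 : ε / 2 / ‖y‖ * f y = 0 := by linarith
    simpa [hq.ne'] using h3
  have := hf x hx
  rw [hf0] at this
  simp at this

/-- A boundary point of a solid cone is annihilated by a functional positive on the interior. -/
lemma exists_support (hC : IsSolidCone C) {p : V} (hp : p ∈ C) (hpi : p ∉ interior C) :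
    ∃ ℓ : V →L[ℝ] ℝ, (∀ x ∈ C, 0 ≤ ℓ x) ∧ (∀ x ∈ interior C, 0 < ℓ x) ∧ ℓ p = 0 := by
  obtain ⟨ℓ, h1, h2⟩ := exists_support_of_notMem isOpen_interior hC.convex.interior
    hC.interior_nonempty (fun t ht x hx => hC.smul_mem_interior ht hx) hpi
  have h3 : ∀ x ∈ C, 0 ≤ ℓ x := by
    intro x hx
    have h4 : closure (interior C) ⊆ {x | 0 ≤ ℓ x} :=
      closure_minimal (fun x hx => (h1 x hx).le) (isClosed_le continuous_const ℓ.continuous)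
    exact h4 (hC.subset_closure_interior hx)
  exact ⟨ℓ, h3, h1, le_antisymm h2 (h3 p hp)⟩

lemma isOpen_shadow : IsOpen (shadow C c₀) := by
  have : shadow C c₀ = ⋃ z : ℝ, (fun v => v + z • c₀) ⁻¹' interior C := by
    ext v; simp [shadow]
  rw [this]
  exact isOpen_iUnion fun z => isOpen_interior.preimage (by fun_prop)

lemma interior_subset_shadow : interior C ⊆ shadow C c₀ := fun v hv => ⟨0, by simpa using hv⟩

lemma shadow_add (hC : IsSolidCone C) {x y : V} (hx : x ∈ shadow C c₀) (hy : y ∈ shadow C c₀) :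
    x + y ∈ shadow C c₀ := by
  obtain ⟨z, hz⟩ := hx
  obtain ⟨z', hz'⟩ := hy
  refine ⟨z + z', ?_⟩
  have := hC.add_mem_interior hz (interior_subset hz')
  convert this using 1
  module

lemma shadow_smul (hC : IsSolidCone C) {x : V} {t : ℝ} (ht : 0 < t) (hx : x ∈ shadow C c₀) :
    t • x ∈ shadow C c₀ := by
  obtain ⟨z, hz⟩ := hx
  refine ⟨t * z, ?_⟩
  have := hC.smul_mem_interior ht hz
  convert this using 1
  module

lemma shadow_add_smul {x : V} (t : ℝ) (hx : x ∈ shadow C c₀) : x + t • c₀ ∈ shadow C c₀ := by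
  obtain ⟨z, hz⟩ := hx
  refine ⟨z - t, ?_⟩
  convert hz using 1
  module

lemma convex_shadow (hC : IsSolidCone C) : Convex ℝ (shadow C c₀) := by
  refine convex_iff_forall_pos.2 fun x hx y hy a b ha hb _ => ?_
  exact hC.shadow_add (hC.shadow_smul ha hx) (hC.shadow_smul hb hy)

lemma height_le_iff (hC : IsSolidCone C) (hc : c₀ ∈ C) (hne : c₀ ≠ 0)
    {v : V} (hv : v ∈ shadow C c₀) {z : ℝ} :
    height C c₀ v ≤ z ↔ v + z • c₀ ∈ C := by
  set Z : Set ℝ := {z : ℝ | v + z • c₀ ∈ C} with hZ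
  have hup : ∀ z ∈ Z, ∀ z', z ≤ z' → z' ∈ Z := by
    intro z hz z' hzz
    have := hC.add_mem _ hz _ (hC.smul_mem (z' - z) (by linarith) _ hc)
    rw [hZ, mem_ofPred_eq]
    convert this using 1
    module
  have hnonempty : Z.Nonempty := by
    obtain ⟨z, hz⟩ := hv
    exact ⟨z, interior_subset (s := C) hz⟩
  have hbdd : BddBelow Z := by
    by_contra hb
    rw [not_bddBelow_iff] at hb
    refine hne (hC.pointed _ hc (hC.mem_of_add_nat_smul_mem (y := v) fun n => ?_))
    obtain ⟨z, hz, hzn⟩ := hb (-n)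
    have := hup z hz (-n) hzn.le
    rw [hZ, mem_ofPred_eq] at this
    rwa [smul_neg, ← neg_smul]
  have hclosed : IsClosed Z := hC.closed.preimage (by fun_prop)
  constructor
  · intro h
    exact hup _ (hclosed.csInf_mem hnonempty hbdd) _ h
  · exact fun h => csInf_le hbdd h

lemma height_lt_iff (hC : IsSolidCone C) (hc : c₀ ∈ C) (hne : c₀ ≠ 0)
    {v : V} (hv : v ∈ shadow C c₀) {z : ℝ} :
    height C c₀ v < z ↔ v + z • c₀ ∈ interior C := by
  constructor
  · intro h
    have h1 := (hC.height_le_iff hc hne hv).1 le_rfl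
    obtain ⟨t, ht⟩ := hv
    have h2 : v + (max t (z + 1)) • c₀ ∈ interior C := by
      have := hC.add_mem_interior ht
        (hC.smul_mem (max t (z + 1) - t) (sub_nonneg.2 (le_max_left _ _)) _ hc)
      convert this using 1
      module
    set T := max t (z + 1)
    have hT : z + 1 ≤ T := le_max_right _ _
    set m := height C c₀ v
    have hTm : 0 < T - m := by linarith
    have h3 := hC.add_mem_interior (hC.smul_mem_interior (t := (z - m) / (T - m))
      (div_pos (by linarith) hTm) h2) (hC.smul_mem ((T - z) / (T - m))
      (div_nonneg (by linarith) hTm.le) _ h1)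
    convert h3 using 1
    have e1 : (z - m) / (T - m) + (T - z) / (T - m) = 1 := by field_simp; ring
    have e2 : (z - m) / (T - m) * T + (T - z) / (T - m) * m = z := by field_simp; ring
    rw [← sub_eq_zero]
    have : v + z • c₀ - (((z - m) / (T - m)) • (v + T • c₀) + ((T - z) / (T - m)) • (v + m • c₀)) =
      (1 - ((z - m) / (T - m) + (T - z) / (T - m))) • v +
        (z - ((z - m) / (T - m) * T + (T - z) / (T - m) * m)) • c₀ := by module
    rw [this, e1, e2, sub_self, sub_self, zero_smul, zero_smul, add_zero]
  · intro h
    obtain ⟨δ, hδ, hb⟩ := mem_interior_iff.1 h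
    have hn := norm_pos_iff.2 hne
    have h1 := hb (-(δ / ‖c₀‖) • c₀) (by
      rw [norm_smul, norm_neg, Real.norm_of_nonneg (by positivity), div_mul_cancel₀ _ hn.ne'])
    have h2 : height C c₀ v ≤ z - δ / ‖c₀‖ := (hC.height_le_iff hc hne hv).2 (by
      convert h1 using 1
      module)
    have : 0 < δ / ‖c₀‖ := by positivity
    linarith

lemma mem_interior_iff_height (hC : IsSolidCone C) (hc : c₀ ∈ C) (hne : c₀ ≠ 0)
    {v : V} : v ∈ interior C ↔ v ∈ shadow C c₀ ∧ height C c₀ v < 0 := by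
  constructor
  · intro h
    have h1 := interior_subset_shadow (c₀ := c₀) h
    exact ⟨h1, (hC.height_lt_iff hc hne h1).2 (by simpa using h)⟩
  · rintro ⟨h1, h2⟩
    simpa using (hC.height_lt_iff hc hne h1).1 h2

lemma height_add_smul (hC : IsSolidCone C) (hc : c₀ ∈ C) (hne : c₀ ≠ 0)
    {v : V} (hv : v ∈ shadow C c₀) (t : ℝ) :
    height C c₀ (v + t • c₀) = height C c₀ v - t := by
  refine eq_of_forall_ge_iff fun z => ?_
  rw [hC.height_le_iff hc hne (shadow_add_smul t hv), sub_le_iff_le_add,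
    hC.height_le_iff hc hne hv]
  rw [show v + t • c₀ + z • c₀ = v + (z + t) • c₀ by module]

lemma height_smul (hC : IsSolidCone C) (hc : c₀ ∈ C) (hne : c₀ ≠ 0)
    {v : V} (hv : v ∈ shadow C c₀) {t : ℝ} (ht : 0 < t) :
    height C c₀ (t • v) = t * height C c₀ v := by
  refine eq_of_forall_ge_iff fun z => ?_
  rw [hC.height_le_iff hc hne (hC.shadow_smul ht hv), ← le_div_iff₀' ht,
    hC.height_le_iff hc hne hv]
  constructor
  · intro h
    have := hC.smul_mem t⁻¹ (by positivity) _ h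
    rwa [smul_add, inv_smul_smul₀ ht.ne', smul_smul, ← div_eq_inv_mul] at this
  · intro h
    have := hC.smul_mem t ht.le _ h
    rwa [smul_add, smul_smul, mul_div_cancel₀ _ ht.ne'] at this

lemma height_add_le (hC : IsSolidCone C) (hc : c₀ ∈ C) (hne : c₀ ≠ 0)
    {x y : V} (hx : x ∈ shadow C c₀) (hy : y ∈ shadow C c₀) :
    height C c₀ (x + y) ≤ height C c₀ x + height C c₀ y := by
  rw [hC.height_le_iff hc hne (hC.shadow_add hx hy)]
  have := hC.add_mem _ ((hC.height_le_iff hc hne hx).1 le_rfl) _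
    ((hC.height_le_iff hc hne hy).1 le_rfl)
  convert this using 1
  module

lemma continuousOn_height (hC : IsSolidCone C) (hc : c₀ ∈ C) (hne : c₀ ≠ 0)
    [FiniteDimensional ℝ V] :
    ContinuousOn (height C c₀) (shadow C c₀) := by
  refine ConvexOn.continuousOn isOpen_shadow ⟨hC.convex_shadow, fun x hx y hy a b ha hb hab => ?_⟩
  rcases ha.eq_or_lt with rfl | ha
  · simp_all
  rcases hb.eq_or_lt with rfl | hb
  · simp_all
  have := hC.height_add_le hc hne (hC.shadow_smul ha hx) (hC.shadow_smul hb hy)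
  rwa [hC.height_smul hc hne hx ha, hC.height_smul hc hne hy hb] at this

end IsSolidCone

/-- A solid cone with a group of linear automorphisms acting cocompactly on its interior and
preserving a ray of the cone. -/
structure IsHomogeneousCone {G V : Type*} [Group G] [NormedAddCommGroup V] [NormedSpace ℝ V]
    (A : G →* (V ≃ₗ[ℝ] V)) (κ : G → ℝ) (C K : Set V) (c₀ : V) : Prop where
  cone : IsSolidCone C
  map_mem : ∀ g, ∀ c ∈ C, A g c ∈ C
  eigen : ∀ g, A g c₀ = κ g • c₀
  compact : IsCompact K
  subset : K ⊆ interior C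
  cocompact : ∀ u ∈ interior C, ∃ g, A g u ∈ K
  mem : c₀ ∈ C
  ne : c₀ ≠ 0

namespace IsHomogeneousCone

variable {G V : Type*} [Group G] [NormedAddCommGroup V] [NormedSpace ℝ V]
  {A : G →* (V ≃ₗ[ℝ] V)} {κ : G → ℝ} {C K : Set V} {c₀ : V}

lemma κ_pos (h : IsHomogeneousCone A κ C K c₀) (g : G) : 0 < κ g := by
  by_contra! hk
  have h1 := h.map_mem g _ h.mem
  have h2 : A g c₀ ≠ 0 := (A g).map_ne_zero_iff.2 h.ne
  refine h2 (h.cone.pointed _ h1 ?_)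
  rw [h.eigen, ← neg_smul]
  exact h.cone.smul_mem _ (by linarith) _ h.mem

lemma A_inv_A (g : G) (v : V) : A g⁻¹ (A g v) = v := by
  have : A g⁻¹ * A g = 1 := by rw [← map_mul, inv_mul_cancel, map_one]
  exact congrArg (fun e : V ≃ₗ[ℝ] V => e v) this

lemma A_A_inv (g : G) (v : V) : A g (A g⁻¹ v) = v := by
  simp

lemma κ_inv (h : IsHomogeneousCone A κ C K c₀) (g : G) : κ g⁻¹ * κ g = 1 := by
  have h1 := A_inv_A (A := A) g c₀
  rw [h.eigen, map_smul, h.eigen, smul_smul] at h1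
  have h2 : (κ g * κ g⁻¹ - 1) • c₀ = 0 := by rw [sub_smul, h1, one_smul, sub_self]
  rcases smul_eq_zero.1 h2 with h3 | h3
  · linarith
  · exact absurd h3 h.ne

lemma map_interior [FiniteDimensional ℝ V] (h : IsHomogeneousCone A κ C K c₀) (g : G) {u : V}
    (hu : u ∈ interior C) : A g u ∈ interior C := by
  have hc := (A g⁻¹ : V →ₗ[ℝ] V).continuous_of_finiteDimensional
  refine interior_maximal (t := A g⁻¹ ⁻¹' interior C) (fun x hx => ?_)
    (isOpen_interior.preimage hc) (by rwa [mem_preimage, A_inv_A])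
  have := h.map_mem g _ (interior_subset hx)
  rwa [A_A_inv] at this

lemma map_shadow [FiniteDimensional ℝ V] (h : IsHomogeneousCone A κ C K c₀) (g : G) {u : V}
    (hu : u ∈ shadow C c₀) : A g u ∈ shadow C c₀ := by
  obtain ⟨z, hz⟩ := hu
  refine ⟨z * κ g, ?_⟩
  have := h.map_interior g hz
  rwa [map_add, map_smul, h.eigen, smul_smul] at this

lemma height_map [FiniteDimensional ℝ V] (h : IsHomogeneousCone A κ C K c₀) (g : G) {u : V}
    (hu : u ∈ shadow C c₀) : height C c₀ (A g u) = κ g * height C c₀ u := by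
  have hle : ∀ g, ∀ u ∈ shadow C c₀, height C c₀ (A g u) ≤ κ g * height C c₀ u := by
    intro g u hu
    rw [h.cone.height_le_iff h.mem h.ne (h.map_shadow g hu)]
    have := h.map_mem g _ ((h.cone.height_le_iff h.mem h.ne hu).1 le_rfl)
    rwa [map_add, map_smul, h.eigen, smul_smul, mul_comm] at this
  refine le_antisymm (hle g u hu) ?_
  have h1 := hle g⁻¹ _ (h.map_shadow g hu)
  rw [A_inv_A] at h1
  have h2 := mul_le_mul_of_nonneg_left h1 (h.κ_pos g).le
  rwa [← mul_assoc, mul_comm (κ g) (κ g⁻¹), h.κ_inv, one_mul] at h2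

/-- The invariant ray is not interior. -/
lemma notMem_interior (h : IsHomogeneousCone A κ C K c₀) (hV : 2 ≤ Module.finrank ℝ V) :
    c₀ ∉ interior C := by
  intro hi
  obtain ⟨z, hz, hzi, hz0⟩ := h.cone.exists_boundary hV
  obtain ⟨δ, hδ, hK⟩ := IsSolidCone.exists_uniform_radius h.compact isOpen_interior h.subset
  obtain ⟨δ', hδ', hc⟩ := IsSolidCone.mem_interior_iff.1 hi
  obtain ⟨B, hB⟩ := h.compact.exists_bound_of_continuousOn (f := id) continuous_id.continuousOn
  have hn := norm_pos_iff.2 h.ne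
  set m := δ / ‖c₀‖ with hm
  have hm0 : 0 < m := by positivity
  have hB0 : 0 ≤ B := by
    obtain ⟨g, hg⟩ := h.cocompact _ hi
    exact (norm_nonneg _).trans (hB _ hg)
  have key : ∀ η > 0, (η * (B / δ' / m)) • c₀ - (z + η • c₀) ∈ C := by
    intro η hη
    have hu : z + η • c₀ ∈ interior C := by
      have := h.cone.add_mem_interior (h.cone.smul_mem_interior hη hi) hz
      rwa [add_comm] at this
    obtain ⟨g, hg⟩ := h.cocompact _ hu
    have hκ := h.κ_pos g
    have hκi := h.κ_pos g⁻¹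
    have h1 := interior_subset (hK _ hg (-m • c₀) (by
      rw [norm_smul, norm_neg, Real.norm_of_nonneg hm0.le, hm, div_mul_cancel₀ _ hn.ne']))
    have h2 := h.map_mem g⁻¹ _ h1
    rw [map_add, A_inv_A, map_smul, h.eigen] at h2
    have hle : m * κ g⁻¹ ≤ η := by
      by_contra! hlt
      refine hzi ?_
      have := h.cone.add_mem_interior (h.cone.smul_mem_interior (sub_pos.2 hlt) hi) h2
      convert this using 1
      module
    have h3 : (B / δ') • c₀ - A g (z + η • c₀) ∈ C := by
      rcases hB0.eq_or_lt with hB0 | hB0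
      · have := hB _ hg
        rw [← hB0, id, norm_le_zero_iff] at this
        rw [← hB0, this, zero_div, zero_smul, sub_zero]
        exact h.cone.zero_mem
      have := h.cone.smul_mem (B / δ') (by positivity) _ (hc (-(δ' / B) • A g (z + η • c₀)) (by
        rw [norm_smul, norm_neg, Real.norm_of_nonneg (by positivity)]
        calc δ' / B * _ ≤ δ' / B * B := by
              refine mul_le_mul_of_nonneg_left (hB _ hg) (by positivity)
          _ = δ' := by field_simp))
      rw [smul_add, smul_smul, show B / δ' * -(δ' / B) = -1 by field_simp, neg_one_smul,
        ← sub_eq_add_neg] at this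
      exact this
    have h4 := h.map_mem g⁻¹ _ h3
    rw [map_sub, A_inv_A, map_smul, h.eigen] at h4
    have h5 := h.cone.add_mem _ h4 _ (h.cone.smul_mem
      (η * (B / δ' / m) - B / δ' * κ g⁻¹) (by
        rw [sub_nonneg]
        calc B / δ' * κ g⁻¹ = B / δ' / m * (m * κ g⁻¹) := by field_simp
          _ ≤ B / δ' / m * η := by gcongr
          _ = _ := mul_comm _ _) _ h.mem)
    convert h5 using 1
    module
  have h1 : Tendsto (fun η : ℝ => (η * (B / δ' / m)) • c₀ - (z + η • c₀)) (𝓝[>] 0)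
      (𝓝 (((0 : ℝ) * (B / δ' / m)) • c₀ - (z + (0 : ℝ) • c₀))) :=
    (Continuous.tendsto (by fun_prop) 0).mono_left nhdsWithin_le_nhds
  have h2 : -z ∈ C := by
    have := h.cone.closed.mem_of_tendsto h1 (by
      filter_upwards [self_mem_nhdsWithin] with η hη
      exact key η hη)
    simpa using this
  exact hz0 (h.cone.pointed _ hz h2)

end IsHomogeneousCone

/-- A functional that is nonnegative on an open set and not zero is positive there. -/
lemma pos_of_nonneg_of_isOpen {V : Type*} [NormedAddCommGroup V] [NormedSpace ℝ V] {S : Set V}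
    (ho : IsOpen S) {f : V →L[ℝ] ℝ} (hf : ∀ x ∈ S, 0 ≤ f x) {e : V} (he : f e ≠ 0) {x : V}
    (hx : x ∈ S) : 0 < f x := by
  refine lt_of_le_of_ne (hf x hx) fun h => he ?_
  have h1 : Tendsto (fun t : ℝ => x + t • e) (𝓝 0) (𝓝 (x + (0 : ℝ) • e)) :=
    Continuous.tendsto (by fun_prop) 0
  rw [zero_smul, add_zero] at h1
  obtain ⟨ε, hε, hb⟩ := Metric.eventually_nhds_iff.1 (h1.eventually (ho.mem_nhds hx))
  have key : ∀ t : ℝ, |t| < ε → 0 ≤ t * f e := fun t ht => by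
    have := hf _ (hb (y := t) (by simpa using ht))
    rwa [map_add, ← h, zero_add, map_smul, smul_eq_mul] at this
  have h2 := key (ε / 2) (by rw [abs_of_pos (half_pos hε)]; linarith)
  have h3 := key (-(ε / 2)) (by rw [abs_neg, abs_of_pos (half_pos hε)]; linarith)
  have h4 : ε / 2 * f e = 0 := by linarith
  simpa [hε.ne'] using h4

namespace IsHomogeneousCone

variable {G V : Type*} [Group G] [NormedAddCommGroup V] [NormedSpace ℝ V] [FiniteDimensional ℝ V]
  {A : G →* (V ≃ₗ[ℝ] V)} {κ : G → ℝ} {C K : Set V} {c₀ : V}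

lemma nonneg_on_shadow {ℓ : V →L[ℝ] ℝ} (hℓ : ∀ x ∈ C, 0 ≤ ℓ x) (h0 : ℓ c₀ = 0) {x : V}
    (hx : x ∈ shadow C c₀) : 0 ≤ ℓ x := by
  obtain ⟨z, hz⟩ := hx
  have := hℓ _ (interior_subset hz)
  rwa [map_add, map_smul, h0, smul_zero, add_zero] at this

/-- If two independent functionals bound the shadow, the height is additive. -/
lemma height_add (h : IsHomogeneousCone A κ C K c₀) {ℓa ℓb : V →L[ℝ] ℝ} {e₁ e₂ : V}
    (ha : ∀ x ∈ C, 0 ≤ ℓa x) (hb : ∀ x ∈ C, 0 ≤ ℓb x) (ha0 : ℓa c₀ = 0) (hb0 : ℓb c₀ = 0)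
    (hdec : ∀ u, ∃ t : ℝ, u = t • c₀ + ℓa u • e₁ + ℓb u • e₂)
    {x y : V} (hx : x ∈ shadow C c₀) (hy : y ∈ shadow C c₀) :
    height C c₀ (x + y) = height C c₀ x + height C c₀ y := by
  have hC := h.cone
  refine le_antisymm (hC.height_add_le h.mem h.ne hx hy) ?_
  by_contra! hlt
  set S := shadow C c₀ with hS
  set F := height C c₀ with hF
  have hFc : ContinuousOn F S := hC.continuousOn_height h.mem h.ne
  have hKS : K ⊆ S := h.subset.trans IsSolidCone.interior_subset_shadow
  set v : V := (1 / 2 : ℝ) • (x + y) with hv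
  set w : V := (1 / 2 : ℝ) • (x - y) with hw
  have hvw : v + w = x := by rw [hv, hw]; module
  have hvw' : v - w = y := by rw [hv, hw]; module
  have hvS : v ∈ S := hC.shadow_smul (by norm_num) (hC.shadow_add hx hy)
  have hFv : 2 * F v = F (x + y) := by
    rw [hv, hF, hC.height_smul h.mem h.ne (hC.shadow_add hx hy) (by norm_num)]; ring
  set D : V → V → ℝ := fun v w => F (v + w) + F (v - w) - 2 * F v with hD
  have hD0 : 0 < D v w := by
    simp only [hD, hvw, hvw', hFv]; linarith
  obtain ⟨θ, hθ, hθ1, hθ2⟩ : ∃ θ : ℝ, 1 < θ ∧ v + θ • w ∈ S ∧ v - θ • w ∈ S := by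
    have h1 : Tendsto (fun t : ℝ => v + t • w) (𝓝[>] 1) (𝓝 (v + (1 : ℝ) • w)) :=
      (Continuous.tendsto (by fun_prop) 1).mono_left nhdsWithin_le_nhds
    have h2 : Tendsto (fun t : ℝ => v - t • w) (𝓝[>] 1) (𝓝 (v - (1 : ℝ) • w)) :=
      (Continuous.tendsto (by fun_prop) 1).mono_left nhdsWithin_le_nhds
    rw [one_smul, hvw] at h1
    rw [one_smul, hvw'] at h2
    obtain ⟨θ, hθ⟩ := ((h1.eventually (IsSolidCone.isOpen_shadow.mem_nhds hx)).and
      ((h2.eventually (IsSolidCone.isOpen_shadow.mem_nhds hy)).and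
        self_mem_nhdsWithin)).exists
    exact ⟨θ, hθ.2.2, hθ.1, hθ.2.1⟩
  have hθ0 : 0 < θ := by linarith
  obtain ⟨Ba, hBa⟩ := h.compact.exists_bound_of_continuousOn ℓa.continuous.continuousOn
  obtain ⟨Bb, hBb⟩ := h.compact.exists_bound_of_continuousOn ℓb.continuous.continuousOn
  set R := Ba * ‖e₁‖ + Bb * ‖e₂‖ with hR
  set Q : Set (V × V) := (K ×ˢ Metric.closedBall 0 R) ∩
    {q | q.1 + q.2 ∈ closure S ∧ q.1 - q.2 ∈ closure S} with hQ
  have hQc : IsCompact Q := by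
    refine (h.compact.prod (isCompact_closedBall _ _)).inter_right ?_
    exact (isClosed_closure.preimage (continuous_fst.add continuous_snd)).inter
      (isClosed_closure.preimage (continuous_fst.sub continuous_snd))
  have hcombo : ∀ k ∈ S, ∀ z, k + z ∈ closure S → k + θ⁻¹ • z ∈ S := by
    intro k hk z hz
    have hθi : θ⁻¹ < 1 := inv_lt_one_of_one_lt₀ hθ
    have := hC.convex_shadow.combo_interior_closure_mem_interior
      (by rwa [IsSolidCone.isOpen_shadow.interior_eq]) hz (a := 1 - θ⁻¹) (b := θ⁻¹)
      (by linarith) (by positivity) (by ring) (x := k)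
    convert interior_subset this using 1
    module
  have hGc : ContinuousOn (fun q : V × V => D q.1 (θ⁻¹ • q.2)) Q := by
    refine ((hFc.comp (by fun_prop) ?_).add (hFc.comp (by fun_prop) ?_)).sub
      ((hFc.comp (by fun_prop) ?_).const_smul (2 : ℝ))
    · exact fun q hq => hcombo _ (hKS hq.1.1) _ hq.2.1
    · intro q hq
      have h1 := hq.2.2
      rw [sub_eq_add_neg] at h1
      have := hcombo _ (hKS hq.1.1) _ h1
      rw [smul_neg, ← sub_eq_add_neg] at this
      exact this
    · exact fun q hq => hKS hq.1.1
  obtain ⟨M, hM⟩ := hQc.exists_bound_of_continuousOn hGc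
  obtain ⟨u₀, hu₀⟩ := hC.interior_nonempty
  obtain ⟨g₀, hg₀⟩ := h.cocompact u₀ hu₀
  obtain ⟨k₀, hk₀, hmax⟩ := h.compact.exists_isMaxOn ⟨_, hg₀⟩ (hFc.mono hKS)
  set m := -F k₀ with hm
  have hm0 : 0 < m := by
    rw [hm, neg_pos]
    exact ((hC.mem_interior_iff_height h.mem h.ne).1 (h.subset hk₀)).2
  have hkey : ∀ ε > 0, m * D v w ≤ ε * M := by
    intro ε hε
    set v' := v + (F v + ε) • c₀ with hv'
    have hv'S : v' ∈ S := IsSolidCone.shadow_add_smul _ hvS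
    have hFv' : F v' = -ε := by
      rw [hv', hF, hC.height_add_smul h.mem h.ne hvS]; ring
    have hv'C : v' ∈ interior C :=
      (hC.mem_interior_iff_height h.mem h.ne).2 ⟨hv'S, by rw [← hF, hFv']; linarith⟩
    obtain ⟨g, hg⟩ := h.cocompact v' hv'C
    have hκ := h.κ_pos g
    have hmκ : m ≤ κ g * ε := by
      have h1 := hmax hg
      rw [mem_ofPred_eq, hF, h.height_map g hv'S, ← hF, hFv'] at h1
      linarith
    obtain ⟨t, ht⟩ := hdec (A g (θ • w))
    set z := ℓa (A g (θ • w)) • e₁ + ℓb (A g (θ • w)) • e₂ with hz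
    have hAz : A g (θ • w) = z + t • c₀ := by rw [hz]; nth_rw 1 [ht]; abel
    have hp : A g v' + A g (θ • w) ∈ S := by
      have := h.map_shadow g (IsSolidCone.shadow_add_smul (F v + ε) hθ1)
      rw [← map_add]
      convert this using 2
      rw [hv']; abel
    have hn : A g v' - A g (θ • w) ∈ S := by
      have := h.map_shadow g (IsSolidCone.shadow_add_smul (F v + ε) hθ2)
      rw [← map_sub]
      convert this using 2
      rw [hv']; abel
    have hbound : ∀ ℓ : V →L[ℝ] ℝ, (∀ x ∈ C, 0 ≤ ℓ x) → ℓ c₀ = 0 → ∀ B, ‖ℓ (A g v')‖ ≤ B →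
        ‖ℓ (A g (θ • w))‖ ≤ B := by
      intro ℓ hℓ h0 B hB
      have h1 := nonneg_on_shadow hℓ h0 hp
      have h2 := nonneg_on_shadow hℓ h0 hn
      rw [map_add] at h1
      rw [map_sub] at h2
      have h3 := (abs_le.1 hB).2
      exact abs_le.2 ⟨by linarith, by linarith⟩
    have hzQ : (A g v', z) ∈ Q := by
      refine ⟨⟨hg, ?_⟩, subset_closure ?_, subset_closure ?_⟩
      · rw [mem_closedBall_zero_iff]
        refine (norm_add_le _ _).trans ?_
        rw [norm_smul, norm_smul, hR]
        exact add_le_add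
          (mul_le_mul_of_nonneg_right (hbound _ ha ha0 _ (hBa _ hg)) (norm_nonneg _))
          (mul_le_mul_of_nonneg_right (hbound _ hb hb0 _ (hBb _ hg)) (norm_nonneg _))
      · have := IsSolidCone.shadow_add_smul (-t) hp
        convert this using 1
        simp only [hAz]; module
      · have := IsSolidCone.shadow_add_smul t hn
        convert this using 1
        simp only [hAz]; module
    have hDle : κ g * D v w ≤ M := by
      have h1 := (abs_le.1 (hM _ hzQ)).2
      refine le_trans (le_of_eq ?_) h1
      have e1 : A g v' + θ⁻¹ • z = A g x + (κ g * (F v + ε) - θ⁻¹ * t) • c₀ := by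
        have : z = A g (θ • w) - t • c₀ := by rw [hAz]; abel
        rw [this, ← hvw, hv', map_smul, smul_sub, inv_smul_smul₀ hθ0.ne']
        simp only [map_add, map_smul, h.eigen]
        module
      have e2 : A g v' - θ⁻¹ • z = A g y + (κ g * (F v + ε) + θ⁻¹ * t) • c₀ := by
        have : z = A g (θ • w) - t • c₀ := by rw [hAz]; abel
        rw [this, ← hvw', hv', map_smul, smul_sub, inv_smul_smul₀ hθ0.ne']
        simp only [map_add, map_sub, map_smul, h.eigen]
        module
      simp only [hD, hvw, hvw']
      rw [e1, e2, hF, hC.height_add_smul h.mem h.ne (h.map_shadow g hx),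
        hC.height_add_smul h.mem h.ne (h.map_shadow g hy), h.height_map g hx, h.height_map g hy,
        h.height_map g hv'S, ← hF, hFv']
      ring
    calc m * D v w ≤ κ g * ε * D v w := by gcongr
      _ = ε * (κ g * D v w) := by ring
      _ ≤ ε * M := by gcongr
  have hmD : 0 < m * D v w := mul_pos hm0 hD0
  have hM0 : 0 < M := by
    have := hkey 1 one_pos
    linarith
  have := hkey (m * D v w / (2 * M)) (by positivity)
  rw [show m * D v w / (2 * M) * M = m * D v w / 2 by field_simp] at this
  linarith

/-- The shadow of a cone bounded by two independent functionals is an open sector. -/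
lemma exists_sector (hC : IsSolidCone C) {ℓa ℓb : V →L[ℝ] ℝ} {e₁ e₂ : V}
    (hb : ∀ x ∈ C, 0 ≤ ℓb x) (ha0 : ℓa c₀ = 0) (hb0 : ℓb c₀ = 0)
    (hdec : ∀ u, ∃ t : ℝ, u = t • c₀ + ℓa u • e₁ + ℓb u • e₂) (hpos : ∀ x ∈ interior C, 0 < ℓa x)
    (he : ℓa e₂ = 0) (he' : ℓb e₂ = 1) :
    ∃ ℓ₁ ℓ₂ : V →L[ℝ] ℝ, ℓ₁ c₀ = 0 ∧ ℓ₂ c₀ = 0 ∧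
      ∀ v, v ∈ shadow C c₀ ↔ 0 < ℓ₁ v ∧ 0 < ℓ₂ v := by
  set σ := ℓa + ℓb with hσ
  have hσe : σ e₂ = 1 := by simp [hσ, he, he']
  have hσpos : ∀ x ∈ interior C, 0 < σ x := fun x hx =>
    add_pos_of_pos_of_nonneg (hpos x hx) (hb x (interior_subset hx))
  set ρ : Set ℝ := (fun x => ℓa x / σ x) '' interior C with hρ
  have hρne : ρ.Nonempty := hC.interior_nonempty.image _
  have hρb : BddBelow ρ := ⟨0, by
    rintro _ ⟨x, hx, rfl⟩
    exact (div_pos (hpos x hx) (hσpos x hx)).le⟩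
  have hρa : BddAbove ρ := ⟨1, by
    rintro _ ⟨x, hx, rfl⟩
    refine (div_le_one (hσpos x hx)).2 ?_
    simpa [hσ] using hb x (interior_subset hx)⟩
  obtain ⟨x₀, hx₀⟩ := hC.interior_nonempty
  set t₁ := sInf ρ with ht₁
  set t₂ := sSup ρ with ht₂
  have h12 : t₁ ≤ t₂ := csInf_le_csSup hρne hρb hρa
  have h1 : ∀ x ∈ interior C, 0 ≤ (ℓa - t₁ • σ) x := fun x hx => by
    have := csInf_le hρb ⟨x, hx, rfl⟩
    rw [← ht₁, le_div_iff₀ (hσpos x hx)] at this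
    simpa using this
  have h2 : ∀ x ∈ interior C, 0 ≤ (t₂ • σ - ℓa) x := fun x hx => by
    have := le_csSup hρa ⟨x, hx, rfl⟩
    rw [← ht₂, div_le_iff₀ (hσpos x hx)] at this
    simpa using this
  have h1' : ∀ x ∈ interior C, 0 < (ℓa - t₁ • σ) x := fun x hx => by
    by_cases ht : t₁ = 0
    · simpa [ht] using hpos x hx
    · refine pos_of_nonneg_of_isOpen isOpen_interior h1 (e := e₂) ?_ hx
      simpa [he, hσe] using ht
  have h2' : ∀ x ∈ interior C, 0 < (t₂ • σ - ℓa) x := fun x hx => by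
    have ht : t₂ ≠ 0 := fun ht => by
      have := h2 x hx
      rw [ht, zero_smul, zero_sub, _root_.neg_apply] at this
      linarith [hpos x hx]
    refine pos_of_nonneg_of_isOpen isOpen_interior h2 (e := e₂) ?_ hx
    simpa [he, hσe] using ht
  refine ⟨ℓa - t₁ • σ, t₂ • σ - ℓa, by simp [hσ, ha0, hb0], by simp [hσ, ha0, hb0],
    fun v => ⟨?_, ?_⟩⟩
  · rintro ⟨z, hz⟩
    have e1 := h1' _ hz
    have e2 := h2' _ hz
    have hσ0 : σ c₀ = 0 := by simp [hσ, ha0, hb0]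
    constructor
    · simpa [ha0, hσ0] using e1
    · simpa [ha0, hσ0] using e2
  · rintro ⟨e1, e2⟩
    have e1' : t₁ * σ v < ℓa v := by simpa using e1
    have e2' : ℓa v < t₂ * σ v := by simpa using e2
    have hσv : 0 < σ v := by
      by_contra! hneg
      nlinarith
    obtain ⟨_, ⟨x, hx, rfl⟩, hxv⟩ := exists_lt_of_csInf_lt hρne
      (show sInf ρ < ℓa v / σ v from (lt_div_iff₀ hσv).2 e1')
    obtain ⟨_, ⟨y, hy, rfl⟩, hyv⟩ := exists_lt_of_lt_csSup hρne
      (show ℓa v / σ v < sSup ρ from (div_lt_iff₀ hσv).2 e2')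
    set r := ℓa v / σ v with hr
    set p := ℓa x / σ x with hp
    set q := ℓa y / σ y with hq
    simp only at hxv hyv
    set u : V := ((q - r) / (q - p) * σ v / σ x) • x + ((r - p) / (q - p) * σ v / σ y) • y with hu
    have hσx := hσpos x hx
    have hσy := hσpos y hy
    have hqp : 0 < q - p := by linarith
    have hqr : 0 < q - r := by linarith
    have hrp : 0 < r - p := by linarith
    have huC : u ∈ interior C :=
      hC.add_mem_interior (hC.smul_mem_interior (by positivity) hx)
        (interior_subset (hC.smul_mem_interior (by positivity) hy))
    have hσu : σ u = σ v := by
      rw [hu, map_add, map_smul, map_smul, smul_eq_mul, smul_eq_mul]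
      field_simp
      ring
    have hau : ℓa u = ℓa v := by
      have ex : ℓa x = p * σ x := by rw [hp]; field_simp
      have ey : ℓa y = q * σ y := by rw [hq]; field_simp
      have ev : ℓa v = r * σ v := by rw [hr]; field_simp
      rw [hu, map_add, map_smul, map_smul, smul_eq_mul, smul_eq_mul, ex, ey, ev]
      field_simp
      ring
    have hbu : ℓb u = ℓb v := by
      have : ℓa u + ℓb u = ℓa v + ℓb v := hσu
      linarith
    obtain ⟨t, ht⟩ := hdec u
    obtain ⟨t', ht'⟩ := hdec v
    refine ⟨t - t', ?_⟩
    have : v + (t - t') • c₀ = u := by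
      rw [hau, hbu] at ht
      rw [ht]
      nth_rw 1 [ht']
      module
    rwa [this]

/-- A cone bounded by two independent functionals is simplicial. -/
theorem exists_simplicial (h : IsHomogeneousCone A κ C K c₀) {ℓa ℓb : V →L[ℝ] ℝ} {e₁ e₂ : V}
    (ha : ∀ x ∈ C, 0 ≤ ℓa x) (hb : ∀ x ∈ C, 0 ≤ ℓb x) (ha0 : ℓa c₀ = 0) (hb0 : ℓb c₀ = 0)
    (hdec : ∀ u, ∃ t : ℝ, u = t • c₀ + ℓa u • e₁ + ℓb u • e₂) (hpos : ∀ x ∈ interior C, 0 < ℓa x)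
    (he : ℓa e₂ = 0) (he' : ℓb e₂ = 1) :
    ∃ ℓ₁ ℓ₂ ℓ₃ : V →L[ℝ] ℝ, ℓ₁ c₀ = 0 ∧ ℓ₂ c₀ = 0 ∧ ℓ₃ c₀ = 1 ∧
      ∀ v, v ∈ interior C ↔ 0 < ℓ₁ v ∧ 0 < ℓ₂ v ∧ 0 < ℓ₃ v := by
  have hC := h.cone
  obtain ⟨ℓ₁, ℓ₂, h1, h2, hsh⟩ := exists_sector hC hb ha0 hb0 hdec hpos he he'
  obtain ⟨v₀, hv₀⟩ := hC.interior_nonempty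
  have hv₀S : v₀ ∈ shadow C c₀ := IsSolidCone.interior_subset_shadow hv₀
  set F := height C c₀ with hF
  have hpC : v₀ + F v₀ • c₀ ∈ C := (hC.height_le_iff h.mem h.ne hv₀S).1 le_rfl
  have hpi : v₀ + F v₀ • c₀ ∉ interior C := fun hi =>
    lt_irrefl _ ((hC.height_lt_iff h.mem h.ne hv₀S).2 hi)
  obtain ⟨ℓ, hℓ, hℓi, hℓp⟩ := hC.exists_support hpC hpi
  have hℓc : 0 < ℓ c₀ := by
    have := hℓi _ ((hC.height_lt_iff h.mem h.ne hv₀S).1 (lt_add_one (F v₀)))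
    rw [add_smul, one_smul, ← add_assoc, map_add, hℓp, zero_add] at this
    exact this
  have hE : ∀ x ∈ shadow C c₀, 0 ≤ ℓ x + F x * ℓ c₀ := by
    intro x hx
    have := hℓ _ ((hC.height_le_iff h.mem h.ne hx).1 le_rfl)
    rwa [map_add, map_smul, smul_eq_mul] at this
  have hE0 : ℓ v₀ + F v₀ * ℓ c₀ = 0 := by
    rwa [map_add, map_smul, smul_eq_mul] at hℓp
  have hEx : ∀ x ∈ shadow C c₀, ℓ x + F x * ℓ c₀ = 0 := by
    intro x hx
    have h3 : Tendsto (fun t : ℝ => v₀ - t • x) (𝓝[>] 0) (𝓝 (v₀ - (0 : ℝ) • x)) :=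
      (Continuous.tendsto (by fun_prop) 0).mono_left nhdsWithin_le_nhds
    rw [zero_smul, sub_zero] at h3
    obtain ⟨t, ht, ht0⟩ := ((h3.eventually (IsSolidCone.isOpen_shadow.mem_nhds hv₀S)).and
      self_mem_nhdsWithin).exists
    have ht0 : 0 < t := ht0
    have htx := hC.shadow_smul ht0 hx
    have h4 := h.height_add ha hb ha0 hb0 hdec htx ht
    rw [add_sub_cancel, hC.height_smul h.mem h.ne hx ht0, ← hF] at h4
    have h5 := hE _ ht
    rw [map_sub, map_smul, smul_eq_mul] at h5
    have h6 := hE _ hx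
    have h7 : t * (ℓ x + F x * ℓ c₀) ≤ 0 := by
      rw [h4] at hE0
      nlinarith
    have h8 : ℓ x + F x * ℓ c₀ ≤ 0 := by
      by_contra! hp
      exact absurd h7 (not_le.2 (mul_pos ht0 hp))
    exact le_antisymm h8 h6
  refine ⟨ℓ₁, ℓ₂, (ℓ c₀)⁻¹ • ℓ, h1, h2, ?_, fun v => ?_⟩
  · simp [hℓc.ne']
  · rw [hC.mem_interior_iff_height h.mem h.ne, hsh, and_assoc]
    refine and_congr_right fun hv1 => and_congr_right fun hv2 => ?_
    have h3 := hEx v ((hsh v).2 ⟨hv1, hv2⟩)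
    have h4 : F v = -((ℓ c₀)⁻¹ * ℓ v) := by
      field_simp
      linarith
    rw [← hF, h4, neg_lt_zero]
    rfl

end IsHomogeneousCone

/-- Coordinates on a three-dimensional space adapted to a functional and a vector in its
kernel. -/
lemma exists_coordinates {V : Type*} [NormedAddCommGroup V] [NormedSpace ℝ V]
    [FiniteDimensional ℝ V] (hV : Module.finrank ℝ V = 3) {c₀ : V} (hc : c₀ ≠ 0)
    {ℓ : V →L[ℝ] ℝ} (hℓ : ℓ c₀ = 0) {x₀ : V} (hx₀ : ℓ x₀ ≠ 0) :
    ∃ (e₁ e₂ : V) (ε₀ ε₂ : V →L[ℝ] ℝ), ℓ e₁ = 1 ∧ ℓ e₂ = 0 ∧ ε₀ c₀ = 1 ∧ ε₀ e₁ = 0 ∧ ε₀ e₂ = 0 ∧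
      ε₂ c₀ = 0 ∧ ε₂ e₁ = 0 ∧ ε₂ e₂ = 1 ∧ ∀ v, v = ε₀ v • c₀ + ℓ v • e₁ + ε₂ v • e₂ := by
  have he₁ : ℓ ((ℓ x₀)⁻¹ • x₀) = 1 := by rw [map_smul, smul_eq_mul, inv_mul_cancel₀ hx₀]
  set e₁ := (ℓ x₀)⁻¹ • x₀
  obtain ⟨e₂, he₂, he₂'⟩ : ∃ e₂, ℓ e₂ = 0 ∧ e₂ ∉ Submodule.span ℝ {c₀} := by
    by_contra! hcon
    have h1 : LinearMap.ker (ℓ : V →ₗ[ℝ] ℝ) ≤ Submodule.span ℝ {c₀} := fun v hv => hcon v hv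
    have h2 := Submodule.finrank_mono h1
    rw [finrank_span_singleton hc] at h2
    have h3 := LinearMap.finrank_range_add_finrank_ker (ℓ : V →ₗ[ℝ] ℝ)
    have h4 := Submodule.finrank_le (LinearMap.range (ℓ : V →ₗ[ℝ] ℝ))
    rw [Module.finrank_self] at h4
    omega
  have hli : LinearIndependent ℝ ![c₀, e₁, e₂] := by
    rw [Fintype.linearIndependent_iff]
    intro g hg
    simp only [Fin.sum_univ_three, Matrix.cons_val_zero, Matrix.cons_val_one,
      Matrix.cons_val] at hg
    have h1 : g 1 = 0 := by
      have := congrArg ℓ hg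
      simpa [hℓ, he₁, he₂] using this
    have h2 : g 2 = 0 := by
      by_contra h2
      refine he₂' (Submodule.mem_span_singleton.2 ⟨-(g 0 / g 2), ?_⟩)
      rw [h1, zero_smul, add_zero] at hg
      have : e₂ = (g 2)⁻¹ • (g 2 • e₂) := by rw [inv_smul_smul₀ h2]
      rw [this, eq_neg_of_add_eq_zero_right hg, smul_neg, smul_smul, neg_smul, div_eq_inv_mul]
    have h0 : g 0 = 0 := by
      rw [h1, h2, zero_smul, zero_smul, add_zero, add_zero] at hg
      exact (smul_eq_zero.1 hg).resolve_right hc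
    intro i
    fin_cases i <;> assumption
  set b := basisOfLinearIndependentOfCardEqFinrank hli (by simp [hV]) with hb
  have b0 : b 0 = c₀ := by simp [hb]
  have b1 : b 1 = e₁ := by simp [hb]
  have b2 : b 2 = e₂ := by simp [hb]
  have hdec : ∀ v, v = b.coord 0 v • c₀ + b.coord 1 v • e₁ + b.coord 2 v • e₂ := by
    intro v
    have := b.sum_repr v
    rw [Fin.sum_univ_three, b0, b1, b2] at this
    exact this.symm
  have hℓb : ∀ v, ℓ v = b.coord 1 v := by
    intro v
    conv_lhs => rw [hdec v]
    simp [hℓ, he₁, he₂]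
  refine ⟨e₁, e₂, LinearMap.toContinuousLinearMap (b.coord 0),
    LinearMap.toContinuousLinearMap (b.coord 2), he₁, he₂, ?_, ?_, ?_, ?_, ?_, ?_, fun v => ?_⟩
  · simp [← b0]
  · simp [← b1]
  · simp [← b2]
  · simp [← b0]
  · simp [← b1]
  · simp [← b2]
  · rw [hℓb]
    exact hdec v

/-- Multiplication of real numbers by the values of a nonvanishing character. -/
def scalarAction {G : Type*} [Group G] (φ : G → ℝ) (h0 : ∀ g, φ g ≠ 0)
    (hmul : ∀ g h, φ (g * h) = φ g * φ h) : G →* (ℝ ≃ₗ[ℝ] ℝ) :=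
  MonoidHom.mk' (fun g => LinearEquiv.smulOfNeZero ℝ ℝ (φ g) (h0 g)) fun g h => by
    ext x
    change φ (g * h) • x = φ g • φ h • x
    rw [hmul, mul_smul]

lemma isSolidCone_Ici : IsSolidCone (Ici (0 : ℝ)) where
  closed := isClosed_Ici
  add_mem x hx y hy := add_nonneg (mem_Ici.1 hx) (mem_Ici.1 hy)
  smul_mem t ht x hx := mul_nonneg ht (mem_Ici.1 hx)
  pointed x hx hx' := le_antisymm (by simpa using hx') hx
  interior_nonempty := by
    rw [interior_Ici]
    exact nonempty_Ioi

namespace IsHomogeneousCone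

variable {G V : Type*} [Group G] [NormedAddCommGroup V] [NormedSpace ℝ V] [FiniteDimensional ℝ V]
  {A : G →* (V ≃ₗ[ℝ] V)} {κ : G → ℝ} {C K : Set V} {c₀ : V}

lemma κ_mul (h : IsHomogeneousCone A κ C K c₀) (g g' : G) : κ (g * g') = κ g * κ g' := by
  have h1 := h.eigen (g * g')
  rw [map_mul, LinearEquiv.mul_apply, h.eigen, map_smul, h.eigen, smul_smul] at h1
  rw [mul_comm]
  exact (smul_left_injective ℝ h.ne h1).symm

/-- If the supporting functionals at `c₀` are proportional, the shadow is a half-space. -/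
lemma mem_shadow_iff (h : IsHomogeneousCone A κ C K c₀) {ℓ : V →L[ℝ] ℝ} {e₁ e₂ : V}
    {ε₀ ε₂ : V →L[ℝ] ℝ} (hpos : ∀ x ∈ interior C, 0 < ℓ x) (hℓ : ℓ c₀ = 0)
    (hdec : ∀ v, v = ε₀ v • c₀ + ℓ v • e₁ + ε₂ v • e₂)
    (hΦ : ∀ ℓ' : V →L[ℝ] ℝ, (∀ x ∈ C, 0 ≤ ℓ' x) → ℓ' c₀ = 0 → ℓ' e₂ = 0) (v : V) :
    v ∈ shadow C c₀ ↔ 0 < ℓ v := by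
  have hC := h.cone
  constructor
  · rintro ⟨z, hz⟩
    simpa [hℓ] using hpos _ hz
  · intro hv
    by_contra hvS
    obtain ⟨u, hu⟩ := hC.interior_nonempty
    have huS : u ∈ shadow C c₀ := IsSolidCone.interior_subset_shadow hu
    obtain ⟨f, hf, hfv⟩ := IsSolidCone.exists_support_of_notMem IsSolidCone.isOpen_shadow
      hC.convex_shadow ⟨u, huS⟩ (fun t ht x hx => hC.shadow_smul ht hx) hvS
    have hf0 : f c₀ = 0 := by
      by_contra hne
      have := hf _ (IsSolidCone.shadow_add_smul (-(f u / f c₀)) huS)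
      rw [map_add, map_smul, smul_eq_mul, neg_mul, div_mul_cancel₀ _ hne, add_neg_cancel] at this
      exact lt_irrefl _ this
    have hfC : ∀ x ∈ C, 0 ≤ f x := by
      intro x hx
      have h4 : closure (interior C) ⊆ {x | 0 ≤ f x} :=
        closure_minimal (fun x hx => (hf x (IsSolidCone.interior_subset_shadow hx)).le)
          (isClosed_le continuous_const f.continuous)
      exact h4 (hC.subset_closure_interior hx)
    have hmul : ∀ x, f x = ℓ x * f e₁ := by
      intro x
      conv_lhs => rw [hdec x]
      simp [hf0, hΦ f hfC hf0]
    have h1 := hf u huS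
    rw [hmul] at h1 hfv
    have h2 := (mul_pos_iff_of_pos_left (hpos u hu)).1 h1
    exact absurd hfv (not_le.2 (mul_pos hv h2))

/-- If the supporting functionals at `c₀` are proportional, the cone is quadratic. -/
theorem exists_quadric (h : IsHomogeneousCone A κ C K c₀) {ℓ : V →L[ℝ] ℝ} {e₁ e₂ : V}
    {ε₀ ε₂ : V →L[ℝ] ℝ} (hnn : ∀ x ∈ C, 0 ≤ ℓ x) (hpos : ∀ x ∈ interior C, 0 < ℓ x)
    (hℓ : ℓ c₀ = 0) (hℓ₁ : ℓ e₁ = 1) (hℓ₂ : ℓ e₂ = 0) (hε₀ : ε₀ c₀ = 1) (hε₂ : ε₂ c₀ = 0)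
    (hε₂₁ : ε₂ e₁ = 0) (hε₂₂ : ε₂ e₂ = 1) (hdec : ∀ v, v = ε₀ v • c₀ + ℓ v • e₁ + ε₂ v • e₂)
    (hΦ : ∀ ℓ' : V →L[ℝ] ℝ, (∀ x ∈ C, 0 ≤ ℓ' x) → ℓ' c₀ = 0 → ℓ' e₂ = 0) :
    ∃ ℓ₁ ℓ₂ ℓ₃ : V →L[ℝ] ℝ, ℓ₁ c₀ = 0 ∧ ℓ₂ c₀ = 0 ∧ ℓ₃ c₀ = 1 ∧
      ∀ v, v ∈ interior C ↔ 0 < ℓ₁ v ∧ ℓ₂ v ^ 2 < ℓ₃ v * ℓ₁ v := by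
  have hC := h.cone
  have hsh := h.mem_shadow_iff hpos hℓ hdec hΦ
  set F := height C c₀ with hF
  have hFc : ContinuousOn F (shadow C c₀) := hC.continuousOn_height h.mem h.ne
  set χ : G → ℝ := fun g => ℓ (A g e₁) with hχ
  have hχe : ∀ g v, ℓ (A g v) = χ g * ℓ v := by
    intro g v
    have h1 : ℓ (A g c₀) = 0 := by rw [h.eigen, map_smul, hℓ, smul_zero]
    have h2 : ℓ (A g e₂) = 0 :=
      hΦ (ℓ.comp (LinearMap.toContinuousLinearMap (A g : V →ₗ[ℝ] V)))
        (fun x hx => hnn _ (h.map_mem g x hx)) h1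
    conv_lhs => rw [hdec v]
    simp only [map_add, map_smul, h1, h2, smul_eq_mul, hχ]
    ring
  obtain ⟨u₀, hu₀⟩ := hC.interior_nonempty
  have hχ0 : ∀ g, 0 < χ g := by
    intro g
    have := hpos _ (h.map_interior g hu₀)
    rw [hχe] at this
    exact (mul_pos_iff_of_pos_right (hpos _ hu₀)).1 this
  have hχmul : ∀ g g', χ (g * g') = χ g * χ g' := by
    intro g g'
    change ℓ (A (g * g') e₁) = _
    rw [map_mul, LinearEquiv.mul_apply, hχe]
  set m : G → ℝ := fun g => ε₂ (A g e₂) with hm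
  set p : G → ℝ := fun g => ε₂ (A g e₁) with hp
  have hε₂A : ∀ g v, ε₂ (A g v) = p g * ℓ v + m g * ε₂ v := by
    intro g v
    conv_lhs => rw [hdec v]
    simp only [map_add, map_smul, h.eigen, hε₂, smul_eq_mul, hp, hm]
    ring
  have hmmul : ∀ g g', m (g * g') = m g * m g' := by
    intro g g'
    change ε₂ (A (g * g') e₂) = _
    rw [map_mul, LinearEquiv.mul_apply, hε₂A, hχe, hℓ₂]
    ring
  have hpmul : ∀ g g', p (g * g') = p g * χ g' + m g * p g' := by
    intro g g'
    change ε₂ (A (g * g') e₁) = _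
    rw [map_mul, LinearEquiv.mul_apply, hε₂A]
  have hm0 : ∀ g, m g ≠ 0 := by
    intro g h0
    have h1 := hmmul g g⁻¹
    rw [h0, zero_mul, mul_inv_cancel] at h1
    have h2 : m 1 = 1 := by simp [hm, hε₂₂]
    exact one_ne_zero (h2.symm.trans h1)
  have hφ0 : ∀ g, κ g / χ g ≠ 0 := fun g => (div_pos (h.κ_pos g) (hχ0 g)).ne'
  have hφmul : ∀ g g', κ (g * g') / χ (g * g') = κ g / χ g * (κ g' / χ g') := fun g g' => by
    rw [h.κ_mul, hχmul, mul_div_mul_comm]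
  let X : BaseAction G ℝ :=
    { a := fun g => m g / χ g
      b := fun g => p g / χ g
      A := scalarAction (fun g => κ g / χ g) hφ0 hφmul
      a_ne := fun g => div_ne_zero (hm0 g) (hχ0 g).ne'
      a_mul := fun g g' => by rw [hmmul, hχmul, mul_div_mul_comm]
      b_mul := fun g g' => by
        have h1 := (hχ0 g).ne'
        have h2 := (hχ0 g').ne'
        rw [hpmul, hχmul]
        field_simp
        ring }
  have hXA : ∀ g t, X.A g t = κ g / χ g * t := fun g t => rfl
  have hXact : ∀ g s, X.act g s = (m g * s + p g) / χ g := fun g s => by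
    change m g / χ g * s + p g / χ g = _
    ring
  set f : ℝ → ℝ := fun s => F (e₁ + s • e₂) with hf
  have hmem : ∀ s : ℝ, e₁ + s • e₂ ∈ shadow C c₀ := fun s => (hsh _).2 (by simp [hℓ₁, hℓ₂])
  have hfact : ∀ g s, f (X.act g s) = (κ g * f s + ε₀ (A g (e₁ + s • e₂))) / χ g := by
    intro g s
    have h1 := (hχ0 g).ne'
    have h2 : A g (e₁ + s • e₂) =
        χ g • (e₁ + X.act g s • e₂) + ε₀ (A g (e₁ + s • e₂)) • c₀ := by
      conv_lhs => rw [hdec (A g (e₁ + s • e₂)), hχe, hε₂A]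
      rw [hXact]
      simp only [map_add, map_smul, hℓ₁, hℓ₂, hε₂₁, hε₂₂, smul_add, smul_smul, smul_eq_mul,
        mul_div_cancel₀ _ h1]
      module
    have h3 := h.height_map g (hmem s)
    rw [h2, hC.height_add_smul h.mem h.ne (hC.shadow_smul (hχ0 g) (hmem _)),
      hC.height_smul h.mem h.ne (hmem _) (hχ0 g)] at h3
    rw [eq_div_iff h1]
    simp only [hf, hF]
    linarith
  have hprof : IsEquivariantProfile X (Ici 0) f := by
    refine ⟨isSolidCone_Ici, fun g c hc => ?_, ?_, fun r s => ?_, fun g r s => ?_, ?_, ?_⟩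
    · exact mul_nonneg (div_pos (h.κ_pos g) (hχ0 g)).le hc
    · exact hFc.comp_continuous (by fun_prop) hmem
    · have h1 := hC.height_add_le h.mem h.ne (hmem (s + r)) (hmem (s - r))
      have h2 : e₁ + (s + r) • e₂ + (e₁ + (s - r) • e₂) = (2 : ℝ) • (e₁ + s • e₂) := by module
      rw [h2, hC.height_smul h.mem h.ne (hmem s) two_pos] at h1
      simp only [secondDiff, mem_Ici, hf, smul_eq_mul, hF]
      linarith
    · unfold secondDiff
      rw [← X.act_add, show X.act g s - X.a g * r = X.act g (s - r) by
        rw [sub_eq_add_neg s r, X.act_add]; ring, hfact, hfact, hfact, hXA]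
      simp only [map_add, map_smul, smul_eq_mul]
      ring
    · have hKS : K ⊆ shadow C c₀ := h.subset.trans IsSolidCone.interior_subset_shadow
      have hℓK : ∀ k ∈ K, ℓ k ≠ 0 := fun k hk => (hpos k (h.subset hk)).ne'
      obtain ⟨J, hJ⟩ := h.compact.exists_bound_of_continuousOn (f := fun k => ε₂ k / ℓ k)
        (ε₂.continuous.continuousOn.div ℓ.continuous.continuousOn hℓK)
      refine ⟨J, (fun k => -F k / ℓ k) '' K, h.compact.image_of_continuousOn
        ((hFc.mono hKS).neg.div ℓ.continuous.continuousOn hℓK), ?_, fun s u hu => ?_⟩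
      · rintro _ ⟨k, hk, rfl⟩
        rw [interior_Ici]
        have := ((hC.mem_interior_iff_height h.mem h.ne).1 (h.subset hk)).2
        exact div_pos (neg_pos.2 this) (hpos k (h.subset hk))
      · rw [interior_Ici] at hu
        have hu : 0 < u := hu
        have hFv : F (e₁ + s • e₂ + (f s + u) • c₀) = -u := by
          rw [hF, hC.height_add_smul h.mem h.ne (hmem s)]
          ring
        have hvS := IsSolidCone.shadow_add_smul (f s + u) (hmem s)
        obtain ⟨g, hg⟩ := h.cocompact (e₁ + s • e₂ + (f s + u) • c₀)
          ((hC.mem_interior_iff_height h.mem h.ne).2 ⟨hvS, by rw [← hF, hFv]; linarith⟩)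
        have h1 : ℓ (A g (e₁ + s • e₂ + (f s + u) • c₀)) = χ g := by
          rw [hχe]; simp [hℓ, hℓ₁, hℓ₂]
        have h2 : ε₂ (A g (e₁ + s • e₂ + (f s + u) • c₀)) = m g * s + p g := by
          rw [hε₂A]; simp [hℓ, hℓ₁, hℓ₂, hε₂, hε₂₁, hε₂₂]; ring
        refine ⟨g, ?_, _, hg, ?_⟩
        · have := hJ _ hg
          rwa [h1, h2, ← hXact] at this
        · simp only [h1, hF, h.height_map g hvS]
          rw [← hF, hFv, hXA]
          ring
    · by_contra! hcon
      have hfc : Continuous f := hFc.comp_continuous (by fun_prop) hmem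
      have haff := affine_of_secondDiff_eq_zero hfc hcon
      set z := e₂ + (f 1 - f 0) • c₀ with hz
      have hmemC : ∀ t : ℝ, (e₁ + f 0 • c₀) + t • z ∈ C := by
        intro t
        have h1 := (hC.height_le_iff h.mem h.ne (hmem t)).1 le_rfl
        have h2 : height C c₀ (e₁ + t • e₂) = f 0 + t * (f 1 - f 0) := haff t
        rw [h2] at h1
        convert h1 using 1
        rw [hz]
        module
      have h1 : z ∈ C := hC.mem_of_add_nat_smul_mem fun n => hmemC n
      have h2 : -z ∈ C := hC.mem_of_add_nat_smul_mem (y := e₁ + f 0 • c₀) fun n => by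
        rw [smul_neg, ← neg_smul]
        exact hmemC (-n)
      have h3 := congrArg ε₂ (hC.pointed z h1 h2)
      simp [hz, hε₂, hε₂₂] at h3
  obtain ⟨c, hc, hc0, d, e, hfs⟩ := hprof.exists_quadratic
    ((Submodule.finrank_le _).trans (by rw [Module.finrank_self]; norm_num))
  have hc : 0 < c := lt_of_le_of_ne hc (Ne.symm hc0)
  refine ⟨ℓ, √c • ε₂, ε₀ - d • ε₂ - e • ℓ, hℓ, by simp [hε₂], by simp [hε₀, hε₂, hℓ],
    fun v => ?_⟩
  rw [hC.mem_interior_iff_height h.mem h.ne, hsh]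
  refine and_congr_right fun hv => ?_
  have hv0 := hv.ne'
  have h1 : v = ℓ v • (e₁ + (ε₂ v / ℓ v) • e₂) + ε₀ v • c₀ := by
    conv_lhs => rw [hdec v]
    rw [smul_add, smul_smul, mul_div_cancel₀ _ hv0]
    abel
  have h2 : height C c₀ v = ℓ v * f (ε₂ v / ℓ v) - ε₀ v := by
    conv_lhs => rw [h1]
    rw [hC.height_add_smul h.mem h.ne (hC.shadow_smul hv (hmem _)),
      hC.height_smul h.mem h.ne (hmem _) hv]
  have h3 : height C c₀ v * ℓ v =
      (√c * ε₂ v) ^ 2 - (ε₀ v - d * ε₂ v - e * ℓ v) * ℓ v := by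
    rw [h2, hfs, mul_pow, Real.sq_sqrt hc.le]
    simp only [smul_eq_mul]
    field_simp
    ring
  simp only [_root_.smul_apply, _root_.sub_apply, smul_eq_mul]
  rw [← sub_neg (b := (ε₀ v - d * ε₂ v - e * ℓ v) * ℓ v), ← h3]
  exact ⟨(mul_neg_of_neg_of_pos · hv), fun h => neg_of_mul_neg_left h hv.le⟩

end IsHomogeneousCone

/-- A three-dimensional homogeneous cone is an orthant or a quadratic cone. -/
theorem IsHomogeneousCone.classification {G V : Type*} [Group G] [NormedAddCommGroup V]
    [NormedSpace ℝ V] [FiniteDimensional ℝ V] {A : G →* (V ≃ₗ[ℝ] V)} {κ : G → ℝ} {C K : Set V}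
    {c₀ : V} (h : IsHomogeneousCone A κ C K c₀) (hV : Module.finrank ℝ V = 3) :
    ∃ ℓ₁ ℓ₂ ℓ₃ : V →L[ℝ] ℝ, ℓ₁ c₀ = 0 ∧ ℓ₂ c₀ = 0 ∧ ℓ₃ c₀ = 1 ∧
      ((∀ v, v ∈ interior C ↔ 0 < ℓ₁ v ∧ 0 < ℓ₂ v ∧ 0 < ℓ₃ v) ∨
        ∀ v, v ∈ interior C ↔ 0 < ℓ₁ v ∧ ℓ₂ v ^ 2 < ℓ₃ v * ℓ₁ v) := by
  obtain ⟨ℓ, hnn, hpos, hℓ⟩ := h.cone.exists_support h.mem (h.notMem_interior (by omega))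
  obtain ⟨x₀, hx₀⟩ := h.cone.interior_nonempty
  obtain ⟨e₁, e₂, ε₀, ε₂, hℓ₁, hℓ₂, hε₀, -, -, hε₂, hε₂₁, hε₂₂, hdec⟩ :=
    exists_coordinates hV h.ne hℓ (hpos _ hx₀).ne'
  by_cases hΦ : ∀ ℓ' : V →L[ℝ] ℝ, (∀ x ∈ C, 0 ≤ ℓ' x) → ℓ' c₀ = 0 → ℓ' e₂ = 0
  · obtain ⟨f₁, f₂, f₃, h1, h2, h3, h4⟩ :=
      h.exists_quadric hnn hpos hℓ hℓ₁ hℓ₂ hε₀ hε₂ hε₂₁ hε₂₂ hdec hΦ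
    exact ⟨f₁, f₂, f₃, h1, h2, h3, Or.inr h4⟩
  · push Not at hΦ
    obtain ⟨ℓb, hb, hb0, hbe⟩ := hΦ
    have hbe' : ℓb ((ℓb e₂)⁻¹ • e₂) = 1 := by rw [map_smul, smul_eq_mul, inv_mul_cancel₀ hbe]
    obtain ⟨f₁, f₂, f₃, h1, h2, h3, h4⟩ := h.exists_simplicial hnn hb hℓ hb0
      (e₁ := e₁ - ℓb e₁ • (ℓb e₂)⁻¹ • e₂) (e₂ := (ℓb e₂)⁻¹ • e₂) (fun u => ⟨ε₀ u, by
        have hbu : ℓb u = ℓ u * ℓb e₁ + ε₂ u * ℓb e₂ := by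
          conv_lhs => rw [hdec u]
          simp [hb0]
        have hu : ε₂ u • e₂ = (ε₂ u * ℓb e₂) • (ℓb e₂)⁻¹ • e₂ := by
          rw [smul_smul, mul_assoc, mul_inv_cancel₀ hbe, mul_one]
        conv_lhs => rw [hdec u, hu]
        rw [hbu]
        module⟩) hpos (by rw [map_smul, hℓ₂, smul_zero]) hbe'
    exact ⟨f₁, f₂, f₃, h1, h2, h3, Or.inl h4⟩

/-- An equivariant profile with values in a three-dimensional space is quadratic, and its
leading coefficient spans an invariant ray. -/
lemma IsEquivariantProfile.exists_homogeneous {G V : Type*} [Group G] [NormedAddCommGroup V]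
    [NormedSpace ℝ V] [FiniteDimensional ℝ V] {X : BaseAction G V} {C : Set V} {f : ℝ → V}
    (h : IsEquivariantProfile X C f) (hV : Module.finrank ℝ V = 3) :
    ∃ (K : Set V) (c d e : V), IsHomogeneousCone X.A (fun g => X.a g ^ 2) C K c ∧
      ∀ s, f s = s ^ 2 • c + s • d + e := by
  have hW := Submodule.finrank_lt (h.diffSpan_ne_top (by omega)).lt_top.ne
  obtain ⟨c, hc, hc0, d, e, hf⟩ := h.exists_quadratic (by omega)
  obtain ⟨J, K, hK, hKC, hco⟩ := h.cocompact
  refine ⟨K, c, d, e, ⟨h.cone, h.map_mem, fun g => ?_, hK, hKC, fun u hu => ?_, hc, hc0⟩, hf⟩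
  · have h1 := h.diff_map g 1 0
    have h2 : ∀ r s, secondDiff f r s = (2 * r ^ 2) • c := by
      intro r s
      unfold secondDiff
      rw [hf, hf, hf]
      module
    rw [h2, h2, map_smul] at h1
    refine smul_right_injective V (two_ne_zero (α := ℝ)) ?_
    linear_combination (norm := module) -h1
  · obtain ⟨g, -, hg⟩ := hco 0 u hu
    exact ⟨g, hg⟩

/-- The two normal forms of a fibered domain over a three-dimensional cone. -/
theorem IsFiberedDomain.classification {G V : Type*} [Group G] [NormedAddCommGroup V]
    [NormedSpace ℝ V] [FiniteDimensional ℝ V] {X : BaseAction G V} {w c : G → V} {C : Set V}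
    {Ω K : Set (ℝ × V)} (h : IsFiberedDomain X w c C Ω K) (hV : Module.finrank ℝ V = 3) :
    ∃ (d e : V) (ℓ₁ ℓ₂ ℓ₃ : V →L[ℝ] ℝ), (∀ v, ℓ₁ v = 0 → ℓ₂ v = 0 → ℓ₃ v = 0 → v = 0) ∧
      ((∀ s v, (s, v + s • d + e) ∈ Ω ↔ s ^ 2 < ℓ₃ v ∧ 0 < ℓ₁ v ∧ 0 < ℓ₂ v) ∨
        ∀ s v, (s, v + s • d + e) ∈ Ω ↔ 0 < ℓ₁ v ∧ ℓ₂ v ^ 2 < (ℓ₃ v - s ^ 2) * ℓ₁ v) := by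
  obtain ⟨f, hf, hΩ⟩ := h.exists_profile
  obtain ⟨K', c₀, d, e, hc, hfs⟩ := hf.exists_homogeneous hV
  obtain ⟨ℓ₁, ℓ₂, ℓ₃, h1, h2, h3, hC⟩ := hc.classification hV
  obtain ⟨u, hu⟩ := h.cone.interior_nonempty
  have hmem : ∀ s v, (s, v + s • d + e) ∈ Ω ↔ v - s ^ 2 • c₀ ∈ interior C := by
    intro s v
    rw [hΩ, hfs]
    congr! 1
    abel
  refine ⟨d, e, ℓ₁, ℓ₂, ℓ₃, fun v hv1 hv2 hv3 => ?_, ?_⟩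
  · have hline : ∀ t : ℝ, u + t • v ∈ C := by
      intro t
      refine interior_subset ?_
      rcases hC with hC | hC <;> rw [hC] at hu ⊢ <;> simpa [hv1, hv2, hv3] using hu
    refine h.cone.pointed v (h.cone.mem_of_add_nat_smul_mem fun n => hline n)
      (h.cone.mem_of_add_nat_smul_mem (y := u) fun n => ?_)
    rw [smul_neg, ← neg_smul]
    exact hline (-n)
  · refine hC.imp (fun hC s v => ?_) (fun hC s v => ?_)
    · rw [hmem, hC]
      simp only [map_sub, map_smul, h1, h2, h3, smul_eq_mul, mul_zero, mul_one, sub_zero, sub_pos]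
      tauto
    · rw [hmem, hC]
      simp only [map_sub, map_smul, h1, h2, h3, smul_eq_mul, mul_zero, mul_one, sub_zero]

/-- The group of affine automorphisms of the ambient space preserving a set. -/
def affineStabilizer {E : Type*} [AddCommGroup E] [Module ℝ E] (Ω : Set E) :
    Subgroup (E ≃ᵃ[ℝ] E) where
  carrier := {g | ∀ x, g x ∈ Ω ↔ x ∈ Ω}
  one_mem' _ := Iff.rfl
  mul_mem' hg hh x := (hg _).trans (hh x)
  inv_mem' {g} hg x := by
    rw [← hg, AffineEquiv.inv_def, AffineEquiv.apply_symm_apply]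

/-- The asymptotic cone of a set. -/
def recessionCone {E : Type*} [AddCommGroup E] [Module ℝ E] (Ω : Set E) : Set E :=
  {u | ∀ x ∈ Ω, ∀ t : ℝ, 0 ≤ t → x + t • u ∈ Ω}

namespace affineStabilizer

variable {E : Type*} [NormedAddCommGroup E] [NormedSpace ℝ E] {Ω : Set E}

lemma apply_eq (g : E ≃ᵃ[ℝ] E) (x : E) : g x = g.linear x + g 0 := by
  have := g.map_vadd 0 x
  simpa using this

lemma linear_mem_recessionCone (g : affineStabilizer Ω) {u : E} (hu : u ∈ recessionCone Ω) :
    (g : E ≃ᵃ[ℝ] E).linear u ∈ recessionCone Ω := by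
  intro x hx t ht
  obtain ⟨y, rfl⟩ := (g : E ≃ᵃ[ℝ] E).surjective x
  have h1 := (g.2 _).2 (hu y ((g.2 y).1 hx) t ht)
  rw [apply_eq] at h1 ⊢
  convert h1 using 1
  rw [map_add, map_smul]
  abel

lemma linear_mem_span (g : affineStabilizer Ω) {u : E}
    (hu : u ∈ Submodule.span ℝ (recessionCone Ω)) :
    (g : E ≃ᵃ[ℝ] E).linear u ∈ Submodule.span ℝ (recessionCone Ω) := by
  have h1 : Submodule.span ℝ (recessionCone Ω) ≤ (Submodule.span ℝ (recessionCone Ω)).comap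
      ((g : E ≃ᵃ[ℝ] E).linear : E →ₗ[ℝ] E) :=
    Submodule.span_le.2 fun v hv => Submodule.subset_span (linear_mem_recessionCone g hv)
  exact h1 hu

lemma linear_mul (g h : affineStabilizer Ω) (v : E) :
    ((g * h : affineStabilizer Ω) : E ≃ᵃ[ℝ] E).linear v =
      (g : E ≃ᵃ[ℝ] E).linear ((h : E ≃ᵃ[ℝ] E).linear v) := rfl

lemma linear_one (v : E) : ((1 : affineStabilizer Ω) : E ≃ᵃ[ℝ] E).linear v = v := rfl

/-- The linear action on the span of the asymptotic cone. -/
def spanAction (Ω : Set E) :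
    affineStabilizer Ω →* (Submodule.span ℝ (recessionCone Ω) ≃ₗ[ℝ]
      Submodule.span ℝ (recessionCone Ω)) :=
  MonoidHom.mk' (fun g => LinearEquiv.ofLinearMap
    (((g : E ≃ᵃ[ℝ] E).linear : E →ₗ[ℝ] E).restrict fun _ hu => linear_mem_span g hu)
    ((((g⁻¹ : affineStabilizer Ω) : E ≃ᵃ[ℝ] E).linear : E →ₗ[ℝ] E).restrict
      fun _ hu => linear_mem_span g⁻¹ hu)
    (by
      ext v
      change (g : E ≃ᵃ[ℝ] E).linear (((g⁻¹ : affineStabilizer Ω) : E ≃ᵃ[ℝ] E).linear v) = v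
      rw [← linear_mul, mul_inv_cancel, linear_one])
    (by
      ext v
      change ((g⁻¹ : affineStabilizer Ω) : E ≃ᵃ[ℝ] E).linear ((g : E ≃ᵃ[ℝ] E).linear v) = v
      rw [← linear_mul, inv_mul_cancel, linear_one])) fun g h => by
    ext v
    exact linear_mul g h v

variable {φ : E →ₗ[ℝ] ℝ} {e₀ : E}

lemma apply_linear (hφ : LinearMap.ker φ = Submodule.span ℝ (recessionCone Ω)) (he : φ e₀ = 1)
    (g : affineStabilizer Ω) (x : E) :
    φ ((g : E ≃ᵃ[ℝ] E).linear x) = φ ((g : E ≃ᵃ[ℝ] E).linear e₀) * φ x := by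
  have h1 : x - φ x • e₀ ∈ Submodule.span ℝ (recessionCone Ω) := by
    rw [← hφ, LinearMap.mem_ker]
    simp [he]
  have h2 := linear_mem_span g h1
  rw [← hφ, LinearMap.mem_ker, map_sub, map_smul, map_sub, map_smul, smul_eq_mul] at h2
  linarith

/-- The action on the line obtained by dividing by the span of the asymptotic cone. -/
def baseAction (hφ : LinearMap.ker φ = Submodule.span ℝ (recessionCone Ω)) (he : φ e₀ = 1) :
    BaseAction (affineStabilizer Ω) (Submodule.span ℝ (recessionCone Ω)) where
  a g := φ ((g : E ≃ᵃ[ℝ] E).linear e₀)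
  b g := φ ((g : E ≃ᵃ[ℝ] E) 0)
  A := spanAction Ω
  a_ne g h0 := by
    have h1 := apply_linear hφ he g (((g⁻¹ : affineStabilizer Ω) : E ≃ᵃ[ℝ] E).linear e₀)
    rw [h0, zero_mul, ← linear_mul, mul_inv_cancel, linear_one, he] at h1
    exact one_ne_zero h1
  a_mul g h := by rw [linear_mul, apply_linear hφ he]
  b_mul g h := by
    change φ ((g : E ≃ᵃ[ℝ] E) ((h : E ≃ᵃ[ℝ] E) 0)) = _
    rw [apply_eq, map_add, apply_linear hφ he]

/-- The component in the kernel of `φ` along `e₀`. -/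
def component (hφ : LinearMap.ker φ = Submodule.span ℝ (recessionCone Ω)) (he : φ e₀ = 1) :
    E →ₗ[ℝ] Submodule.span ℝ (recessionCone Ω) :=
  (LinearMap.id - φ.smulRight e₀).codRestrict _ fun x => by
    rw [← hφ, LinearMap.mem_ker]
    simp [he]

lemma coe_component (hφ : LinearMap.ker φ = Submodule.span ℝ (recessionCone Ω)) (he : φ e₀ = 1)
    (x : E) : (component hφ he x : E) = x - φ x • e₀ := rfl

lemma isSolidCone_recessionCone [FiniteDimensional ℝ E] (ho : IsOpen Ω) (hc : Convex ℝ Ω)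
    (hne : Ω.Nonempty) (hl : ¬ ∃ x ∈ Ω, ∃ v : E, v ≠ 0 ∧ ∀ t : ℝ, x + t • v ∈ Ω) :
    IsSolidCone ((↑) ⁻¹' recessionCone Ω : Set (Submodule.span ℝ (recessionCone Ω))) := by
  obtain ⟨x₀, hx₀⟩ := hne
  have hclosed : IsClosed (recessionCone Ω) := by
    refine IsSeqClosed.isClosed fun u d hu hd => ?_
    refine recession_of_tendsto ho hc (x := fun n => x₀ + (n : ℝ) • u n) (t := fun n : ℕ => (n : ℝ))
      (fun n => subset_closure (hu n x₀ hx₀ n n.cast_nonneg)) tendsto_natCast_atTop_atTop ?_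
    have h1 : Tendsto (fun n : ℕ => ((n : ℝ))⁻¹ • x₀ + u n) atTop (𝓝 ((0 : ℝ) • x₀ + d)) :=
      ((tendsto_inv_atTop_zero.comp tendsto_natCast_atTop_atTop).smul_const x₀).add hd
    rw [zero_smul, zero_add] at h1
    refine h1.congr' ?_
    filter_upwards [eventually_gt_atTop 0] with n hn
    rw [smul_add, inv_smul_smul₀ (by positivity)]
  have hadd : ∀ u ∈ recessionCone Ω, ∀ v ∈ recessionCone Ω, u + v ∈ recessionCone Ω := by
    intro u hu v hv x hx t ht
    rw [smul_add, ← add_assoc]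
    exact hv _ (hu x hx t ht) t ht
  have hsmul : ∀ r : ℝ, 0 ≤ r → ∀ u ∈ recessionCone Ω, r • u ∈ recessionCone Ω := by
    intro r hr u hu x hx t ht
    rw [smul_smul]
    exact hu x hx _ (mul_nonneg ht hr)
  refine ⟨hclosed.preimage continuous_subtype_val, fun u hu v hv => hadd u hu v hv,
    fun r hr u hu => hsmul r hr u hu, fun u hu hu' => ?_, ?_⟩
  · by_contra hne
    refine hl ⟨x₀, hx₀, u, fun h => hne (Subtype.ext h), fun t => ?_⟩
    rcases le_total 0 t with ht | ht
    · exact hu x₀ hx₀ t ht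
    · have := hu' x₀ hx₀ (-t) (neg_nonneg.2 ht)
      simpa using this
  · have h0 : (0 : Submodule.span ℝ (recessionCone Ω)) ∈
        ((↑) ⁻¹' recessionCone Ω : Set (Submodule.span ℝ (recessionCone Ω))) := by
      intro x hx t _
      simpa using hx
    have hcv : Convex ℝ ((↑) ⁻¹' recessionCone Ω : Set (Submodule.span ℝ (recessionCone Ω))) :=
      fun u hu v hv a b ha hb _ => hadd _ (hsmul a ha _ hu) _ (hsmul b hb _ hv)
    rw [hcv.interior_nonempty_iff_affineSpan_eq_top, ← insert_eq_of_mem h0]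
    apply SetLike.coe_injective
    rw [affineSpan_insert_zero, Submodule.span_span_coe_preimage]
    rfl

/-- A quasi-homogeneous domain fibers over the quotient by the span of its asymptotic cone when
this span is a hyperplane. -/
theorem isFiberedDomain [FiniteDimensional ℝ E] (ho : IsOpen Ω) (hc : Convex ℝ Ω)
    (hne : Ω.Nonempty) (hl : ¬ ∃ x ∈ Ω, ∃ v : E, v ≠ 0 ∧ ∀ t : ℝ, x + t • v ∈ Ω)
    {K : Set E} (hK : IsCompact K) (hKΩ : K ⊆ Ω)
    (hco : ∀ x ∈ Ω, ∃ g : affineStabilizer Ω, (g : E ≃ᵃ[ℝ] E) x ∈ K)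
    (hφ : LinearMap.ker φ = Submodule.span ℝ (recessionCone Ω)) (he : φ e₀ = 1) :
    IsFiberedDomain (baseAction hφ he)
      (fun g => component hφ he ((g : E ≃ᵃ[ℝ] E).linear e₀))
      (fun g => component hφ he ((g : E ≃ᵃ[ℝ] E) 0))
      ((↑) ⁻¹' recessionCone Ω)
      {p : ℝ × Submodule.span ℝ (recessionCone Ω) | p.1 • e₀ + (p.2 : E) ∈ Ω}
      ((fun x => (φ x, component hφ he x)) '' K) := by
  have hφV : ∀ v : Submodule.span ℝ (recessionCone Ω), φ v = 0 := fun v =>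
    LinearMap.mem_ker.1 (hφ.ge v.2)
  have key : ∀ (g : affineStabilizer Ω) (s : ℝ) (v : Submodule.span ℝ (recessionCone Ω)),
      (baseAction hφ he).act g s • e₀ + (((baseAction hφ he).A g v +
        s • component hφ he ((g : E ≃ᵃ[ℝ] E).linear e₀) +
        component hφ he ((g : E ≃ᵃ[ℝ] E) 0) : Submodule.span ℝ (recessionCone Ω)) : E) =
      (g : E ≃ᵃ[ℝ] E) (s • e₀ + v) := by
    intro g s v
    have h1 : (baseAction hφ he).act g s =
        φ ((g : E ≃ᵃ[ℝ] E).linear e₀) * s + φ ((g : E ≃ᵃ[ℝ] E) 0) := rfl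
    have h2 : (((baseAction hφ he).A g v : Submodule.span ℝ (recessionCone Ω)) : E) =
        (g : E ≃ᵃ[ℝ] E).linear v := rfl
    rw [apply_eq (g : E ≃ᵃ[ℝ] E) (s • e₀ + v), h1]
    simp only [Submodule.coe_add, Submodule.coe_smul, h2, coe_component, map_add, map_smul]
    module
  refine ⟨?_, ?_, ?_, isSolidCone_recessionCone ho hc hne hl, fun d => ⟨fun hd => ?_, ?_⟩,
    fun g s v => ?_, ?_, ?_, fun s v hv => ?_⟩
  · exact ho.preimage (by fun_prop)
  · intro p hp q hq a b ha hb hab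
    have := hc hp hq ha hb hab
    rw [mem_ofPred_eq]
    convert this using 1
    simp only [Prod.fst_add, Prod.smul_fst, Prod.snd_add, Prod.smul_snd, Submodule.coe_add,
      Submodule.coe_smul, smul_eq_mul]
    module
  · obtain ⟨x, hx⟩ := hne
    refine ⟨(φ x, component hφ he x), ?_⟩
    rw [mem_ofPred_eq, coe_component]
    simpa using hx
  · have h1 : d.1 • e₀ + (d.2 : E) ∈ recessionCone Ω := by
      intro x hx t ht
      have := hd (φ x, component hφ he x) (by
        rw [mem_ofPred_eq, coe_component]
        simpa using hx) t ht
      rw [mem_ofPred_eq] at this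
      convert this using 1
      simp only [Prod.fst_add, Prod.smul_fst, Prod.snd_add, Prod.smul_snd, Submodule.coe_add,
        Submodule.coe_smul, smul_eq_mul, coe_component]
      module
    have h2 : d.1 = 0 := by
      have := LinearMap.mem_ker.1 (hφ.ge (Submodule.subset_span (R := ℝ) h1))
      rw [map_add, map_smul, he, hφV] at this
      simpa using this
    rw [h2, zero_smul, zero_add] at h1
    exact ⟨h2, h1⟩
  · rintro ⟨h1, h2⟩ p hp t ht
    have := h2 _ hp t ht
    rw [mem_ofPred_eq]
    convert this using 1
    simp only [Prod.fst_add, Prod.smul_fst, Prod.snd_add, Prod.smul_snd, Submodule.coe_add,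
      Submodule.coe_smul, smul_eq_mul, h1]
    module
  · simp only [mem_ofPred_eq, key]
    exact g.2 _
  · refine hK.image ?_
    have h1 := φ.continuous_of_finiteDimensional
    have h2 := (component hφ he).continuous_of_finiteDimensional
    exact h1.prodMk h2
  · rintro _ ⟨x, hx, rfl⟩
    rw [mem_ofPred_eq, coe_component]
    simpa using hKΩ hx
  · obtain ⟨g, hg⟩ := hco _ hv
    refine ⟨g, _, hg, ?_⟩
    simp only
    rw [← key]
    ext
    · simp [he, hφV]
    · simp [coe_component, he, hφV]

end affineStabilizer

/-- An affine-form matrix acts by an affine equivalence. -/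
lemma exists_affineEquiv_of_isAffineForm {n : ℕ} {g : GL (Fin (n + 1)) ℝ}
    (hg : IsAffineForm n g) : ∃ e : (Fin n → ℝ) ≃ᵃ[ℝ] (Fin n → ℝ), ∀ x, e x = affAct n g x := by
  set B : Matrix (Fin n) (Fin n) ℝ := Matrix.of fun i j => g.val i.castSucc j.castSucc with hB
  have hinj : Function.Injective (Matrix.toLin' B) := by
    rw [← LinearMap.ker_eq_bot, LinearMap.ker_eq_bot']
    intro y hy
    have h1 : g.val *ᵥ (Fin.snoc y 0 : Fin (n + 1) → ℝ) = 0 := by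
      funext i
      rw [Matrix.mulVec, dotProduct, Fin.sum_univ_castSucc]
      simp only [Fin.snoc_castSucc, Fin.snoc_last, mul_zero, add_zero, Pi.zero_apply]
      refine Fin.lastCases ?_ (fun j => ?_) i
      · simp [hg.1]
      · exact congrFun hy j
    have h2 : (Fin.snoc y 0 : Fin (n + 1) → ℝ) = 0 := by
      have := congrArg (fun z => (g⁻¹).val *ᵥ z) h1
      simpa only [Matrix.mulVec_mulVec, ← Units.val_mul, inv_mul_cancel, Units.val_one,
        Matrix.one_mulVec, Matrix.mulVec_zero] using this
    funext j
    have := congrFun h2 j.castSucc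
    simpa using this
  refine ⟨(LinearEquiv.ofInjectiveEndo _ hinj).toAffineEquiv.trans
    (AffineEquiv.constVAdd ℝ _ fun i => g.val i.castSucc (Fin.last n)), fun x => ?_⟩
  funext i
  simp [affAct, hB, Matrix.mulVec, dotProduct, add_comm]

lemma exists_affineStabilizer {n : ℕ} {Ω K : Set (Fin n → ℝ)}
    (hK : (⋃ g ∈ AutSet n Ω, affAct n g '' K) = Ω) {x : Fin n → ℝ} (hx : x ∈ Ω) :
    ∃ g : affineStabilizer Ω, (g : (Fin n → ℝ) ≃ᵃ[ℝ] (Fin n → ℝ)) x ∈ K := by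
  rw [← hK] at hx
  simp only [mem_iUnion] at hx
  obtain ⟨g, hg, k, hk, rfl⟩ := hx
  obtain ⟨e, he⟩ := exists_affineEquiv_of_isAffineForm hg.1
  have himg : e '' Ω = Ω := by
    rw [show (e : (Fin n → ℝ) → Fin n → ℝ) = affAct n g from funext he]
    exact hg.2
  have hes : e ∈ affineStabilizer Ω := by
    intro y
    constructor
    · intro hy
      rw [← himg] at hy
      obtain ⟨z, hz, hzy⟩ := hy
      rwa [← e.injective hzy]
    · intro hy
      rw [← himg]
      exact mem_image_of_mem e hy
  refine ⟨⟨e, hes⟩⁻¹, ?_⟩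
  rw [← he]
  change e⁻¹ (e k) ∈ K
  rwa [AffineEquiv.inv_def, AffineEquiv.symm_apply_apply]

/-- A hyperplane is the kernel of a functional. -/
lemma exists_functional_of_finrank {E : Type*} [AddCommGroup E] [Module ℝ E]
    [FiniteDimensional ℝ E] {W : Submodule ℝ E}
    (hW : Module.finrank ℝ W + 1 = Module.finrank ℝ E) :
    ∃ (φ : E →ₗ[ℝ] ℝ) (e : E), LinearMap.ker φ = W ∧ φ e = 1 := by
  have hlt : W < ⊤ := lt_of_le_of_ne le_top fun h => by
    rw [h, finrank_top] at hW
    omega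
  obtain ⟨φ, hφ, hle⟩ := W.exists_le_ker_of_lt_top hlt
  obtain ⟨x, hx⟩ : ∃ x, φ x ≠ 0 := by
    by_contra! h
    exact hφ (LinearMap.ext h)
  refine ⟨φ, (φ x)⁻¹ • x, (Submodule.eq_of_le_of_finrank_le hle ?_).symm, by simp [hx]⟩
  have hker : LinearMap.ker φ < ⊤ := lt_of_le_of_ne le_top fun h =>
    hx (LinearMap.mem_ker.1 (h ▸ Submodule.mem_top))
  have := Submodule.finrank_lt hker.ne
  omega

lemma affinelyEquivalent_of_forall {n : ℕ} {Ω Ω' : Set (Fin n → ℝ)}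
    (T : (Fin n → ℝ) →ₗ[ℝ] (Fin n → ℝ)) (hT : ∀ x, T x = 0 → x = 0) (p : Fin n → ℝ)
    (h : ∀ x, x + p ∈ Ω ↔ T x ∈ Ω') : AffinelyEquivalent n Ω Ω' := by
  have hinj : Function.Injective T := LinearMap.ker_eq_bot.1 (LinearMap.ker_eq_bot'.2 hT)
  set e := (AffineEquiv.constVAdd ℝ (Fin n → ℝ) (-p)).trans
    (LinearEquiv.ofInjectiveEndo _ hinj).toAffineEquiv with he
  have hex : ∀ x, e x = T (x - p) := fun x => by
    simp [he, sub_eq_neg_add]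
  have hmem : ∀ x, x ∈ Ω ↔ e x ∈ Ω' := fun x => by
    rw [hex, ← h, sub_add_cancel]
  refine ⟨e, Subset.antisymm ?_ fun y hy => ?_⟩
  · rintro _ ⟨x, hx, rfl⟩
    exact (hmem x).1 hx
  · obtain ⟨x, rfl⟩ := e.surjective y
    exact mem_image_of_mem e ((hmem x).2 hy)

/-- classification of properly convex quasi-homogeneous affine domains
in ℝ⁴ with 3-dimensional asymptotic cone. -/
theorem dim4_asympCone_three (Ω : Set (Fin 4 → ℝ))
    (h1 : IsProperlyConvexDomain 4 Ω) (h2 : IsQuasiHomogeneous 4 Ω)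
    (hAC : Module.finrank ℝ (Submodule.span ℝ (asympCone 4 Ω)) = 3) :
    AffinelyEquivalent 4 Ω
        {x : Fin 4 → ℝ | x 0 ^ 2 < x 1 ∧ 0 < x 2 ∧ 0 < x 3} ∨
      AffinelyEquivalent 4 Ω
        {x : Fin 4 → ℝ | 0 < x 2 ∧ x 3 ^ 2 < (x 1 - x 0 ^ 2) * x 2} := by
  obtain ⟨⟨hne, ho, hc⟩, hl⟩ := h1
  obtain ⟨K, hK, hKΩ, hco⟩ := h2
  have hAC' : Module.finrank ℝ (Submodule.span ℝ (recessionCone Ω)) = 3 := hAC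
  obtain ⟨φ, e₀, hφ, he⟩ := exists_functional_of_finrank
    (W := Submodule.span ℝ (recessionCone Ω)) (by rw [hAC']; simp)
  have hfib := affineStabilizer.isFiberedDomain ho hc hne hl hK hKΩ
    (fun x hx => exists_affineStabilizer hco hx) hφ he
  obtain ⟨d, e, ℓ₁, ℓ₂, ℓ₃, hinj, hcases⟩ := hfib.classification hAC'
  set q : (Fin 4 → ℝ) →ₗ[ℝ] Submodule.span ℝ (recessionCone Ω) :=
    affineStabilizer.component hφ he - φ.smulRight d with hq
  have hqx : ∀ x, x = φ x • e₀ + ((q x + φ x • d : Submodule.span ℝ (recessionCone Ω)) :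
      Fin 4 → ℝ) := fun x => by
    simp [hq, affineStabilizer.coe_component]
  set T : (Fin 4 → ℝ) →ₗ[ℝ] (Fin 4 → ℝ) :=
    LinearMap.pi ![φ, ℓ₃.toLinearMap ∘ₗ q, ℓ₁.toLinearMap ∘ₗ q, ℓ₂.toLinearMap ∘ₗ q] with hT
  have hT0 : ∀ x, T x 0 = φ x := fun x => rfl
  have hT1 : ∀ x, T x 1 = ℓ₃ (q x) := fun x => rfl
  have hT2 : ∀ x, T x 2 = ℓ₁ (q x) := fun x => rfl
  have hT3 : ∀ x, T x 3 = ℓ₂ (q x) := fun x => rfl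
  have hTinj : ∀ x, T x = 0 → x = 0 := by
    intro x hx
    have hq0 : q x = 0 := hinj _ (by rw [← hT2, hx]; rfl) (by rw [← hT3, hx]; rfl)
      (by rw [← hT1, hx]; rfl)
    have hφ0 : φ x = 0 := by rw [← hT0, hx]; rfl
    rw [hqx x, hq0, hφ0]
    simp
  have hmem : ∀ x, x + (e : Fin 4 → ℝ) ∈ Ω ↔ (φ x, q x + φ x • d + e) ∈
      {p : ℝ × Submodule.span ℝ (recessionCone Ω) | p.1 • e₀ + (p.2 : Fin 4 → ℝ) ∈ Ω} := by
    intro x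
    rw [mem_ofPred_eq]
    conv_lhs => rw [hqx x]
    rw [add_assoc, ← Submodule.coe_add]
  refine hcases.imp (fun h => ?_) (fun h => ?_)
  · refine affinelyEquivalent_of_forall T hTinj e fun x => ?_
    rw [hmem, h, mem_ofPred_eq, hT0, hT1, hT2, hT3]
  · refine affinelyEquivalent_of_forall T hTinj e fun x => ?_
    rw [hmem, h, mem_ofPred_eq, hT0, hT1, hT2, hT3]
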